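/- For every r₀ > 0 there exists a constant C = C(r₀) > 0 with the following property: if Ω ⊆ ℝ² is a non-special bounded convex polygonal domain with all edges of length 1 such that, for each vertex p of Ω, the open disk D(p, r₀) intersects the frontier of Ω only along the two edges having p as an endpoint, and u is a Jenkins–Serrin graph on Ω, then the Gauss curvature of the graph of u, K = (∂₁₁u · ∂₂₂u − (∂₁₂u)²)/(1 + ‖∇u‖²)², satisfies |K(p)| ≤ C for every p ∈ Ω. (Since conjugation preserves Gauss curvature, the same bound holds for the Gauss curvature of the associated saddle tower.) -/

import Mathlib

open Set Filter Topology Metric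
open scoped RealInnerProductSpace

noncomputable section

/-- The plane `ℝ²` with the Euclidean metric. -/
abbrev Pt : Type := EuclideanSpace ℝ (Fin 2)

/-- The point of `ℝ²` with coordinates `(a, b)`. -/
def vec2 (a b : ℝ) : Pt := (WithLp.equiv 2 (Fin 2 → ℝ)).symm ![a, b]

/-- `W_u = √(1 + ‖∇u‖²)`. -/
def Wu (u : Pt → ℝ) (p : Pt) : ℝ := Real.sqrt (1 + ‖gradient u p‖ ^ 2)

/-- The conjugate vector field `F_u = (−∂₂u/W_u, ∂₁u/W_u)` of a minimal graph `u`. -/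
def conjField (u : Pt → ℝ) (p : Pt) : Pt :=
  (Wu u p)⁻¹ • vec2 (-(gradient u p 1)) (gradient u p 0)

/-- `u` is a minimal graph on the open set `Ω`: it is `C²` on `Ω` and satisfies the minimal
surface equation `div (∇u / √(1 + ‖∇u‖²)) = 0` there, the divergence being the sum of the
partial derivatives of the components of the normalized gradient field. -/
def MinimalGraph (Ω : Set Pt) (u : Pt → ℝ) : Prop :=
  IsOpen Ω ∧ ContDiffOn ℝ 2 u Ω ∧
    ∀ p ∈ Ω, (∑ i : Fin 2,
      fderiv ℝ (fun q => (Wu u q)⁻¹ • gradient u q) p (EuclideanSpace.single i 1) i) = 0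

/-- `ψ` is a conjugate function of `u` on `Ω`: it is differentiable with `∇ψ = F_u` on `Ω`. -/
def IsConjugate (Ω : Set Pt) (u ψ : Pt → ℝ) : Prop :=
  ∀ p ∈ Ω, DifferentiableAt ℝ ψ p ∧ gradient ψ p = conjField u p

/-- The planar cross product `v₁ w₂ − v₂ w₁`. -/
def cross2 (v w : Pt) : ℝ := v 0 * w 1 - v 1 * w 0

/-- A bounded convex polygonal domain with `2n` edges, all of length one, whose vertices
`vtx 0, vtx 1, …` are listed in positively oriented cyclic order. -/
structure UnitPolygon (n : ℕ) : Type where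
  n_ge : 2 ≤ n
  Ω : Set Pt
  vtx : ZMod (2 * n) → Pt
  isOpen : IsOpen Ω
  convex : Convex ℝ Ω
  isBounded : Bornology.IsBounded Ω
  nonempty : Ω.Nonempty
  inj : Function.Injective vtx
  unit_edges : ∀ i, dist (vtx i) (vtx (i + 1)) = 1
  frontier_eq : frontier Ω = ⋃ i, segment ℝ (vtx i) (vtx (i + 1))
  pos_orient : ∀ i, 0 ≤ cross2 (vtx (i + 1) - vtx i) (vtx (i + 2) - vtx (i + 1))

/-- A bounded unit polygon with `2n` edges is special if `n ≥ 3` and its boundary is a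
parallelogram with two sides of length one and two sides of length `n − 1`. -/
def UnitPolygon.IsSpecial {n : ℕ} (P : UnitPolygon n) : Prop :=
  3 ≤ n ∧ ∃ q v w : Pt, ‖v‖ = 1 ∧ ‖w‖ = (n : ℝ) - 1 ∧
    frontier P.Ω = segment ℝ q (q + v) ∪ segment ℝ (q + v) (q + v + w) ∪
      segment ℝ (q + v + w) (q + w) ∪ segment ℝ (q + w) q

/-- The Jenkins–Serrin graph on a unit polygon: a minimal graph taking boundary values
`+∞` on the edges `(vtx (2i), vtx (2i+1))` and `−∞` on the edges `(vtx (2i−1), vtx (2i))`. -/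
def JSGraph {n : ℕ} (P : UnitPolygon n) (u : Pt → ℝ) : Prop :=
  MinimalGraph P.Ω u ∧
    ∀ i : ZMod (2 * n), ∀ t ∈ openSegment ℝ (P.vtx i) (P.vtx (i + 1)),
      (Even i.val → Tendsto u (𝓝[P.Ω] t) atTop) ∧
      (¬ Even i.val → Tendsto u (𝓝[P.Ω] t) atBot)

/-- The partial derivative `∂ᵢu`. -/
def pd (i : Fin 2) (u : Pt → ℝ) (p : Pt) : ℝ := fderiv ℝ u p (EuclideanSpace.single i 1)

/-- The Gauss curvature of the graph of `u`:
`K = (∂₁₁u ∂₂₂u − (∂₁₂u)²) / (1 + ‖∇u‖²)²`. -/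
def gaussK (u : Pt → ℝ) (p : Pt) : ℝ :=
  (pd 0 (pd 0 u) p * pd 1 (pd 1 u) p - (pd 1 (pd 0 u) p) ^ 2) /
    (1 + ‖gradient u p‖ ^ 2) ^ 2

/-- Borel–Carathéodory type bound for functions with positive real part. -/
theorem hp_deriv_le {f : ℂ → ℂ} {c : ℂ} {R : ℝ} (hR : 0 < R)
    (hf : DifferentiableOn ℂ f (ball c R)) (hpos : ∀ z ∈ ball c R, 0 < (f z).re) :
    ‖deriv f c‖ ≤ 2 * (f c).re / R := by
  have hc : c ∈ ball c R := mem_ball_self hR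
  have hne : ∀ z ∈ ball c R, f z + (starRingEnd ℂ) (f c) ≠ 0 := by
    intro z hz h
    have h1 := hpos z hz
    have h2 := hpos c hc
    have := congrArg Complex.re h
    simp at this
    linarith
  set φ : ℂ → ℂ := fun z => (f z - f c) / (f z + (starRingEnd ℂ) (f c)) with hφ
  have hφc : φ c = 0 := by simp [hφ]
  have hd : DifferentiableOn ℂ φ (ball c R) :=
    (hf.sub_const _).div (hf.add_const _) hne
  have hm : MapsTo φ (ball c R) (closedBall (φ c) 1) := by
    intro z hz
    rw [hφc, mem_closedBall, dist_zero_right]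
    simp only [hφ, norm_div]
    rw [div_le_one (norm_pos_iff.2 (hne z hz))]
    rw [← sq_le_sq₀ (norm_nonneg _) (norm_nonneg _), ← Complex.normSq_eq_norm_sq,
      ← Complex.normSq_eq_norm_sq]
    simp only [Complex.normSq_apply, Complex.sub_re, Complex.sub_im, Complex.add_re,
      Complex.add_im, Complex.conj_re, Complex.conj_im]
    nlinarith [mul_pos (hpos z hz) (hpos c hc)]
  have key := Complex.norm_deriv_le_div_of_mapsTo_ball hd hm hR
  have hfd : HasDerivAt f (deriv f c) c :=
    (hf.differentiableAt (isOpen_ball.mem_nhds hc)).hasDerivAt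
  have h2 := (hfd.sub_const (f c)).div (hfd.add_const ((starRingEnd ℂ) (f c))) (hne c hc)
  have h3 : deriv φ c = deriv f c / (f c + (starRingEnd ℂ) (f c)) := by
    have : deriv φ c = _ := h2.deriv
    rw [this]
    have := hne c hc
    field_simp
    ring
  rw [h3, norm_div, Complex.add_conj, Complex.norm_real, Real.norm_eq_abs,
    abs_of_pos (by linarith [hpos c hc])] at key
  have h2p : 0 < 2 * (f c).re := by linarith [hpos c hc]
  rw [div_le_div_iff₀ h2p hR] at key
  rw [le_div_iff₀ hR]
  linarith

theorem strip_lemma {f f' : ℂ → ℂ} {β C : ℝ} (hβ : 0 < β) (hC : 0 < C)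
    (hf : ∀ z : ℂ, 0 < z.re → z.re < β → HasDerivAt f (f' z) z)
    (hre : ∀ z : ℂ, 0 < z.re → z.re < β → |(f z).re| ≤ C * z.re)
    (him : ∀ z : ℂ, 0 < z.re → z.re < β → 0 < (f' z).im)
    {z : ℂ} (hz : 0 < z.re) (hz2 : z.re ≤ β / 2) : ‖deriv f' z‖ ≤ 24 * C / β := by
  -- balls
  have hball : ∀ z : ℂ, z.re ≤ β / 2 → ∀ w ∈ ball z z.re, 0 < w.re ∧ w.re < β ∧ w.re < 2 * z.re := by
    intro z hz w hw
    rw [mem_ball, dist_eq_norm] at hw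
    have := Complex.abs_re_le_norm (w - z)
    rw [Complex.sub_re] at this
    have h1 := abs_le.1 this
    refine ⟨by linarith, by linarith, by linarith⟩
  -- (a)
  have hA : ∀ z : ℂ, 0 < z.re → z.re ≤ β / 2 → ‖f' z‖ ≤ 6 * C := by
    intro z hz hz2
    have hd : DifferentiableOn ℂ (fun w => f w + ((2 * C * z.re : ℝ) : ℂ)) (ball z z.re) := by
      intro w hw
      obtain ⟨h1, h2, _⟩ := hball z hz2 w hw
      exact ((hf w h1 h2).differentiableAt.add_const _).differentiableWithinAt
    have hp : ∀ w ∈ ball z z.re, 0 < (f w + ((2 * C * z.re : ℝ) : ℂ)).re := by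
      intro w hw
      obtain ⟨h1, h2, h3⟩ := hball z hz2 w hw
      have := (abs_le.1 (hre w h1 h2)).1
      rw [Complex.add_re, Complex.ofReal_re]
      nlinarith
    have h := hp_deriv_le hz hd hp
    have hzz : z.re < β := by linarith
    have he : deriv (fun w => f w + ((2 * C * z.re : ℝ) : ℂ)) z = f' z :=
      ((hf z hz hzz).add_const _).deriv
    rw [he] at h
    refine h.trans ?_
    rw [div_le_iff₀ hz, Complex.add_re, Complex.ofReal_re]
    have := (abs_le.1 (hre z hz hzz)).2
    nlinarith
  -- (b)
  have hB : ∀ z : ℂ, 0 < z.re → z.re ≤ β / 2 → ∀ ε : ℝ, 0 < ε →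
      (f z).re - (f (z + ε * Complex.I)).re ≤ 12 * C / β * ε * z.re := by
    intro z hz hz2 ε hε
    set h : ℂ → ℂ := fun w => f w - f (w + ε * Complex.I) - ((12 * C / β * ε : ℝ) : ℂ) * w with hh
    have hhre : ∀ w, (h w).re = (f w).re - (f (w + ε * Complex.I)).re - 12 * C / β * ε * w.re := by
      intro w; simp only [hh, Complex.sub_re, Complex.re_ofReal_mul]
    have hadd : ∀ w : ℂ, (w + ε * Complex.I).re = w.re := by intro w; simp
    have hhd : ∀ w : ℂ, 0 < w.re → w.re < β → DifferentiableAt ℂ h w := by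
      intro w h1 h2
      have e1 := (hf w h1 h2).differentiableAt
      have e2 : DifferentiableAt ℂ (fun w => f (w + ε * Complex.I)) w := by
        have e3 := (hf (w + ε * Complex.I) (by rw [hadd]; exact h1) (by rw [hadd]; exact h2)).differentiableAt
        exact DifferentiableAt.comp w e3 (differentiableAt_id.add_const _)
      exact (e1.sub e2).sub (differentiableAt_id.const_mul _)
    have hkpos : 0 < 12 * C / β * ε := by positivity
    have hbd : ∀ w : ℂ, 0 < w.re → w.re < β → (h w).re ≤ 2 * C * w.re := by
      intro w h1 h2
      have e1 := (abs_le.1 (hre w h1 h2)).2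
      have e2 := (abs_le.1 (hre (w + ε * Complex.I) (by rw [hadd]; exact h1)
        (by rw [hadd]; exact h2))).1
      rw [hadd] at e2
      rw [hhre]
      nlinarith [mul_pos hkpos h1]
    have hright : ∀ w : ℂ, w.re = β / 2 → (h w).re ≤ 0 := by
      intro w hw
      have hconv : Convex ℝ {v : ℂ | v.re = β / 2} := by
        have := (convex_singleton (𝕜 := ℝ) (β / 2)).linear_preimage Complex.reLm
        exact this
      have hmv : ‖f (w + ε * Complex.I) - f w‖ ≤ 6 * C * ‖(w + ε * Complex.I) - w‖ := by
        refine hconv.norm_image_sub_le_of_norm_hasDerivWithin_le (f' := f') (s := {v : ℂ | v.re = β / 2}) ?_ ?_ hw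
          (by simp only [mem_ofPred_eq]; rw [hadd]; exact hw)
        · intro v hv
          simp only [mem_ofPred_eq] at hv
          exact (hf v (by rw [hv]; linarith) (by rw [hv]; linarith)).hasDerivWithinAt
        · intro v hv
          simp only [mem_ofPred_eq] at hv
          exact hA v (by rw [hv]; linarith) (by rw [hv])
      have hn : ‖(w + ε * Complex.I) - w‖ = ε := by
        simp [abs_of_pos hε]
      rw [hn] at hmv
      have := (abs_le.1 (Complex.abs_re_le_norm (f (w + ε * Complex.I) - f w))).1
      rw [Complex.sub_re] at this
      rw [hhre, hw]
      have : 12 * C / β * ε * (β / 2) = 6 * C * ε := by field_simp; ring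
      linarith
    have hdelta : ∀ δ : ℝ, 0 < δ → δ ≤ z.re → (h z).re ≤ 2 * C * δ := by
      intro δ hδ hδz
      have hle : ‖Complex.exp (h z)‖ ≤ Real.exp (2 * C * δ) := by
        refine PhragmenLindelof.vertical_strip (f := fun w => Complex.exp (h w)) (a := δ) (b := β / 2) ?_ ?_ ?_ ?_ hδz hz2
        · have : DifferentiableOn ℂ (fun w => Complex.exp (h w)) (closure (Complex.re ⁻¹' Ioo δ (β/2))) := by
            intro w hw
            have hcl : closure (Complex.re ⁻¹' Ioo δ (β/2)) ⊆ Complex.re ⁻¹' Icc δ (β/2) :=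
              closure_minimal (preimage_mono Ioo_subset_Icc_self) (isClosed_Icc.preimage Complex.continuous_re)
            have hw' := hcl hw
            exact (hhd w (lt_of_lt_of_le hδ hw'.1) (lt_of_le_of_lt hw'.2 (by linarith))).cexp.differentiableWithinAt
          exact this.diffContOnCl
        · have hb2 : 0 < β / 2 - δ ∨ β / 2 - δ = 0 := by
            rcases eq_or_lt_of_le (hδz.trans hz2) with e | e
            · right; linarith
            · left; linarith
          rcases hb2 with hb2 | hb2
          · refine ⟨0, by positivity, 0, ?_⟩
            refine Asymptotics.IsBigO.of_bound (Real.exp (2 * C * β)) ?_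
            refine Filter.mem_inf_of_right ?_
            rw [mem_principal]
            intro w hw
            simp only [mem_ofPred_eq, Complex.norm_exp]
            have h1 : 0 < w.re := hδ.trans hw.1
            have h2 : w.re < β := by have := hw.2; linarith
            have := hbd w h1 h2
            simp
            nlinarith
          · refine ⟨-1, by rw [hb2]; simp, 0, ?_⟩
            have : Ioo δ (β/2) = ∅ := Ioo_eq_empty (by linarith)
            rw [this]; simp only [preimage_empty, principal_empty, inf_bot_eq]
            exact Asymptotics.IsBigO.of_bound 1 (by simp)
        · intro w hw
          rw [Complex.norm_exp, Real.exp_le_exp]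
          have := hbd w (by rw [hw]; exact hδ) (by rw [hw]; linarith)
          rwa [hw] at this
        · intro w hw
          rw [Complex.norm_exp, Real.exp_le_exp]
          exact (hright w hw).trans (by positivity)
      rwa [Complex.norm_exp, Real.exp_le_exp] at hle
    have hfin : (h z).re ≤ 0 := by
      by_contra hcon
      push Not at hcon
      have h1 := hdelta (min z.re ((h z).re / (4 * C))) (lt_min hz (by positivity)) (min_le_left _ _)
      have h2 : 2 * C * min z.re ((h z).re / (4 * C)) ≤ 2 * C * ((h z).re / (4 * C)) := by
        gcongr; exact min_le_right _ _
      have h3 : 2 * C * ((h z).re / (4 * C)) = (h z).re / 2 := by field_simp; ring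
      linarith
    rw [hhre] at hfin
    linarith
  have hzβ : z.re < β := by linarith
  have hB' : (f' z).im ≤ 12 * C / β * z.re := by
    have hd : HasDerivAt (fun ε : ℝ => (f (z + ε * Complex.I)).re) (-(f' z).im) 0 := by
      have e0 : HasDerivAt (fun ε : ℝ => z + (ε : ℂ) * Complex.I) Complex.I 0 := by
        have := ((Complex.ofRealCLM.hasDerivAt (x := (0:ℝ))).mul_const Complex.I).const_add z
        simpa using this
      have e1 : HasDerivAt f (f' z) (z + ((0:ℝ) : ℂ) * Complex.I) := by simpa using hf z hz hzβ
      have e2 := e1.comp (0:ℝ) e0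
      have e3 := (Complex.reCLM.hasFDerivAt).comp_hasDerivAt (0:ℝ) e2
      have e4 : -(f' z).im = Complex.reCLM (f' z * Complex.I) := by simp
      rw [e4]
      exact e3
    by_contra hcon
    push Not at hcon
    have hd2 : HasDerivAt (fun ε : ℝ => (f (z + ε * Complex.I)).re + (12 * C / β * z.re) * ε)
        (-(f' z).im + (12 * C / β * z.re)) 0 := by
      have := hd.add ((hasDerivAt_id (0:ℝ)).const_mul (12 * C / β * z.re))
      rw [mul_one] at this
      exact this
    have hev := hd2.tendsto_slope_zero_right
    have hlt : ∀ᶠ y in 𝓝 (-(f' z).im + (12 * C / β * z.re)), y < 0 :=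
      eventually_lt_nhds (by linarith)
    obtain ⟨t, ht1, ht2⟩ := ((hev.eventually hlt).and self_mem_nhdsWithin).exists
    have ht : 0 < t := ht2
    have hb := hB z hz hz2 t ht
    simp only [smul_eq_mul, zero_add] at ht1
    have : 0 ≤ t⁻¹ * ((f (z + t * Complex.I)).re + 12 * C / β * z.re * t -
        ((f (z + ((0:ℝ):ℂ) * Complex.I)).re + 12 * C / β * z.re * 0)) := by
      apply mul_nonneg (inv_nonneg.2 ht.le)
      simp
      linarith
    linarith
  -- (c)
  have hopen : IsOpen {w : ℂ | 0 < w.re ∧ w.re < β} :=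
    (isOpen_lt continuous_const Complex.continuous_re).inter
      (isOpen_lt Complex.continuous_re continuous_const)
  have hf'd : DifferentiableOn ℂ f' {w : ℂ | 0 < w.re ∧ w.re < β} := by
    have h1 : DifferentiableOn ℂ f {w : ℂ | 0 < w.re ∧ w.re < β} := fun w hw =>
      (hf w hw.1 hw.2).differentiableAt.differentiableWithinAt
    refine (h1.deriv hopen).congr ?_
    intro w hw
    exact ((hf w hw.1 hw.2).deriv).symm
  have hd : DifferentiableOn ℂ (fun w => -Complex.I * f' w) (ball z z.re) := by
    refine (hf'd.mono ?_).const_mul _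
    intro w hw
    obtain ⟨h1, h2, _⟩ := hball z hz2 w hw
    exact ⟨h1, h2⟩
  have hp : ∀ w ∈ ball z z.re, 0 < (-Complex.I * f' w).re := by
    intro w hw
    obtain ⟨h1, h2, _⟩ := hball z hz2 w hw
    simpa using him w h1 h2
  have h := hp_deriv_le hz hd hp
  rw [deriv_const_mul _ (hf'd.differentiableAt (hopen.mem_nhds ⟨hz, hzβ⟩))] at h
  simp only [norm_mul, norm_neg, Complex.norm_I, one_mul] at h
  refine h.trans ?_
  rw [div_le_iff₀ hz]
  simp
  have : 24 * C / β * z.re = 2 * (12 * C / β * z.re) := by ring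
  linarith

/-- Inverse function: complex derivative in a coordinate `Z`. -/
theorem inv_coord_hasDerivAt {Z F g : ℂ → ℂ} {DZ DF : ℂ →L[ℝ] ℂ} {x m : ℂ}
    (hZ : HasStrictFDerivAt Z DZ x) (hF : HasFDerivAt F DF x)
    (hdet : (DZ 1).re * (DZ Complex.I).im - (DZ 1).im * (DZ Complex.I).re ≠ 0)
    (hg : ∀ᶠ y in 𝓝 x, g (Z y) = y) (hm : ∀ v, DF v = m * DZ v) :
    HasDerivAt (fun w => F (g w)) m (Z x) := by
  have hinj : Function.Injective DZ := by
    rw [injective_iff_map_eq_zero]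
    intro v hv
    have hv' : v = (v.re : ℝ) • (1:ℂ) + (v.im : ℝ) • Complex.I := by
      apply Complex.ext <;> simp
    rw [hv', map_add, map_smul, map_smul] at hv
    have h1 := congrArg Complex.re hv
    have h2 := congrArg Complex.im hv
    simp at h1 h2
    have e1 : v.re * ((DZ 1).re * (DZ Complex.I).im - (DZ 1).im * (DZ Complex.I).re) = 0 := by
      linear_combination (DZ Complex.I).im * h1 - (DZ Complex.I).re * h2
    have e2 : v.im * ((DZ 1).re * (DZ Complex.I).im - (DZ 1).im * (DZ Complex.I).re) = 0 := by
      linear_combination (DZ 1).re * h2 - (DZ 1).im * h1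
    apply Complex.ext
    · simpa [hdet] using e1
    · simpa [hdet] using e2
  let L : ℂ ≃ₗ[ℝ] ℂ := LinearEquiv.ofInjectiveEndo (DZ : ℂ →ₗ[ℝ] ℂ) hinj
  let E : ℂ ≃L[ℝ] ℂ := L.toContinuousLinearEquiv
  have hE : (E : ℂ →L[ℝ] ℂ) = DZ := by
    ext v <;> rfl
  have hZ' : HasStrictFDerivAt Z (E : ℂ →L[ℝ] ℂ) x := by rw [hE]; exact hZ
  have hginv := (hZ'.to_local_left_inverse hg).hasFDerivAt
  have hgx : g (Z x) = x := hg.self_of_nhds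
  have hF' : HasFDerivAt F DF (g (Z x)) := by rw [hgx]; exact hF
  have hc := hF'.comp (Z x) hginv
  have hfin : DF.comp (E.symm : ℂ →L[ℝ] ℂ) = (ContinuousLinearMap.toSpanSingleton ℂ m).restrictScalars ℝ := by
    refine ContinuousLinearMap.ext fun v => ?_
    have h1 : DZ (E.symm v) = v := by rw [← hE]; exact E.apply_symm_apply v
    simp [hm, h1, mul_comm]
  rw [hfin] at hc
  exact hasFDerivAt_of_restrictScalars ℝ hc rfl

theorem inv_fderiv {Z g : ℂ → ℂ} {DZ : ℂ →L[ℝ] ℂ} {x : ℂ}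
    (hZ : HasStrictFDerivAt Z DZ x)
    (hdet : (DZ 1).re * (DZ Complex.I).im - (DZ 1).im * (DZ Complex.I).re ≠ 0)
    (hg : ∀ᶠ y in 𝓝 x, g (Z y) = y) :
    ∃ L : ℂ →L[ℝ] ℂ, (∀ v, DZ (L v) = v) ∧ HasFDerivAt g L (Z x) := by
  have hinj : Function.Injective DZ := by
    rw [injective_iff_map_eq_zero]
    intro v hv
    have hv' : v = (v.re : ℝ) • (1:ℂ) + (v.im : ℝ) • Complex.I := by
      apply Complex.ext <;> simp
    rw [hv', map_add, map_smul, map_smul] at hv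
    have h1 := congrArg Complex.re hv
    have h2 := congrArg Complex.im hv
    simp at h1 h2
    have e1 : v.re * ((DZ 1).re * (DZ Complex.I).im - (DZ 1).im * (DZ Complex.I).re) = 0 := by
      linear_combination (DZ Complex.I).im * h1 - (DZ Complex.I).re * h2
    have e2 : v.im * ((DZ 1).re * (DZ Complex.I).im - (DZ 1).im * (DZ Complex.I).re) = 0 := by
      linear_combination (DZ 1).re * h2 - (DZ 1).im * h1
    apply Complex.ext
    · simpa [hdet] using e1
    · simpa [hdet] using e2
  let L : ℂ ≃ₗ[ℝ] ℂ := LinearEquiv.ofInjectiveEndo (DZ : ℂ →ₗ[ℝ] ℂ) hinj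
  let E : ℂ ≃L[ℝ] ℂ := L.toContinuousLinearEquiv
  have hE : (E : ℂ →L[ℝ] ℂ) = DZ := by
    ext v <;> rfl
  have hZ' : HasStrictFDerivAt Z (E : ℂ →L[ℝ] ℂ) x := by rw [hE]; exact hZ
  refine ⟨E.symm, fun v => ?_, (hZ'.to_local_left_inverse hg).hasFDerivAt⟩
  rw [← hE]; exact E.apply_symm_apply v

/-- The real linear functional `v ↦ α v.re + β v.im`. -/
def lin (α β : ℝ) : ℂ →L[ℝ] ℝ := α • Complex.reCLM + β • Complex.imCLM

/-- The real linear map `v ↦ v.re • A + v.im • B`. -/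
def cl (A B : ℂ) : ℂ →L[ℝ] ℂ := Complex.reCLM.smulRight A + Complex.imCLM.smulRight B

@[simp] theorem lin_apply (α β : ℝ) (v : ℂ) : lin α β v = α * v.re + β * v.im := by
  simp [lin]

@[simp] theorem cl_apply (A B v : ℂ) : cl A B v = v.re * A + v.im * B := by
  simp [cl]

theorem lin_ext {α β γ δ : ℝ} (h1 : α = γ) (h2 : β = δ) : lin α β = lin γ δ := by rw [h1, h2]

theorem lin_eq_of (L : ℂ →L[ℝ] ℝ) {α β : ℝ} (h1 : L 1 = α) (h2 : L Complex.I = β) : L = lin α β := by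
  refine ContinuousLinearMap.ext fun v => ?_
  have hv' : v = (v.re : ℝ) • (1:ℂ) + (v.im : ℝ) • Complex.I := by
    apply Complex.ext <;> simp
  conv_lhs => rw [hv', map_add, map_smul, map_smul, h1, h2]
  simp [mul_comm]

theorem cl_eq_of (L : ℂ →L[ℝ] ℂ) {A B : ℂ} (h1 : L 1 = A) (h2 : L Complex.I = B) : L = cl A B := by
  refine ContinuousLinearMap.ext fun v => ?_
  have hv' : v = (v.re : ℝ) • (1:ℂ) + (v.im : ℝ) • Complex.I := by
    apply Complex.ext <;> simp
  conv_lhs => rw [hv', map_add, map_smul, map_smul, h1, h2]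
  simp

theorem lin_continuousAt {α β : ℂ → ℝ} {z : ℂ} (hα : ContinuousAt α z) (hβ : ContinuousAt β z) :
    ContinuousAt (fun w => lin (α w) (β w)) z :=
  (hα.smul continuousAt_const).add (hβ.smul continuousAt_const)

theorem strict_of_lin {f α β : ℂ → ℝ} {Ω : Set ℂ} (hΩ : IsOpen Ω)
    (hf : ∀ z ∈ Ω, HasFDerivAt f (lin (α z) (β z)) z) {z : ℂ} (hz : z ∈ Ω)
    (hα : ContinuousAt α z) (hβ : ContinuousAt β z) : HasStrictFDerivAt f (lin (α z) (β z)) z :=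
  hasStrictFDerivAt_of_hasFDerivAt_of_continuousAt
    (Filter.eventually_of_mem (hΩ.mem_nhds hz) hf) (lin_continuousAt hα hβ)

theorem strict_pair {f g : ℂ → ℝ} {α β γ δ : ℝ} {z : ℂ} (hf : HasStrictFDerivAt f (lin α β) z)
    (hg : HasStrictFDerivAt g (lin γ δ) z) :
    HasStrictFDerivAt (fun w => (⟨f w, g w⟩ : ℂ)) (cl ⟨α, γ⟩ ⟨β, δ⟩) z := by
  have h1 := (Complex.ofRealCLM.hasStrictFDerivAt (x := f z)).comp z hf
  have h2 := (Complex.ofRealCLM.hasStrictFDerivAt (x := g z)).comp z hg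
  have h3 := h1.add (h2.mul_const Complex.I)
  have h4 : (fun w => (⟨f w, g w⟩ : ℂ)) =
      ((Complex.ofRealCLM ∘ f) + fun y => (Complex.ofRealCLM ∘ g) y * Complex.I) := by
    funext w
    apply Complex.ext <;> simp
  rw [h4]
  refine h3.congr_fderiv ?_
  apply cl_eq_of
  · apply Complex.ext <;> simp
  · apply Complex.ext <;> simp

/-- Poincaré lemma in the plane. -/
theorem poincare2 {Ω : Set ℂ} (hΩ : IsOpen Ω) (hc : Convex ℝ Ω) {A B : ℂ → ℝ}
    {A1 A2 B1 B2 : ℂ → ℝ} (hA : ∀ z ∈ Ω, HasFDerivAt A (lin (A1 z) (A2 z)) z)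
    (hB : ∀ z ∈ Ω, HasFDerivAt B (lin (B1 z) (B2 z)) z) (h : ∀ z ∈ Ω, A2 z = B1 z) :
    ∃ f : ℂ → ℝ, ∀ z ∈ Ω, HasFDerivAt f (lin (A z) (B z)) z := by
  have hd : ∀ z ∈ Ω, HasFDerivAt (fun w => lin (A w) (B w))
      ((lin (A1 z) (A2 z)).smulRight Complex.reCLM + (lin (B1 z) (B2 z)).smulRight Complex.imCLM) z := by
    intro z hz
    have h1 := (hA z hz).smul_const Complex.reCLM
    have h2 := (hB z hz).smul_const Complex.imCLM
    exact h1.add h2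
  refine hc.exists_forall_hasFDerivAt_of_fderiv_symmetric hΩ
    (fun z hz => (hd z hz).differentiableAt.differentiableWithinAt) ?_
  intro z hz x y
  rw [(hd z hz).fderiv]
  simp [h z hz]
  ring

/-- Data of a minimal graph in complex form. -/
structure MS (Ω : Set ℂ) where
  u : ℂ → ℝ
  P : ℂ → ℝ
  Q : ℂ → ℝ
  a : ℂ → ℝ
  b : ℂ → ℝ
  c : ℂ → ℝ
  W : ℂ → ℝ
  ψ : ℂ → ℝ
  G : ℂ → ℝ
  F : ℂ → ℝ
  op : IsOpen Ω
  cv : Convex ℝ Ω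
  Wpos : ∀ z, 0 < W z
  Wsq : ∀ z, W z ^ 2 = 1 + P z ^ 2 + Q z ^ 2
  cP : ∀ z ∈ Ω, ContinuousAt P z
  cQ : ∀ z ∈ Ω, ContinuousAt Q z
  cW : ∀ z ∈ Ω, ContinuousAt W z
  du : ∀ z ∈ Ω, HasStrictFDerivAt u (lin (P z) (Q z)) z
  dP : ∀ z ∈ Ω, HasFDerivAt P (lin (a z) (b z)) z
  dQ : ∀ z ∈ Ω, HasFDerivAt Q (lin (b z) (c z)) z
  dψ : ∀ z ∈ Ω, HasStrictFDerivAt ψ (lin (-Q z / W z) (P z / W z)) z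
  dG : ∀ z ∈ Ω, HasStrictFDerivAt G (lin (P z * Q z / W z) ((1 + Q z ^ 2) / W z)) z
  dF : ∀ z ∈ Ω, HasStrictFDerivAt F (lin ((1 + P z ^ 2) / W z) (P z * Q z / W z)) z
  dW : ∀ z ∈ Ω, HasFDerivAt W (lin ((P z * a z + Q z * b z) / W z) ((P z * b z + Q z * c z) / W z)) z

theorem exists_MS {Ω : Set ℂ} (op : IsOpen Ω) (cv : Convex ℝ Ω) {u P Q a b c : ℂ → ℝ}
    (du : ∀ z ∈ Ω, HasFDerivAt u (lin (P z) (Q z)) z)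
    (dP : ∀ z ∈ Ω, HasFDerivAt P (lin (a z) (b z)) z)
    (dQ : ∀ z ∈ Ω, HasFDerivAt Q (lin (b z) (c z)) z)
    (mse : ∀ z ∈ Ω, (1 + Q z ^ 2) * a z - 2 * P z * Q z * b z + (1 + P z ^ 2) * c z = 0) :
    ∃ M : MS Ω, M.u = u ∧ M.P = P ∧ M.Q = Q ∧ M.a = a ∧ M.b = b ∧ M.c = c := by
  set W : ℂ → ℝ := fun z => Real.sqrt (1 + P z ^ 2 + Q z ^ 2) with hW
  have hpos : ∀ z, 0 < 1 + P z ^ 2 + Q z ^ 2 := fun z => by positivity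
  have Wpos : ∀ z, 0 < W z := fun z => Real.sqrt_pos.2 (hpos z)
  have Wsq : ∀ z, W z ^ 2 = 1 + P z ^ 2 + Q z ^ 2 := fun z => Real.sq_sqrt (hpos z).le
  have cP : ∀ z ∈ Ω, ContinuousAt P z := fun z hz => (dP z hz).continuousAt
  have cQ : ∀ z ∈ Ω, ContinuousAt Q z := fun z hz => (dQ z hz).continuousAt
  have dW : ∀ z ∈ Ω, HasFDerivAt W
      (lin ((P z * a z + Q z * b z) / W z) ((P z * b z + Q z * c z) / W z)) z := by
    intro z hz
    have h1 := (((dP z hz).pow 2).const_add 1).add ((dQ z hz).pow 2)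
    have h2 := h1.sqrt (hpos z).ne'
    have h2' : HasFDerivAt W _ z := h2
    refine h2'.congr_fderiv ?_
    have hw : Real.sqrt (1 + P z ^ 2 + Q z ^ 2) = W z := rfl
    have := (Wpos z).ne'
    apply lin_eq_of <;> simp [hw] <;> field_simp
  have cW : ∀ z ∈ Ω, ContinuousAt W z := fun z hz => (dW z hz).continuousAt
  have dWi : ∀ z ∈ Ω, HasFDerivAt (fun w => (W w)⁻¹)
      (lin (-((P z * a z + Q z * b z) / W z ^ 3)) (-((P z * b z + Q z * c z) / W z ^ 3))) z := by
    intro z hz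
    have h2 := (hasDerivAt_inv (Wpos z).ne').comp_hasFDerivAt z (dW z hz)
    have h2' : HasFDerivAt (fun w => (W w)⁻¹) _ z := h2
    refine h2'.congr_fderiv ?_
    have := (Wpos z).ne'
    apply lin_eq_of <;> simp <;> field_simp
  -- generic product
  have prod : ∀ {A : ℂ → ℝ} {A1 A2 : ℂ → ℝ}, (∀ z ∈ Ω, HasFDerivAt A (lin (A1 z) (A2 z)) z) →
      ∀ z ∈ Ω, HasFDerivAt (fun w => A w / W w)
        (lin ((A1 z * W z ^ 2 - A z * (P z * a z + Q z * b z)) / W z ^ 3)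
          ((A2 z * W z ^ 2 - A z * (P z * b z + Q z * c z)) / W z ^ 3)) z := by
    intro A A1 A2 hA z hz
    have h2 := (hA z hz).mul (dWi z hz)
    have h2' : HasFDerivAt (fun w => A w * (W w)⁻¹) _ z := h2
    simp only [div_eq_mul_inv (A _)]
    refine h2'.congr_fderiv ?_
    have := (Wpos z).ne'
    apply lin_eq_of <;> simp <;> field_simp <;> ring
  have dnQ : ∀ z ∈ Ω, HasFDerivAt (fun w => -Q w) (lin (-b z) (-c z)) z := by
    intro z hz
    refine (dQ z hz).neg.congr_fderiv ?_
    apply lin_eq_of <;> simp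
  have dPQ : ∀ z ∈ Ω, HasFDerivAt (fun w => P w * Q w)
      (lin (P z * b z + Q z * a z) (P z * c z + Q z * b z)) z := by
    intro z hz
    refine ((dP z hz).mul (dQ z hz)).congr_fderiv ?_
    apply lin_eq_of <;> simp
  have dPP : ∀ z ∈ Ω, HasFDerivAt (fun w => 1 + P w ^ 2)
      (lin (2 * P z * a z) (2 * P z * b z)) z := by
    intro z hz
    refine (((dP z hz).pow 2).const_add 1).congr_fderiv ?_
    apply lin_eq_of <;> simp
  have dQQ : ∀ z ∈ Ω, HasFDerivAt (fun w => 1 + Q w ^ 2)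
      (lin (2 * Q z * b z) (2 * Q z * c z)) z := by
    intro z hz
    refine (((dQ z hz).pow 2).const_add 1).congr_fderiv ?_
    apply lin_eq_of <;> simp
  obtain ⟨ψ, hψ⟩ := poincare2 op cv (prod dnQ) (prod dP) (by
    intro z hz
    have := mse z hz
    congr 1
    rw [Wsq z]
    linear_combination -this)
  obtain ⟨G, hG⟩ := poincare2 op cv (prod dPQ) (prod dQQ) (by
    intro z hz
    have := mse z hz
    congr 1
    rw [Wsq z]
    linear_combination (P z) * this)
  obtain ⟨F, hF⟩ := poincare2 op cv (prod dPP) (prod dPQ) (by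
    intro z hz
    have := mse z hz
    congr 1
    rw [Wsq z]
    linear_combination (-Q z) * this)
  refine ⟨⟨u, P, Q, a, b, c, W, ψ, G, F, op, cv, Wpos, Wsq, cP, cQ, cW, ?_, dP, dQ, ?_, ?_, ?_, dW⟩,
    rfl, rfl, rfl, rfl, rfl, rfl⟩
  · intro z hz
    exact strict_of_lin op du hz (cP z hz) (cQ z hz)
  · intro z hz
    exact strict_of_lin op hψ hz (((cQ z hz).neg).div (cW z hz) (Wpos z).ne')
      ((cP z hz).div (cW z hz) (Wpos z).ne')
  · intro z hz
    exact strict_of_lin op hG hz (((cP z hz).mul (cQ z hz)).div (cW z hz) (Wpos z).ne')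
      ((((cQ z hz).pow 2).const_add 1).div (cW z hz) (Wpos z).ne')
  · intro z hz
    exact strict_of_lin op hF hz ((((cP z hz).pow 2).const_add 1).div (cW z hz) (Wpos z).ne')
      (((cP z hz).mul (cQ z hz)).div (cW z hz) (Wpos z).ne')

theorem line_mono {f : ℂ → ℝ} {L : ℂ → ℂ →L[ℝ] ℝ} {x y : ℂ} {k : ℝ}
    (hf : ∀ z ∈ segment ℝ x y, HasFDerivAt f (L z) z)
    (hk : ∀ z ∈ segment ℝ x y, k ≤ L z (y - x)) : k ≤ f y - f x := by
  have hseg : ∀ t ∈ Icc (0:ℝ) 1, x + (t:ℝ) • (y - x) ∈ segment ℝ x y := by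
    intro t ht
    rw [segment_eq_image']
    exact ⟨t, ht, rfl⟩
  have hd : ∀ t ∈ Icc (0:ℝ) 1, HasDerivAt (fun t : ℝ => f (x + t • (y - x)) - k * t)
      (L (x + t • (y - x)) (y - x) - k) t := by
    intro t ht
    have e0 : HasDerivAt (fun t : ℝ => x + t • (y - x)) (y - x) t := by
      have := ((hasDerivAt_id t).smul_const (y - x)).const_add x
      rw [one_smul] at this
      exact this
    have e1 := (hf _ (hseg t ht)).comp_hasDerivAt t e0
    have e2 := e1.sub ((hasDerivAt_id t).const_mul k)
    rw [mul_one] at e2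
    exact e2
  have hm : MonotoneOn (fun t : ℝ => f (x + t • (y - x)) - k * t) (Icc 0 1) := by
    refine monotoneOn_of_deriv_nonneg (convex_Icc 0 1)
      (fun t ht => (hd t ht).continuousAt.continuousWithinAt)
      (fun t ht => (hd t (interior_subset ht)).differentiableAt.differentiableWithinAt) ?_
    intro t ht
    rw [(hd t (interior_subset ht)).deriv]
    linarith [hk _ (hseg t (interior_subset ht))]
  have := hm (left_mem_Icc.2 zero_le_one) (right_mem_Icc.2 zero_le_one) zero_le_one
  simp at this
  linarith

namespace MS
variable {Ω : Set ℂ} (M : MS Ω)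

def X (z : ℂ) : ℂ := ⟨z.re, M.G z⟩
def Y (z : ℂ) : ℂ := ⟨z.im, -M.F z⟩
def Ps (z : ℂ) : ℂ := ⟨M.ψ z, -M.u z⟩
def DX (z : ℂ) : ℂ →L[ℝ] ℂ := cl ⟨1, M.P z * M.Q z / M.W z⟩ ⟨0, (1 + M.Q z ^ 2) / M.W z⟩
def D0 (z : ℂ) : ℂ := ⟨-(M.Q z * M.W z) / (1 + M.Q z ^ 2), -M.P z / (1 + M.Q z ^ 2)⟩
def C0 (z : ℂ) : ℂ := ⟨-(M.P z * M.Q z) / (1 + M.Q z ^ 2), -M.W z / (1 + M.Q z ^ 2)⟩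
def H0 (z : ℂ) : ℂ := ⟨-M.Q z / (M.W z + M.P z), 1 / (M.W z + M.P z)⟩

theorem W_ge_one (z : ℂ) : 1 ≤ M.W z := by
  nlinarith [M.Wsq z, M.Wpos z, sq_nonneg (M.P z), sq_nonneg (M.Q z)]

theorem absP_lt (z : ℂ) : |M.P z| < M.W z := by
  apply abs_lt_of_sq_lt_sq _ (M.Wpos z).le
  nlinarith [M.Wsq z, sq_nonneg (M.Q z)]

theorem absQ_lt (z : ℂ) : |M.Q z| < M.W z := by
  apply abs_lt_of_sq_lt_sq _ (M.Wpos z).le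
  nlinarith [M.Wsq z, sq_nonneg (M.P z)]

theorem S_pos (z : ℂ) : 0 < M.W z + M.P z := by
  have := (abs_lt.1 (M.absP_lt z)).1
  linarith

theorem strict_re (z : ℂ) : HasStrictFDerivAt (fun w : ℂ => w.re) (lin 1 0) z := by
  have h : lin 1 0 = Complex.reCLM := by
    refine ContinuousLinearMap.ext fun v => ?_
    simp
  rw [h]
  exact Complex.reCLM.hasStrictFDerivAt

theorem strict_im (z : ℂ) : HasStrictFDerivAt (fun w : ℂ => w.im) (lin 0 1) z := by
  have h : lin 0 1 = Complex.imCLM := by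
    refine ContinuousLinearMap.ext fun v => ?_
    simp
  rw [h]
  exact Complex.imCLM.hasStrictFDerivAt

theorem dX {z : ℂ} (hz : z ∈ Ω) : HasStrictFDerivAt M.X (M.DX z) z :=
  strict_pair (strict_re z) (M.dG z hz)

theorem dY {z : ℂ} (hz : z ∈ Ω) : HasStrictFDerivAt M.Y
    (cl ⟨0, -((1 + M.P z ^ 2) / M.W z)⟩ ⟨1, -(M.P z * M.Q z / M.W z)⟩) z := by
  refine strict_pair (strict_im z) ((M.dF z hz).neg.congr_fderiv ?_)
  apply lin_eq_of <;> simp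

theorem dPs {z : ℂ} (hz : z ∈ Ω) : HasStrictFDerivAt M.Ps
    (cl ⟨-M.Q z / M.W z, -M.P z⟩ ⟨M.P z / M.W z, -M.Q z⟩) z := by
  refine strict_pair (M.dψ z hz) ((M.du z hz).neg.congr_fderiv ?_)
  apply lin_eq_of <;> simp

theorem Qp (z : ℂ) : 0 < 1 + M.Q z ^ 2 := by positivity

theorem cl_mul {A B k : ℂ} : k • cl A B = cl (k * A) (k * B) := by
  apply cl_eq_of <;> simp

theorem DY_eq (z : ℂ) : cl ⟨0, -((1 + M.P z ^ 2) / M.W z)⟩ ⟨1, -(M.P z * M.Q z / M.W z)⟩ =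
    M.C0 z • M.DX z := by
  have h1 := (M.Qp z).ne'
  have h2 := (M.Wpos z).ne'
  have h3 := M.Wsq z
  rw [DX, cl_mul, C0]
  congr 1 <;> apply Complex.ext <;> simp <;> field_simp <;> ring_nf <;> rw [h3] <;> ring

theorem DPs_eq (z : ℂ) : cl ⟨-M.Q z / M.W z, -M.P z⟩ ⟨M.P z / M.W z, -M.Q z⟩ =
    M.D0 z • M.DX z := by
  have h1 := (M.Qp z).ne'
  have h2 := (M.Wpos z).ne'
  have h3 := M.Wsq z
  rw [DX, cl_mul, D0]
  congr 1 <;> apply Complex.ext <;> simp <;> field_simp <;> ring_nf <;> rw [h3] <;> ring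

theorem dY' {z : ℂ} (hz : z ∈ Ω) : HasStrictFDerivAt M.Y (M.C0 z • M.DX z) z := by
  rw [← DY_eq]; exact M.dY hz

theorem dPs' {z : ℂ} (hz : z ∈ Ω) : HasStrictFDerivAt M.Ps (M.D0 z • M.DX z) z := by
  rw [← DPs_eq]; exact M.dPs hz

theorem H0_eq (z : ℂ) : M.H0 z = M.D0 z - M.C0 z := by
  have h1 := (M.Qp z).ne'
  have h2 := (M.S_pos z).ne'
  have h3 := M.Wsq z
  apply Complex.ext
  · simp [H0, D0, C0]
    rw [← sub_div, neg_div, ← sub_eq_zero]; field_simp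
    linear_combination M.Q z * h3
  · simp [H0, D0, C0]
    rw [inv_eq_one_div, ← sub_div, ← sub_eq_zero]; field_simp
    linear_combination - h3

theorem H0_mul (z : ℂ) : M.H0 z * (M.D0 z + M.C0 z) = 1 := by
  have h1 := (M.Qp z).ne'
  have h2 := (M.S_pos z).ne'
  have h3 := M.Wsq z
  apply Complex.ext
  · simp [H0, D0, C0]
    field_simp
    ring
  · simp [H0, D0, C0]
    field_simp
    ring

theorem H0_im_pos (z : ℂ) : 0 < (M.H0 z).im := by
  have := M.S_pos z
  simp [H0]; exact this

theorem normSq_H0 (z : ℂ) : 1 + Complex.normSq (M.H0 z) = 2 * M.W z / (M.W z + M.P z) := by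
  have h2 := (M.S_pos z).ne'
  have h3 := M.Wsq z
  simp [H0, Complex.normSq_apply]
  field_simp
  linear_combination -h3

theorem detDX (z : ℂ) (k : ℂ) : ((k • M.DX z) 1).re * ((k • M.DX z) Complex.I).im -
    ((k • M.DX z) 1).im * ((k • M.DX z) Complex.I).re = Complex.normSq k * ((1 + M.Q z ^ 2) / M.W z) := by
  simp [DX, Complex.normSq_apply]
  ring

/-- Curvature in terms of the derivative of the Gauss map. -/
theorem curv {x k : ℂ} (hx : x ∈ Ω) (hH : HasFDerivAt M.H0 (k • M.DX x) x) :
    |M.a x * M.c x - M.b x ^ 2| = Complex.normSq k * (1 + M.Q x ^ 2) * (M.W x + M.P x) ^ 2 := by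
  have hS := M.S_pos x
  have hW := M.Wpos x
  have dS := (M.dW x hx).add (M.dP x hx)
  have h1 := (hasDerivAt_inv hS.ne').comp_hasFDerivAt x dS
  have h2 := (M.dQ x hx).neg.mul h1
  have g1 := Complex.reCLM.hasFDerivAt.comp x hH
  have g2 := Complex.imCLM.hasFDerivAt.comp x hH
  have f2 : (⇑Complex.imCLM ∘ M.H0) = (fun y => y⁻¹) ∘ (M.W + M.P) := by
    funext z; simp [H0]
  have f1 : (⇑Complex.reCLM ∘ M.H0) = (-M.Q * ((fun y => y⁻¹) ∘ (M.W + M.P))) := by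
    funext z; simp [H0, div_eq_mul_inv]
  rw [f1] at g1
  rw [f2] at g2
  have e1 := g1.unique h2
  have e2 := g2.unique h1
  have hd := M.detDX x k
  have a1 := congrArg (fun L => L 1) e1
  have a2 := congrArg (fun L => L Complex.I) e1
  have b1 := congrArg (fun L => L 1) e2
  have b2 := congrArg (fun L => L Complex.I) e2
  simp only [ContinuousLinearMap.comp_apply, Complex.reCLM_apply, Complex.imCLM_apply] at a1 a2 b1 b2
  rw [a1, a2, b1, b2] at hd
  simp at hd
  have hdet : -(M.a x * M.c x - M.b x ^ 2) / (M.W x * (M.W x + M.P x) ^ 2) =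
      Complex.normSq k * ((1 + M.Q x ^ 2) / M.W x) := by
    rw [← hd]
    field_simp
    ring
  have hfin : -(M.a x * M.c x - M.b x ^ 2) =
      Complex.normSq k * (1 + M.Q x ^ 2) * (M.W x + M.P x) ^ 2 := by
    field_simp at hdet
    linear_combination hdet
  rw [← abs_neg, hfin, abs_of_nonneg]
  have := Complex.normSq_nonneg k
  positivity

/-- Coordinates: derivative of `F` with respect to the coordinate `Z`. -/
theorem coord {Ω₀ : Set ℂ} (hΩ₀ : IsOpen Ω₀) {Z F : ℂ → ℂ} {κ : ℂ → ℂ} {l x : ℂ}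
    (hZ : HasStrictFDerivAt Z (κ x • M.DX x) x) (hκ : κ x ≠ 0)
    (hinj : InjOn Z Ω₀) (hx : x ∈ Ω₀) (hF : HasFDerivAt F (l • M.DX x) x) :
    HasDerivAt (fun w => F (Function.invFunOn Z Ω₀ w)) (l / κ x) (Z x) := by
  refine inv_coord_hasDerivAt hZ hF ?_ ?_ ?_
  · rw [M.detDX]
    have := M.Qp x
    have := M.Wpos x
    have := Complex.normSq_pos.2 hκ
    positivity
  · filter_upwards [hΩ₀.mem_nhds hx] with y hy
    exact hinj (Function.invFunOn_mem ⟨y, hy, rfl⟩) hy (Function.invFunOn_eq ⟨y, hy, rfl⟩)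
  · intro v
    simp only [smul_apply, smul_eq_mul]
    field_simp

/-- The Gauss map is holomorphic in coordinates, and the curvature formula. -/
theorem curv_coord {Ω₀ : Set ℂ} (hΩ₀ : IsOpen Ω₀) (hsub : Ω₀ ⊆ Ω) {Z : ℂ → ℂ} {κ : ℂ → ℂ} {x : ℂ}
    (hZ : HasFDerivAt Z (κ x • M.DX x) x) (hx : x ∈ Ω₀) {h : ℂ → ℂ} {m : ℂ}
    (hh : HasDerivAt h m (Z x)) (hH : ∀ y ∈ Ω₀, M.H0 y = h (Z y)) :
    |M.a x * M.c x - M.b x ^ 2| =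
      Complex.normSq m * Complex.normSq (κ x) * (1 + M.Q x ^ 2) * (M.W x + M.P x) ^ 2 := by
  rw [← Complex.normSq_mul]
  apply M.curv (hsub hx)
  have h1 := (hh.hasFDerivAt.restrictScalars ℝ).comp x hZ
  have h2 := h1.congr_of_eventuallyEq (f₁ := M.H0)
    (Filter.eventually_of_mem (hΩ₀.mem_nhds hx) hH)
  refine h2.congr_fderiv ?_
  refine ContinuousLinearMap.ext fun v => ?_
  simp
  ring

end MS

namespace MS
variable {Ω : Set ℂ} (M : MS Ω)

/-- The coordinate `ζ = X + iY`. -/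
def ze (z : ℂ) : ℂ := M.X z + Complex.I * M.Y z
def kz (z : ℂ) : ℂ := 1 + Complex.I * M.C0 z

theorem ze_re (z : ℂ) : (M.ze z).re = z.re + M.F z := by simp [ze, X, Y]
theorem ze_im (z : ℂ) : (M.ze z).im = z.im + M.G z := by simp [ze, X, Y]; ring

theorem dze {z : ℂ} (hz : z ∈ Ω) : HasStrictFDerivAt M.ze (M.kz z • M.DX z) z := by
  have h := (M.dX hz).add ((M.dY' hz).const_mul Complex.I)
  refine HasStrictFDerivAt.congr_fderiv h ?_
  refine ContinuousLinearMap.ext fun v => ?_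
  simp [kz]
  ring

theorem normSq_kz (z : ℂ) : Complex.normSq (M.kz z) * (1 + M.Q z ^ 2) = (1 + M.W z) ^ 2 := by
  have h1 := (M.Qp z).ne'
  have h3 := M.Wsq z
  have hp : M.P z ^ 2 = M.W z ^ 2 - 1 - M.Q z ^ 2 := by linarith
  simp [kz, C0, Complex.normSq_apply]
  field_simp
  ring_nf
  rw [hp]
  ring

theorem kz_ne (z : ℂ) : M.kz z ≠ 0 := by
  intro h
  have := M.normSq_kz z
  rw [h] at this
  simp at this
  nlinarith [M.Wpos z]

theorem dze_apply (z h : ℂ) : (M.kz z • M.DX z) h =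
    ⟨h.re + (h.re + M.P z * (M.P z * h.re + M.Q z * h.im)) / M.W z,
     h.im + (h.im + M.Q z * (M.P z * h.re + M.Q z * h.im)) / M.W z⟩ := by
  have h1 := (M.Qp z).ne'
  have h2 := (M.Wpos z).ne'
  have h3 := M.Wsq z
  apply Complex.ext
  · simp [kz, C0, DX]
    field_simp
    ring_nf
    rw [h3]
    ring
  · simp [kz, C0, DX]
    field_simp
    ring_nf
    try rw [h3]
    try ring

theorem seg_sub (M : MS Ω) {x y : ℂ} (hx : x ∈ Ω) (hy : y ∈ Ω) : segment ℝ x y ⊆ Ω :=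
  M.cv.segment_subset hx hy

theorem ze_mono {x y : ℂ} (hx : x ∈ Ω) (hy : y ∈ Ω) :
    ‖y - x‖ ^ 2 ≤ (y - x).re * (M.ze y - M.ze x).re + (y - x).im * (M.ze y - M.ze x).im := by
  set w := y - x with hw
  set f : ℂ → ℝ := fun z => w.re * (M.ze z).re + w.im * (M.ze z).im with hf
  have hd : ∀ z ∈ segment ℝ x y, HasFDerivAt f
      (w.re • Complex.reCLM.comp (M.kz z • M.DX z) + w.im • Complex.imCLM.comp (M.kz z • M.DX z)) z := by
    intro z hz
    have h0 := (M.dze (M.seg_sub hx hy hz)).hasFDerivAt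
    exact ((Complex.reCLM.hasFDerivAt.comp z h0).const_smul w.re).add
      ((Complex.imCLM.hasFDerivAt.comp z h0).const_smul w.im)
  have := line_mono (k := ‖w‖ ^ 2) hd (by
    intro z hz
    rw [← hw]
    have hap : (w.re • Complex.reCLM.comp (M.kz z • M.DX z) +
        w.im • Complex.imCLM.comp (M.kz z • M.DX z)) w =
        w.re * ((M.kz z • M.DX z) w).re + w.im * ((M.kz z • M.DX z) w).im := by simp
    rw [hap, M.dze_apply, ← Complex.normSq_eq_norm_sq, Complex.normSq_apply]
    have hW := M.Wpos z
    have : 0 ≤ (w.re ^ 2 + w.im ^ 2 + (M.P z * w.re + M.Q z * w.im) ^ 2) / M.W z := by positivity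
    have e : w.re * (w.re + (w.re + M.P z * (M.P z * w.re + M.Q z * w.im)) / M.W z) +
        w.im * (w.im + (w.im + M.Q z * (M.P z * w.re + M.Q z * w.im)) / M.W z) =
        w.re * w.re + w.im * w.im +
        (w.re ^ 2 + w.im ^ 2 + (M.P z * w.re + M.Q z * w.im) ^ 2) / M.W z := by
      field_simp
      ring
    simp only
    rw [e]
    linarith)
  simp only [hf] at this
  simp only [Complex.sub_re, Complex.sub_im] at this ⊢
  linarith

theorem ze_expand {x y : ℂ} (hx : x ∈ Ω) (hy : y ∈ Ω) : ‖y - x‖ ≤ ‖M.ze y - M.ze x‖ := by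
  have h := M.ze_mono hx hy
  set w := y - x
  set v := M.ze y - M.ze x
  have hcs : w.re * v.re + w.im * v.im ≤ ‖w‖ * ‖v‖ := by
    apply le_of_sq_le_sq _ (by positivity)
    rw [mul_pow, ← Complex.normSq_eq_norm_sq, ← Complex.normSq_eq_norm_sq, Complex.normSq_apply,
      Complex.normSq_apply]
    nlinarith [sq_nonneg (w.re * v.im - w.im * v.re)]
  rcases eq_or_lt_of_le (norm_nonneg w) with h0 | h0
  · rw [← h0]; positivity
  · nlinarith

theorem ze_inj : InjOn M.ze Ω := by
  intro x hx y hy h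
  have := M.ze_expand hy hx
  rw [h, sub_self, norm_zero] at this
  exact sub_eq_zero.1 (norm_le_zero_iff.1 this)

theorem du_le_dze (z h : ℂ) : |lin (M.P z) (M.Q z) h| ≤ ‖(M.kz z • M.DX z) h‖ := by
  apply abs_le_of_sq_le_sq _ (norm_nonneg _)
  rw [M.dze_apply, ← Complex.normSq_eq_norm_sq, Complex.normSq_apply, lin_apply]
  have hW := M.Wpos z
  have h3 := M.Wsq z
  simp only
  set P := M.P z
  set Q := M.Q z
  set W := M.W z
  set D := P * h.re + Q * h.im with hD
  have e : (h.re + (h.re + P * D) / W) * (h.re + (h.re + P * D) / W) +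
      (h.im + (h.im + Q * D) / W) * (h.im + (h.im + Q * D) / W) =
      D ^ 2 + ((W + 1) ^ 2 * (h.re ^ 2 + h.im ^ 2) + 2 * W * D ^ 2 + D ^ 2) / W ^ 2 := by
    field_simp
    have : P ^ 2 + Q ^ 2 = W ^ 2 - 1 := by linarith
    linear_combination (D ^ 2) * this - 2 * D * (W + 1) * hD
  rw [e]
  have : 0 ≤ ((W + 1) ^ 2 * (h.re ^ 2 + h.im ^ 2) + 2 * W * D ^ 2 + D ^ 2) / W ^ 2 := by positivity
  linarith

theorem ze_surj_nhds {z : ℂ} (hz : z ∈ Ω) : map M.ze (𝓝 z) = 𝓝 (M.ze z) := by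
  refine (M.dze hz).map_nhds_eq_of_surj ?_
  rw [LinearMap.range_eq_top]
  have hinj : Function.Injective ((M.kz z • M.DX z : ℂ →L[ℝ] ℂ) : ℂ →ₗ[ℝ] ℂ) := by
    rw [injective_iff_map_eq_zero]
    intro v hv
    have hv : (M.kz z • M.DX z) v = 0 := hv
    rw [M.dze_apply] at hv
    have hW := M.Wpos z
    have e1 := congrArg Complex.re hv
    have e2 := congrArg Complex.im hv
    simp only [Complex.zero_re, Complex.zero_im] at e1 e2
    have e3 : v.re ^ 2 + v.im ^ 2 + (v.re ^ 2 + v.im ^ 2 + (M.P z * v.re + M.Q z * v.im) ^ 2) / M.W z = 0 := by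
      have : (v.re ^ 2 + v.im ^ 2 + (M.P z * v.re + M.Q z * v.im) ^ 2) / M.W z =
        v.re * ((v.re + M.P z * (M.P z * v.re + M.Q z * v.im)) / M.W z) +
        v.im * ((v.im + M.Q z * (M.P z * v.re + M.Q z * v.im)) / M.W z) := by
        field_simp; ring
      linear_combination v.re * e1 + v.im * e2 + this
    have e4 : 0 ≤ (v.re ^ 2 + v.im ^ 2 + (M.P z * v.re + M.Q z * v.im) ^ 2) / M.W z := by positivity
    apply Complex.ext
    · simp; nlinarith [sq_nonneg v.re, sq_nonneg v.im]
    · simp; nlinarith [sq_nonneg v.re, sq_nonneg v.im]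
  exact LinearMap.injective_iff_surjective.1 hinj

theorem u_lip_local {z : ℂ} (hz : z ∈ Ω) :
    ∀ᶠ y in 𝓝 z, |M.u y - M.u z| ≤ 2 * ‖M.ze y - M.ze z‖ := by
  have h1 := (M.du z hz).hasFDerivAt.isLittleO.def (show (0:ℝ) < 1/2 by norm_num)
  have h2 := (M.dze hz).hasFDerivAt.isLittleO.def (show (0:ℝ) < 1/2 by norm_num)
  filter_upwards [h1, h2, M.op.mem_nhds hz] with y e1 e2 hy
  have e3 := M.ze_expand hz hy
  have e4 := M.du_le_dze z (y - z)
  rw [Real.norm_eq_abs] at e1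
  have e5 := abs_sub_abs_le_abs_sub (M.u y - M.u z) (lin (M.P z) (M.Q z) (y - z))
  have e6 := norm_sub_norm_le ((M.kz z • M.DX z) (y - z)) (M.ze y - M.ze z)
  rw [norm_sub_rev ((M.kz z • M.DX z) (y - z))] at e6
  linarith

/-- Disk lemma. -/
theorem disk {q : ℂ} (hq : q ∈ Ω) {R : ℝ}
    (hfr : ∀ x ∈ frontier Ω, dist x q < R → Tendsto (fun z => |M.u z|) (𝓝[Ω] x) atTop) :
    ball (M.ze q) R ⊆ M.ze '' Ω := by
  intro w hw
  set γ : ℝ → ℂ := fun t => M.ze q + t • (w - M.ze q) with hγ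
  have hγc : Continuous γ := by fun_prop
  set S : Set ℝ := {t | ∃ z ∈ Ω, M.ze z = γ t ∧ |M.u z - M.u q| ≤ 2 * t * ‖w - M.ze q‖} with hS
  have hwR : ‖w - M.ze q‖ < R := by rwa [mem_ball, dist_eq_norm] at hw
  have hγsub : ∀ s t, γ s - γ t = (s - t) • (w - M.ze q) := by
    intro s t; simp only [hγ]; rw [sub_smul]; ring
  have hγ0 : γ 0 = M.ze q := by simp [hγ]
  have hγ1 : γ 1 = w := by simp [hγ]
  have key : Icc (0:ℝ) 1 ⊆ S := by
    refine IsClosed.Icc_subset_of_forall_exists_gt ?_ ?_ ?_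
    · -- closed
      apply IsSeqClosed.isClosed
      intro t t0 ht htt
      have ht1 : ∀ n, t n ∈ S := fun n => (ht n).1
      have ht2 : t0 ∈ Icc (0:ℝ) 1 := isClosed_Icc.mem_of_tendsto htt (Eventually.of_forall fun n => (ht n).2)
      refine ⟨?_, ht2⟩
      choose z hzΩ hzγ hzu using ht1
      have hcauchy : CauchySeq z := by
        have hct : CauchySeq (fun n => γ (t n)) := ((hγc.tendsto t0).comp htt).cauchySeq
        rw [Metric.cauchySeq_iff] at hct ⊢
        intro ε hε
        obtain ⟨N, hN⟩ := hct ε hε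
        refine ⟨N, fun m hm n hn => ?_⟩
        have := hN m hm n hn
        rw [dist_eq_norm] at this ⊢
        refine lt_of_le_of_lt (M.ze_expand (hzΩ n) (hzΩ m)) ?_
        rw [hzγ, hzγ]; exact this
      obtain ⟨z0, hz0⟩ := cauchySeq_tendsto_of_complete hcauchy
      have hz0cl : z0 ∈ closure Ω := mem_closure_of_tendsto hz0 (Eventually.of_forall hzΩ)
      have htnorm : ∀ n, ‖γ (t n) - M.ze q‖ ≤ ‖w - M.ze q‖ := by
        intro n
        rw [← hγ0, hγsub, norm_smul, hγ0]
        have h1 := (ht n).2.1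
        have h2 := (ht n).2.2
        rw [sub_zero, Real.norm_eq_abs, abs_of_nonneg h1]
        nlinarith [norm_nonneg (w - M.ze q)]
      have hdist : dist z0 q < R := by
        refine lt_of_le_of_lt ?_ hwR
        refine le_of_tendsto (hz0.dist tendsto_const_nhds) (Eventually.of_forall fun n => ?_)
        rw [dist_eq_norm]
        refine (M.ze_expand hq (hzΩ n)).trans ?_
        rw [hzγ]; exact htnorm n
      have hz0Ω : z0 ∈ Ω := by
        by_contra hnot
        have hf : z0 ∈ frontier Ω := by
          rw [frontier, M.op.interior_eq]; exact ⟨hz0cl, hnot⟩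
        have hT := hfr z0 hf hdist
        have hz0' : Tendsto z atTop (𝓝[Ω] z0) :=
          tendsto_nhdsWithin_iff.2 ⟨hz0, Eventually.of_forall hzΩ⟩
        have hT2 := (hT.comp hz0').eventually (eventually_gt_atTop (|M.u q| + 2 * R))
        obtain ⟨n, hn⟩ := hT2.exists
        simp only [Function.comp] at hn
        have h1 := hzu n
        have h2 := abs_sub_abs_le_abs_sub (M.u (z n)) (M.u q)
        have h3 := (ht n).2.1
        have h4 := (ht n).2.2
        nlinarith [norm_nonneg (w - M.ze q)]
      refine ⟨z0, hz0Ω, ?_, ?_⟩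
      · have h1 := (M.dze hz0Ω).continuousAt.tendsto.comp hz0
        have h2 := (hγc.tendsto t0).comp htt
        have : M.ze ∘ z = γ ∘ t := by funext n; exact hzγ n
        rw [this] at h1
        exact tendsto_nhds_unique h1 h2
      · have h1 := ((M.du z0 hz0Ω).continuousAt.tendsto.comp hz0).sub_const (M.u q)
        have h2 : Tendsto (fun n => 2 * t n * ‖w - M.ze q‖) atTop (𝓝 (2 * t0 * ‖w - M.ze q‖)) :=
          (htt.const_mul 2).mul_const _
        exact le_of_tendsto_of_tendsto h1.abs h2 (Eventually.of_forall hzu)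
    · exact ⟨q, hq, hγ0.symm, by simp⟩
    · rintro t ⟨⟨z, hz, hzγ, hzu⟩, ht0, ht1⟩ y hy
      have hy : t < y := hy
      have h1 := M.u_lip_local hz
      have h2 : ∀ᶠ p in 𝓝 z, p ∈ Ω := M.op.mem_nhds hz
      have h3 : M.ze '' {p | |M.u p - M.u z| ≤ 2 * ‖M.ze p - M.ze z‖ ∧ p ∈ Ω} ∈ 𝓝 (γ t) := by
        rw [← hzγ, ← M.ze_surj_nhds hz]
        exact image_mem_map (h1.and h2)
      have h4 : ∀ᶠ s in 𝓝[>] t, γ s ∈ M.ze '' {p | |M.u p - M.u z| ≤ 2 * ‖M.ze p - M.ze z‖ ∧ p ∈ Ω} :=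
        (hγc.continuousAt.eventually h3).filter_mono nhdsWithin_le_nhds
      obtain ⟨s, ⟨p, ⟨hp1, hp2⟩, hp3⟩, hs⟩ := (h4.and (Ioc_mem_nhdsGT hy)).exists
      refine ⟨s, ⟨p, hp2, hp3, ?_⟩, hs⟩
      rw [hp3, hzγ, hγsub, norm_smul, Real.norm_eq_abs, abs_of_pos (sub_pos.2 hs.1)] at hp1
      have := abs_sub_le (M.u p) (M.u z) (M.u q)
      nlinarith
  obtain ⟨z, hz, hzγ, -⟩ := key (right_mem_Icc.2 zero_le_one)
  exact ⟨z, hz, by rw [hzγ, hγ1]⟩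

/-- Derivative bound in the `ζ`-coordinate. -/
theorem zeta_hp {q : ℂ} (hq : q ∈ Ω) {R : ℝ} (hR : 0 < R) (hball : ball (M.ze q) R ⊆ M.ze '' Ω)
    {F : ℂ → ℂ} {l : ℂ → ℂ} (hF : ∀ z ∈ Ω, HasFDerivAt F (l z • M.DX z) z)
    (hpos : ∀ z ∈ Ω, 0 < (F z).re) : ‖l q / M.kz q‖ ≤ 2 * (F q).re / R := by
  have hd : ∀ z ∈ Ω, HasDerivAt (fun w => F (Function.invFunOn M.ze Ω w)) (l z / M.kz z) (M.ze z) :=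
    fun z hz => M.coord M.op (M.dze hz) (M.kz_ne z) M.ze_inj hz (hF z hz)
  have hg : ∀ z ∈ Ω, Function.invFunOn M.ze Ω (M.ze z) = z := fun z hz =>
    M.ze_inj (Function.invFunOn_mem ⟨z, hz, rfl⟩) hz (Function.invFunOn_eq ⟨z, hz, rfl⟩)
  have h := hp_deriv_le (f := fun w => F (Function.invFunOn M.ze Ω w)) hR (c := M.ze q) (by
    intro w hw
    obtain ⟨z, hz, rfl⟩ := hball hw
    exact (hd z hz).differentiableAt.differentiableWithinAt) (by
    intro w hw
    obtain ⟨z, hz, rfl⟩ := hball hw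
    simp only [hg z hz]
    exact hpos z hz)
  rw [(hd q hq).deriv] at h
  simp only [hg q hq] at h
  exact h

/-- Interior curvature estimate. -/
theorem thmA {q : ℂ} (hq : q ∈ Ω) {R : ℝ} (hR : 0 < R) (hball : ball (M.ze q) R ⊆ M.ze '' Ω) :
    |M.a q * M.c q - M.b q ^ 2| / M.W q ^ 4 ≤ 16 / R ^ 2 := by
  set g := Function.invFunOn M.ze Ω with hgdef
  have hg : ∀ z ∈ Ω, g (M.ze z) = z := fun z hz =>
    M.ze_inj (Function.invFunOn_mem ⟨z, hz, rfl⟩) hz (Function.invFunOn_eq ⟨z, hz, rfl⟩)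
  have d1 : ∀ z ∈ Ω, HasDerivAt (fun w => (M.Ps - M.Y) (g w)) (M.H0 z / M.kz z) (M.ze z) := by
    intro z hz
    refine M.coord M.op (M.dze hz) (M.kz_ne z) M.ze_inj hz ?_
    refine ((M.dPs' hz).sub (M.dY' hz)).hasFDerivAt.congr_fderiv ?_
    refine ContinuousLinearMap.ext fun v => ?_
    rw [M.H0_eq]
    simp
    ring
  have d2 : ∀ z ∈ Ω, HasDerivAt (fun w => M.X (g w)) (1 / M.kz z) (M.ze z) := by
    intro z hz
    refine M.coord M.op (M.dze hz) (M.kz_ne z) M.ze_inj hz ?_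
    rw [one_smul]
    exact (M.dX hz).hasFDerivAt
  set h : ℂ → ℂ := fun w => deriv (fun w => (M.Ps - M.Y) (g w)) w / deriv (fun w => M.X (g w)) w with hh
  have hval : ∀ z ∈ Ω, h (M.ze z) = M.H0 z := by
    intro z hz
    simp only [hh]
    rw [(d1 z hz).deriv, (d2 z hz).deriv]
    have := M.kz_ne z
    field_simp
  have hO : IsOpen (ball (M.ze q) R) := isOpen_ball
  have hdiff : DifferentiableOn ℂ h (ball (M.ze q) R) := by
    refine DifferentiableOn.div (DifferentiableOn.deriv ?_ hO) (DifferentiableOn.deriv ?_ hO) ?_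
    · intro w hw
      obtain ⟨z, hz, rfl⟩ := hball hw
      exact (d1 z hz).differentiableAt.differentiableWithinAt
    · intro w hw
      obtain ⟨z, hz, rfl⟩ := hball hw
      exact (d2 z hz).differentiableAt.differentiableWithinAt
    · intro w hw
      obtain ⟨z, hz, rfl⟩ := hball hw
      rw [(d2 z hz).deriv]
      exact one_div_ne_zero (M.kz_ne z)
  have hqb : M.ze q ∈ ball (M.ze q) R := mem_ball_self hR
  have hdq : HasDerivAt h (deriv h (M.ze q)) (M.ze q) :=
    (hdiff.differentiableAt (hO.mem_nhds hqb)).hasDerivAt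
  have hb := hp_deriv_le (f := fun w => -Complex.I * h w) hR (hdiff.const_mul _) (by
    intro w hw
    obtain ⟨z, hz, rfl⟩ := hball hw
    simp only [hval z hz]
    simpa using M.H0_im_pos z)
  rw [(hdq.const_mul (-Complex.I)).deriv] at hb
  simp only [norm_mul, norm_neg, Complex.norm_I, one_mul, hval q hq] at hb
  have hc := M.curv_coord M.op subset_rfl (M.dze hq).hasFDerivAt hq hdq
    (fun y hy => (hval y hy).symm)
  have hS := M.S_pos q
  have hW := M.W_ge_one q
  have hI : (-Complex.I * M.H0 q).re = 1 / (M.W q + M.P q) := by simp [H0]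
  rw [hI] at hb
  rw [hc, mul_assoc (Complex.normSq _), M.normSq_kz, Complex.normSq_eq_norm_sq]
  rw [div_le_div_iff₀ (by positivity) (by positivity)]
  set m := ‖deriv h (M.ze q)‖
  have hm0 : 0 ≤ m := norm_nonneg _
  have h1 : m * (M.W q + M.P q) * R ≤ 2 := by
    rw [le_div_iff₀ hR] at hb
    have := mul_le_mul_of_nonneg_right hb hS.le
    have e : 2 * (1 / (M.W q + M.P q)) * (M.W q + M.P q) = 2 := by field_simp
    linarith
  have h2 : (m * (M.W q + M.P q) * R) ^ 2 ≤ 2 ^ 2 := by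
    apply pow_le_pow_left₀ (by positivity) h1
  have h3 : (1 + M.W q) ^ 2 ≤ 4 * M.W q ^ 4 := by nlinarith [sq_nonneg (M.W q ^ 2 - 1), sq_nonneg (M.W q - 1)]
  calc m ^ 2 * (1 + M.W q) ^ 2 * (M.W q + M.P q) ^ 2 * R ^ 2
      = (m * (M.W q + M.P q) * R) ^ 2 * (1 + M.W q) ^ 2 := by ring
    _ ≤ 2 ^ 2 * (4 * M.W q ^ 4) := by gcongr
    _ = 16 * M.W q ^ 4 := by ring

/-- Edge estimate for the tangential derivative. -/
theorem edge_est {q : ℂ} (hq : q ∈ Ω) {R : ℝ} (hR : 0 < R) (hball : ball (M.ze q) R ⊆ M.ze '' Ω)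
    {n1 n2 k : ℝ} (hn : n1 ^ 2 + n2 ^ 2 = 1)
    (hpos : ∀ z ∈ Ω, 0 < n1 * z.re + n2 * z.im - k) :
    1 + (n1 * M.Q q - n2 * M.P q) ^ 2 ≤ (4 * (n1 * q.re + n2 * q.im - k) / R) ^ 2 * M.W q ^ 2 := by
  have h := M.zeta_hp hq hR hball (F := fun z => n1 * M.X z + n2 * M.Y z - k)
    (l := fun z => n1 + n2 * M.C0 z) (by
      intro z hz
      have h1 := (((M.dX hz).const_mul (n1:ℂ)).add ((M.dY' hz).const_mul (n2:ℂ))).sub_const (k:ℂ)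
      refine h1.hasFDerivAt.congr_fderiv ?_
      refine ContinuousLinearMap.ext fun v => ?_
      simp
      ring) (by
      intro z hz
      simpa [X, Y] using hpos z hz)
  have e1 : (n1 * M.X q + n2 * M.Y q - k : ℂ).re = n1 * q.re + n2 * q.im - k := by simp [X, Y]
  simp only [e1] at h
  have hd := hpos q hq
  set d := n1 * q.re + n2 * q.im - k
  have hsq : Complex.normSq (n1 + n2 * M.C0 q) ≤ (2 * d / R) ^ 2 * Complex.normSq (M.kz q) := by
    rw [norm_div, div_le_iff₀ (norm_pos_iff.2 (M.kz_ne q))] at h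
    rw [Complex.normSq_eq_norm_sq, Complex.normSq_eq_norm_sq, ← mul_pow]
    exact pow_le_pow_left₀ (norm_nonneg _) h 2
  have hQ := M.Qp q
  have h2 := mul_le_mul_of_nonneg_right hsq hQ.le
  rw [mul_assoc, M.normSq_kz] at h2
  have h3 : Complex.normSq (n1 + n2 * M.C0 q) * (1 + M.Q q ^ 2) =
      1 + (n1 * M.Q q - n2 * M.P q) ^ 2 := by
    have hp : M.W q ^ 2 = 1 + M.P q ^ 2 + M.Q q ^ 2 := M.Wsq q
    simp [C0, Complex.normSq_apply]
    field_simp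
    linear_combination n2 ^ 2 * hp + (1 + M.Q q ^ 2) * hn
  rw [h3] at h2
  refine h2.trans ?_
  have hW := M.W_ge_one q
  have h4 : (1 + M.W q) ^ 2 ≤ 4 * M.W q ^ 2 := by nlinarith
  calc (2 * d / R) ^ 2 * (1 + M.W q) ^ 2 ≤ (2 * d / R) ^ 2 * (4 * M.W q ^ 2) := by gcongr
    _ = _ := by ring

end MS

namespace MS
variable {Ω : Set ℂ} (M : MS Ω)

theorem psi_lip : LipschitzOnWith 1 M.ψ Ω := by
  refine M.cv.lipschitzOnWith_of_nnnorm_hasFDerivWithin_le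
    (fun z hz => (M.dψ z hz).hasFDerivAt.hasFDerivWithinAt) ?_
  intro z hz
  rw [← NNReal.coe_le_coe, coe_nnnorm]
  refine ContinuousLinearMap.opNorm_le_bound _ (by simp) ?_
  intro v
  rw [lin_apply, Real.norm_eq_abs]
  simp only [NNReal.coe_one, one_mul]
  apply abs_le_of_sq_le_sq _ (norm_nonneg _)
  rw [← Complex.normSq_eq_norm_sq, Complex.normSq_apply]
  have hW := M.Wpos z
  have h3 := M.Wsq z
  have e : -M.Q z / M.W z * v.re + M.P z / M.W z * v.im = (-M.Q z * v.re + M.P z * v.im) / M.W z := by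
    ring
  rw [e, div_pow, div_le_iff₀ (by positivity), h3]
  nlinarith [sq_nonneg (M.P z * v.re + M.Q z * v.im), sq_nonneg v.re, sq_nonneg v.im]

/-- Replace `ψ` by a globally Lipschitz normalization. -/
theorem normalize : ∃ N : MS Ω, N.u = M.u ∧ N.P = M.P ∧ N.Q = M.Q ∧ N.a = M.a ∧ N.b = M.b ∧
    N.c = M.c ∧ N.W = M.W ∧ LipschitzWith 1 N.ψ ∧ N.ψ 0 = 0 := by
  obtain ⟨g, hg, hE⟩ := M.psi_lip.extend_real
  refine ⟨{ M with
    ψ := fun z => g z - g 0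
    dψ := ?_ }, rfl, rfl, rfl, rfl, rfl, rfl, rfl, ?_, by simp⟩
  · intro z hz
    refine ((M.dψ z hz).congr_of_eventuallyEq ?_).sub_const (g 0)
    filter_upwards [M.op.mem_nhds hz] with y hy using hE hy
  · exact LipschitzWith.of_dist_le_mul fun x y => by
      have := hg.dist_le_mul x y
      rw [Real.dist_eq] at this ⊢
      rw [sub_sub_sub_cancel_right]
      exact this

/-- The vertex configuration. -/
structure VS {Ω : Set ℂ} (M : MS Ω) (r c σ : ℝ) : Prop where
  r0 : 0 < r
  c0 : 0 ≤ c
  s0 : 0 < σ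
  cs : c ^ 2 + σ ^ 2 = 1
  cone : ∀ η : ℝ, (η = 1 ∨ η = -1) → ∀ z ∈ Ω, 0 < σ * z.re + η * c * z.im
  full : ∀ z : ℂ, ‖z‖ < r → c * |z.im| < σ * z.re → z ∈ Ω
  edge : ∀ η : ℝ, (η = 1 ∨ η = -1) → ∀ ρ : ℝ, 0 < ρ → ρ < r →
    Tendsto (fun z => η * M.u z) (𝓝[Ω] ⟨ρ * c, -η * ρ * σ⟩) atTop
  lip : LipschitzWith 1 M.ψ
  psi0 : M.ψ 0 = 0

namespace VS
variable {M} {r c σ : ℝ}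

theorem psi_lip (V : VS M r c σ) (x y : ℂ) : |M.ψ x - M.ψ y| ≤ ‖x - y‖ := by
  have := V.lip.dist_le_mul x y
  rw [Real.dist_eq, dist_eq_norm] at this
  simpa using this

theorem sle (V : VS M r c σ) : σ ≤ 1 := by nlinarith [V.cs, V.c0, V.s0]
theorem cle (V : VS M r c σ) : c ≤ 1 := by nlinarith [V.cs, V.c0, V.s0]

theorem mem_iff (V : VS M r c σ) {z : ℂ} (hz : ‖z‖ < r) : z ∈ Ω ↔ c * |z.im| < σ * z.re := by
  refine ⟨fun h => ?_, V.full z hz⟩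
  have h1 := V.cone 1 (Or.inl rfl) z h
  have h2 := V.cone (-1) (Or.inr rfl) z h
  rcases abs_cases z.im with ⟨e, _⟩ | ⟨e, _⟩ <;> rw [e] <;> nlinarith

/-- frontier points near the vertex -/
theorem frontier_pt (V : VS M r c σ) {x : ℂ} (hx : x ∈ frontier Ω) (hr : ‖x‖ < r) :
    σ * x.re = c * |x.im| := by
  have hcl : x ∈ closure Ω := hx.1
  have hn : x ∉ Ω := by
    have := hx.2
    rwa [M.op.interior_eq] at this
  have h1 : ∀ η : ℝ, (η = 1 ∨ η = -1) → 0 ≤ σ * x.re + η * c * x.im := by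
    intro η hη
    have hc : IsClosed {z : ℂ | 0 ≤ σ * z.re + η * c * z.im} :=
      isClosed_le continuous_const (by fun_prop)
    exact closure_minimal (fun z hz => (V.cone η hη z hz).le) hc hcl
  have h2 := h1 1 (Or.inl rfl)
  have h3 := h1 (-1) (Or.inr rfl)
  have h4 : ¬ (c * |x.im| < σ * x.re) := fun h => hn (V.full x hr h)
  push Not at h4
  refine le_antisymm h4 ?_
  rcases abs_cases x.im with ⟨e, _⟩ | ⟨e, _⟩ <;> rw [e] <;> nlinarith

/-- a nonzero point of the boundary rays -/
theorem ray_eq (V : VS M r c σ) {x : ℂ} (hx : σ * x.re = c * |x.im|) (h0 : x ≠ 0) :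
    ∃ η : ℝ, (η = 1 ∨ η = -1) ∧ 0 < ‖x‖ ∧ x = ⟨‖x‖ * c, -η * ‖x‖ * σ⟩ := by
  have hn : 0 < ‖x‖ := norm_pos_iff.2 h0
  have hσ := V.s0
  have hsq : ‖x‖ ^ 2 = x.re ^ 2 + x.im ^ 2 := by
    rw [← Complex.normSq_eq_norm_sq, Complex.normSq_apply]; ring
  have him : |x.im| = ‖x‖ * σ := by
    have h1 : (‖x‖ * σ) ^ 2 = |x.im| ^ 2 := by
      rw [mul_pow, hsq]
      have e2 : σ ^ 2 * x.re ^ 2 = c ^ 2 * |x.im| ^ 2 := by rw [← mul_pow, hx, mul_pow]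
      rw [sq_abs] at *
      nlinarith [V.cs]
    exact ((pow_left_inj₀ (by positivity) (abs_nonneg _) two_ne_zero).1 h1).symm
  have hre : x.re = ‖x‖ * c := by
    rw [him] at hx
    have : σ * (x.re - ‖x‖ * c) = 0 := by linarith
    rcases mul_eq_zero.1 this with h | h
    · exact absurd h hσ.ne'
    · linarith
  rcases abs_cases x.im with ⟨e, _⟩ | ⟨e, _⟩
  · refine ⟨-1, Or.inr rfl, hn, Complex.ext hre ?_⟩
    simp only
    linarith
  · refine ⟨1, Or.inl rfl, hn, Complex.ext hre ?_⟩
    simp only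
    linarith

theorem blowup (V : VS M r c σ) {x : ℂ} (hx : x ∈ frontier Ω) (hr : ‖x‖ < r) (h0 : x ≠ 0) :
    Tendsto (fun z => |M.u z|) (𝓝[Ω] x) atTop := by
  obtain ⟨η, hη, hn, he⟩ := V.ray_eq (V.frontier_pt hx hr) h0
  have h := V.edge η hη ‖x‖ hn hr
  rw [← he] at h
  refine tendsto_atTop_mono (fun z => ?_) h
  rcases hη with rfl | rfl
  · rw [one_mul]; exact le_abs_self _
  · rw [neg_one_mul]; exact neg_le_abs _

theorem norm_edge (V : VS M r c σ) {η ρ : ℝ} (hη : η = 1 ∨ η = -1) (hρ : 0 ≤ ρ) :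
    ‖(⟨ρ * c, -η * ρ * σ⟩ : ℂ)‖ = ρ := by
  have h1 : ‖(⟨ρ * c, -η * ρ * σ⟩ : ℂ)‖ ^ 2 = ρ ^ 2 := by
    rw [← Complex.normSq_eq_norm_sq, Complex.normSq_apply]
    simp only
    rcases hη with rfl | rfl <;> linear_combination ρ ^ 2 * V.cs
  exact (pow_left_inj₀ (norm_nonneg _) hρ two_ne_zero).1 h1

/-- Local structure near an edge point. -/
theorem near (V : VS M r c σ) {η ρ R : ℝ} (hη : η = 1 ∨ η = -1) (hρ : 0 < ρ) (hR1 : 2 * R ≤ σ * ρ)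
    (hR2 : 2 * R ≤ r - ρ) {z : ℂ} (hz : ‖z - ⟨ρ * c, -η * ρ * σ⟩‖ < 2 * R) :
    ‖z‖ < r ∧ z ≠ 0 ∧ 0 < - η * z.im ∧ (z ∈ Ω ↔ 0 < σ * z.re + η * c * z.im) := by
  have hx := V.norm_edge hη hρ.le
  set x : ℂ := ⟨ρ * c, -η * ρ * σ⟩ with hxdef
  have h1 : ‖z‖ < r := by
    have := norm_sub_norm_le z x
    linarith
  have h2 : 0 < - η * z.im := by
    have h3 := abs_lt.1 (lt_of_le_of_lt (Complex.abs_im_le_norm (z - x)) hz)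
    have : x.im = -η * ρ * σ := rfl
    rw [Complex.sub_im, this] at h3
    rcases hη with rfl | rfl <;> linarith [h3.1, h3.2]
  have habs : |z.im| = - η * z.im := by
    rcases hη with rfl | rfl
    · rw [abs_of_nonpos] <;> linarith
    · rw [abs_of_nonneg] <;> linarith
  refine ⟨h1, ?_, h2, ?_⟩
  · rintro rfl; simp at h2
  · rw [V.mem_iff h1, habs]
    constructor <;> intro h <;> linarith

theorem near_est (V : VS M r c σ) {η ρ R : ℝ} (hη : η = 1 ∨ η = -1) (hρ : 0 < ρ) (hR : 0 < R) (hR1 : 2 * R ≤ σ * ρ)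
    (hR2 : 2 * R ≤ r - ρ) {z : ℂ} (hzΩ : z ∈ Ω) (hz : ‖z - ⟨ρ * c, -η * ρ * σ⟩‖ < R) :
    1 + (σ * M.Q z - η * c * M.P z) ^ 2 ≤ (4 * (σ * z.re + η * c * z.im) / R) ^ 2 * M.W z ^ 2 := by
  have hball : ball (M.ze z) R ⊆ M.ze '' Ω := by
    refine M.disk hzΩ ?_
    intro x hx hd
    have : ‖x - ⟨ρ * c, -η * ρ * σ⟩‖ < 2 * R := by
      rw [dist_eq_norm] at hd
      have := norm_sub_le_norm_sub_add_norm_sub x z ⟨ρ * c, -η * ρ * σ⟩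
      linarith
    obtain ⟨h1, h2, _, _⟩ := V.near hη hρ hR1 hR2 this
    exact V.blowup hx h1 h2
  have := M.edge_est hzΩ hR hball (n1 := σ) (n2 := η * c) (k := 0) (by
    rcases hη with rfl | rfl <;> linarith [V.cs]) (by
    intro w hw
    have := V.cone η hη w hw
    linarith)
  simpa using this

theorem d_le (V : VS M r c σ) {η ρ : ℝ} (hη : η = 1 ∨ η = -1) (z : ℂ) :
    |σ * z.re + η * c * z.im| ≤ ‖z - ⟨ρ * c, -η * ρ * σ⟩‖ := by
  apply abs_le_of_sq_le_sq _ (norm_nonneg _)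
  rw [← Complex.normSq_eq_norm_sq, Complex.normSq_apply]
  simp only [Complex.sub_re, Complex.sub_im]
  have hη2 : η ^ 2 = 1 := by rcases hη with rfl | rfl <;> norm_num
  have hcs := V.cs
  have e : σ * z.re + η * c * z.im = σ * (z.re - ρ * c) + η * c * (z.im - -η * ρ * σ) := by
    linear_combination (-ρ * c * σ) * hη2
  rw [e]
  have key : ∀ A B : ℝ, (σ * A + η * c * B) ^ 2 ≤ A * A + B * B := by
    intro A B
    have e2 : A * A + B * B - (σ * A + η * c * B) ^ 2 = (η * c * A - σ * B) ^ 2 := by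
      linear_combination (-(A ^ 2 + B ^ 2)) * hcs - c ^ 2 * (A ^ 2 + B ^ 2) * hη2
    nlinarith [sq_nonneg (η * c * A - σ * B)]
  exact key _ _

/-- Sign and size of the normal derivative near an edge. -/
theorem normal_est (V : VS M r c σ) {η ρ R : ℝ} (hη : η = 1 ∨ η = -1) (hρ : 0 < ρ) (hR : 0 < R) (hR1 : 2 * R ≤ σ * ρ)
    (hR2 : 2 * R ≤ r - ρ) {z : ℂ} (hzΩ : z ∈ Ω) (hz : ‖z - ⟨ρ * c, -η * ρ * σ⟩‖ < R / 8) :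
    M.W z * (1 - (4 * (σ * z.re + η * c * z.im) / R) ^ 2) ≤ -η * (σ * M.P z + η * c * M.Q z) ∧
    0 < -η * (σ * M.P z + η * c * M.Q z) := by
  have hη2 : η ^ 2 = 1 := by rcases hη with rfl | rfl <;> norm_num
  have hcs := V.cs
  set x : ℂ := ⟨ρ * c, -η * ρ * σ⟩ with hx
  set f : ℂ → ℝ := fun w => -η * (σ * M.P w + η * c * M.Q w) with hf
  have hsq : ∀ w ∈ Ω, ‖w - x‖ < R / 8 → 0 < (1 - (4 * (σ * w.re + η * c * w.im) / R) ^ 2) ∧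
      M.W w ^ 2 * (1 - (4 * (σ * w.re + η * c * w.im) / R) ^ 2) ≤ f w ^ 2 := by
    intro w hw hwx
    have h1 := V.near_est hη hρ hR hR1 hR2 hw (by rw [← hx]; linarith)
    have h2 := V.d_le (ρ := ρ) hη w
    rw [← hx] at h2
    have h3 := V.cone η hη w hw
    rw [abs_of_pos h3] at h2
    set d := σ * w.re + η * c * w.im
    have h5 : 4 * d / R < 1 := by rw [div_lt_one hR]; linarith
    have h6 : 0 < 4 * d / R := by positivity
    refine ⟨by nlinarith, ?_⟩
    have h4 := M.Wsq w
    have e : f w ^ 2 = M.W w ^ 2 - (1 + (σ * M.Q w - η * c * M.P w) ^ 2) := by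
      simp only [hf]
      rw [h4]
      linear_combination (σ * M.P w + η * c * M.Q w) ^ 2 * hη2 + (M.P w ^ 2 + M.Q w ^ 2) * hcs +
        (c ^ 2 * M.Q w ^ 2 + c ^ 2 * M.P w ^ 2) * hη2
    rw [e]
    linarith
  have hne : ∀ w ∈ Ω, ‖w - x‖ < R / 8 → f w ≠ 0 := by
    intro w hw hwx h0
    obtain ⟨h1, h2⟩ := hsq w hw hwx
    rw [h0] at h2
    have := M.Wpos w
    have : 0 < M.W w ^ 2 * (1 - (4 * (σ * w.re + η * c * w.im) / R) ^ 2) := by positivity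
    linarith
  have hNconv : Convex ℝ (Ω ∩ ball x (R / 8)) := M.cv.inter (convex_ball _ _)
  have hfc : ContinuousOn f (Ω ∩ ball x (R / 8)) := by
    intro w hw
    have := M.cP w hw.1
    have := M.cQ w hw.1
    exact ContinuousAt.continuousWithinAt (by simp only [hf]; fun_prop)
  have hpos : 0 < f z := by
    by_contra hcon
    have hneg : ∀ w ∈ Ω ∩ ball x (R / 8), f w < 0 := by
      intro w hw
      by_contra hw0
      push Not at hw0 hcon
      obtain ⟨y, hy, hy0⟩ := hNconv.isPreconnected.intermediate_value
        ⟨hzΩ, by rwa [mem_ball, dist_eq_norm]⟩ hw hfc ⟨hcon, hw0⟩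
      exact hne y hy.1 (by have := hy.2; rwa [mem_ball, dist_eq_norm] at this) hy0
    -- move towards the edge
    set n : ℂ := ⟨σ, η * c⟩ with hn
    set d := σ * z.re + η * c * z.im with hd
    have hd0 : 0 < d := V.cone η hη z hzΩ
    set q : ℝ → ℂ := fun t => z - t • n with hq
    have hqre : ∀ t, (q t).re = z.re - t * σ := fun t => by simp [hq, hn]
    have hqim : ∀ t, (q t).im = z.im - t * (η * c) := fun t => by simp [hq, hn]
    have hdq : ∀ t, σ * (q t).re + η * c * (q t).im = d - t := by
      intro t
      rw [hqre, hqim, hd]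
      linear_combination (-t) * hcs - t * c ^ 2 * hη2
    have hqx : ∀ t, 0 ≤ t → t ≤ d → ‖q t - x‖ < R / 8 := by
      intro t ht htd
      refine lt_of_le_of_lt ?_ hz
      apply le_of_sq_le_sq _ (norm_nonneg _)
      rw [← Complex.normSq_eq_norm_sq, ← Complex.normSq_eq_norm_sq, Complex.normSq_apply,
        Complex.normSq_apply]
      simp only [Complex.sub_re, Complex.sub_im, hqre, hqim]
      have e : (z.re - t * σ - x.re) * (z.re - t * σ - x.re) +
          (z.im - t * (η * c) - x.im) * (z.im - t * (η * c) - x.im) =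
          (z.re - x.re) * (z.re - x.re) + (z.im - x.im) * (z.im - x.im) - 2 * t * d + t ^ 2 := by
        simp only [hx, hd]
        linear_combination t ^ 2 * hcs + t ^ 2 * c ^ 2 * hη2 - 2 * t * ρ * c * σ * hη2
      rw [e]
      nlinarith
    have hqΩ : ∀ t, 0 ≤ t → t < d → q t ∈ Ω := by
      intro t ht htd
      rw [(V.near hη hρ hR1 hR2 (z := q t) (by have := hqx t ht htd.le; rw [← hx]; linarith)).2.2.2, hdq]
      linarith
    have hbound : ∀ t, 0 ≤ t → t < d → η * M.u (q t) ≤ η * M.u z := by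
      intro t ht htd
      have hin : ∀ w ∈ segment ℝ (q t) z, w ∈ Ω ∩ ball x (R / 8) := by
        intro w hw
        refine hNconv.segment_subset ⟨hqΩ t ht htd, ?_⟩ ⟨hzΩ, ?_⟩ hw
        · rw [mem_ball, dist_eq_norm]; exact hqx t ht htd.le
        · rwa [mem_ball, dist_eq_norm]
      have := line_mono (f := fun w => η * M.u w) (x := q t) (y := z) (k := 0)
        (L := fun w => η • lin (M.P w) (M.Q w)) (by
          intro w hw
          exact (M.du w (hin w hw).1).hasFDerivAt.const_smul η) (by
          intro w hw
          have h1 := hneg w (hin w hw)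
          have e : z - q t = t • n := by simp [hq]
          rw [e]
          simp only [smul_apply, lin_apply, smul_eq_mul, Complex.smul_re,
            Complex.smul_im, hn]
          simp only [hf] at h1
          nlinarith)
      linarith
    -- limit point on the edge
    have hxd : σ * (q d).re + η * c * (q d).im = 0 := by rw [hdq]; ring
    obtain ⟨hk1, hk2, hk3, _⟩ := V.near hη hρ hR1 hR2 (z := q d) (by
      have := hqx d hd0.le le_rfl; rw [← hx]; linarith)
    have hηim : |(q d).im| = -η * (q d).im := by
      rcases hη with rfl | rfl
      · rw [abs_of_nonpos] <;> linarith
      · rw [abs_of_nonneg] <;> linarith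
    have hqd : q d = ⟨‖q d‖ * c, -η * ‖q d‖ * σ⟩ := by
      obtain ⟨η', hη', hnn, he⟩ := V.ray_eq (x := q d) (by rw [hηim]; linarith) hk2
      have h5 : (q d).im = -η' * ‖q d‖ * σ := congrArg Complex.im he
      have hs : 0 < ‖q d‖ * σ := mul_pos hnn V.s0
      have : η' = η := by
        rcases hη with rfl | rfl <;> rcases hη' with rfl | rfl <;> first | rfl | (exfalso; nlinarith)
      rw [← this]; exact he
    have hT := V.edge η hη ‖q d‖ (norm_pos_iff.2 hk2) hk1
    rw [← hqd] at hT
    have hqt : Tendsto q (𝓝[<] d) (𝓝[Ω] (q d)) := by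
      refine tendsto_nhdsWithin_iff.2 ⟨?_, ?_⟩
      · have : Continuous q := by fun_prop
        exact (this.tendsto d).mono_left nhdsWithin_le_nhds
      · filter_upwards [Ioo_mem_nhdsLT hd0] with t ht using hqΩ t ht.1.le ht.2
    have hev := (hT.comp hqt).eventually (eventually_gt_atTop (η * M.u z))
    obtain ⟨t, ht1, ht2⟩ := (hev.and (Ioo_mem_nhdsLT hd0)).exists
    have := hbound t ht2.1.le ht2.2
    simp only [Function.comp] at ht1
    linarith
  refine ⟨?_, hpos⟩
  obtain ⟨h1, h2⟩ := hsq z hzΩ hz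
  set s := 1 - (4 * (σ * z.re + η * c * z.im) / R) ^ 2
  have hs1 : s ≤ 1 := by
    have := sq_nonneg (4 * (σ * z.re + η * c * z.im) / R)
    simp only [s]; linarith
  apply le_of_sq_le_sq _ hpos.le
  have hW := M.Wpos z
  refine le_trans ?_ h2
  rw [mul_pow]
  have : s ^ 2 ≤ s := by nlinarith
  gcongr

end VS
end MS

namespace MS
variable {Ω : Set ℂ} {M : MS Ω}
namespace VS
variable {r c σ : ℝ}

theorem psi_edge (V : VS M r c σ) {η ρ : ℝ} (hη : η = 1 ∨ η = -1) (hρ : 0 ≤ ρ) (hr : ρ < r) :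
    ρ ≤ M.ψ ⟨ρ * c, -η * ρ * σ⟩ := by
  have hη2 : η ^ 2 = 1 := by rcases hη with rfl | rfl <;> norm_num
  have hcs := V.cs
  rcases hρ.eq_or_lt with rfl | hρ
  · have e : (⟨0 * c, -η * 0 * σ⟩ : ℂ) = 0 := by apply Complex.ext <;> simp
    rw [e, V.psi0]
  have main : ∀ ρ1, 0 < ρ1 → ρ1 < ρ → ρ - 2 * ρ1 ≤ M.ψ ⟨ρ * c, -η * ρ * σ⟩ := by
    intro ρ1 h1 h12
    set R := min (σ * ρ1) (r - ρ) / 2 with hRdef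
    have hR : 0 < R := by
      have : 0 < min (σ * ρ1) (r - ρ) := lt_min (mul_pos V.s0 h1) (by linarith)
      rw [hRdef]; linarith
    have hR1 : 2 * R ≤ σ * ρ1 := by
      rw [hRdef]; have := min_le_left (σ * ρ1) (r - ρ); linarith
    have hR2 : 2 * R ≤ r - ρ := by
      rw [hRdef]; have := min_le_right (σ * ρ1) (r - ρ); linarith
    have hnn : ∀ t : ℝ, 0 ≤ t → ∀ a : ℝ,
        ‖(⟨a * c + t * σ, -η * a * σ + t * (η * c)⟩ : ℂ) - ⟨a * c, -η * a * σ⟩‖ = t := by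
      intro t ht a
      have : ‖(⟨a * c + t * σ, -η * a * σ + t * (η * c)⟩ : ℂ) - ⟨a * c, -η * a * σ⟩‖ ^ 2 = t ^ 2 := by
        rw [← Complex.normSq_eq_norm_sq, Complex.normSq_apply]
        simp only [Complex.sub_re, Complex.sub_im]
        linear_combination t ^ 2 * hcs + t ^ 2 * c ^ 2 * hη2
      exact (pow_left_inj₀ (norm_nonneg _) ht two_ne_zero).1 this
    have step : ∀ t, 0 < t → t < R / 8 →
        ρ - 2 * ρ1 - 2 * t - (4 * t / R) ^ 2 * ρ ≤ M.ψ ⟨ρ * c, -η * ρ * σ⟩ := by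
      intro t ht htR
      have hpt : ∀ a, ρ1 ≤ a → a ≤ ρ → (⟨a * c + t * σ, -η * a * σ + t * (η * c)⟩ : ℂ) ∈ Ω ∧
          M.W ⟨a * c + t * σ, -η * a * σ + t * (η * c)⟩ * (1 - (4 * t / R) ^ 2) ≤
          -η * (σ * M.P ⟨a * c + t * σ, -η * a * σ + t * (η * c)⟩ +
            η * c * M.Q ⟨a * c + t * σ, -η * a * σ + t * (η * c)⟩) := by
        intro a ha1 ha2
        have hs : σ * ρ1 ≤ σ * a := mul_le_mul_of_nonneg_left ha1 V.s0.le
        have hz := hnn t ht.le a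
        set z : ℂ := ⟨a * c + t * σ, -η * a * σ + t * (η * c)⟩ with hzd
        have hd : σ * z.re + η * c * z.im = t := by
          simp only [hzd]
          linear_combination t * hcs + (t * c ^ 2 - a * c * σ) * hη2
        have ha0 : 0 < a := by linarith
        have hm : z ∈ Ω := by
          rw [(V.near hη ha0 (R := R) (by linarith) (by linarith) (z := z) (by rw [hz]; linarith)).2.2.2, hd]
          exact ht
        have := V.normal_est hη ha0 hR (by linarith) (by linarith) hm (by rw [hz]; exact htR)
        rw [hd] at this
        exact ⟨hm, this.1⟩
      have hseg : ∀ w ∈ segment ℝ (⟨ρ1 * c + t * σ, -η * ρ1 * σ + t * (η * c)⟩ : ℂ)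
          ⟨ρ * c + t * σ, -η * ρ * σ + t * (η * c)⟩, ∃ a, ρ1 ≤ a ∧ a ≤ ρ ∧
          w = ⟨a * c + t * σ, -η * a * σ + t * (η * c)⟩ := by
        intro w hw
        rw [segment_eq_image'] at hw
        obtain ⟨θ, hθ, rfl⟩ := hw
        refine ⟨ρ1 + θ * (ρ - ρ1), by nlinarith [hθ.1], by nlinarith [hθ.2], ?_⟩
        apply Complex.ext <;> simp <;> ring
      have hl := line_mono (f := M.ψ) (k := (ρ - ρ1) * (1 - (4 * t / R) ^ 2))
        (L := fun w => lin (-M.Q w / M.W w) (M.P w / M.W w))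
        (x := ⟨ρ1 * c + t * σ, -η * ρ1 * σ + t * (η * c)⟩)
        (y := ⟨ρ * c + t * σ, -η * ρ * σ + t * (η * c)⟩) (by
          intro w hw
          obtain ⟨a, ha1, ha2, rfl⟩ := hseg w hw
          exact (M.dψ _ (hpt a ha1 ha2).1).hasFDerivAt) (by
          intro w hw
          obtain ⟨a, ha1, ha2, rfl⟩ := hseg w hw
          have h3 := (hpt a ha1 ha2).2
          set z : ℂ := ⟨a * c + t * σ, -η * a * σ + t * (η * c)⟩ with hzd
          have hW := M.Wpos z
          simp only [lin_apply, Complex.sub_re, Complex.sub_im]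
          have e : -M.Q z / M.W z * (ρ * c + t * σ - (ρ1 * c + t * σ)) +
              M.P z / M.W z * (-η * ρ * σ + t * (η * c) - (-η * ρ1 * σ + t * (η * c))) =
              (ρ - ρ1) * (-η * (σ * M.P z + η * c * M.Q z) / M.W z) := by
            field_simp
            linear_combination (ρ - ρ1) * c * M.Q z * hη2
          rw [e]
          apply mul_le_mul_of_nonneg_left _ (by linarith)
          rw [le_div_iff₀ hW]
          linarith)
      have l1 := V.psi_lip ⟨ρ * c + t * σ, -η * ρ * σ + t * (η * c)⟩ ⟨ρ * c, -η * ρ * σ⟩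
      have l2 := V.psi_lip ⟨ρ1 * c + t * σ, -η * ρ1 * σ + t * (η * c)⟩ ⟨ρ1 * c, -η * ρ1 * σ⟩
      have l3 := V.psi_lip ⟨ρ1 * c, -η * ρ1 * σ⟩ 0
      rw [hnn t ht.le] at l1 l2
      rw [sub_zero, V.norm_edge hη h1.le, V.psi0] at l3
      have l1' := (abs_le.1 l1)
      have l2' := (abs_le.1 l2)
      have l3' := (abs_le.1 l3)
      have : 0 ≤ (4 * t / R) ^ 2 * ρ1 := by positivity
      nlinarith [l1'.1, l1'.2, l2'.1, l2'.2, l3'.1, l3'.2]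
    have hT : Tendsto (fun t : ℝ => ρ - 2 * ρ1 - 2 * t - (4 * t / R) ^ 2 * ρ) (𝓝[>] 0)
        (𝓝 (ρ - 2 * ρ1 - 2 * 0 - (4 * 0 / R) ^ 2 * ρ)) := by
      have : Continuous (fun t : ℝ => ρ - 2 * ρ1 - 2 * t - (4 * t / R) ^ 2 * ρ) := by fun_prop
      exact (this.tendsto 0).mono_left nhdsWithin_le_nhds
    have := le_of_tendsto hT (by
      filter_upwards [Ioo_mem_nhdsGT (show (0:ℝ) < R / 8 by linarith)] with t ht using step t ht.1 ht.2)
    simpa using this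
  have hT : Tendsto (fun t : ℝ => ρ - 2 * t) (𝓝[>] 0) (𝓝 (ρ - 2 * 0)) := by
    have : Continuous (fun t : ℝ => ρ - 2 * t) := by fun_prop
    exact (this.tendsto 0).mono_left nhdsWithin_le_nhds
  have := le_of_tendsto hT (by
    filter_upwards [Ioo_mem_nhdsGT hρ] with t ht using main t ht.1 ht.2)
  simpa using this

theorem psi_edge_eq (V : VS M r c σ) {η ρ : ℝ} (hη : η = 1 ∨ η = -1) (hρ : 0 ≤ ρ) (hr : ρ < r) :
    M.ψ ⟨ρ * c, -η * ρ * σ⟩ = ρ := by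
  refine le_antisymm ?_ (V.psi_edge hη hρ hr)
  have := V.psi_lip ⟨ρ * c, -η * ρ * σ⟩ 0
  rw [sub_zero, V.norm_edge hη hρ, V.psi0, sub_zero] at this
  exact (abs_le.1 this).2

end VS

variable (M)
def bb (z : ℂ) : ℝ := (5 * z.re + 3 * M.ψ z) / 4
def B (z : ℂ) : ℂ := ⟨M.bb z, (5 * M.G z - 3 * M.u z) / 4⟩
variable {M}

namespace VS
variable {r c σ : ℝ}

theorem im_limit (V : VS M r c σ) {η ρ : ℝ} (hη : η = 1 ∨ η = -1) (hρ : 0 < ρ) (hr : ρ < r) :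
    Tendsto (fun z => -η * (M.B z).im) (𝓝[Ω] ⟨ρ * c, -η * ρ * σ⟩) atTop := by
  have hη2 : η ^ 2 = 1 := by rcases hη with rfl | rfl <;> norm_num
  have hcs := V.cs
  set R := min (σ * ρ) (r - ρ) / 2 with hRdef
  have hR : 0 < R := by
    have : 0 < min (σ * ρ) (r - ρ) := lt_min (mul_pos V.s0 hρ) (by linarith)
    rw [hRdef]; linarith
  have hR1 : 2 * R ≤ σ * ρ := by
    rw [hRdef]; have := min_le_left (σ * ρ) (r - ρ); linarith
  have hR2 : 2 * R ≤ r - ρ := by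
    rw [hRdef]; have := min_le_right (σ * ρ) (r - ρ); linarith
  set x : ℂ := ⟨ρ * c, -η * ρ * σ⟩ with hx
  set n : ℂ := ⟨σ, η * c⟩ with hn
  have hnn : ‖n‖ = 1 := by
    have : ‖n‖ ^ 2 = 1 ^ 2 := by
      rw [← Complex.normSq_eq_norm_sq, Complex.normSq_apply]
      simp only [hn]
      linear_combination hcs + c ^ 2 * hη2
    exact (pow_left_inj₀ (norm_nonneg _) zero_le_one two_ne_zero).1 this
  set t0 := R / 40 with ht0
  have ht : 0 < t0 := by rw [ht0]; linarith
  have hdq : ∀ q : ℂ, ∀ t : ℝ, σ * (q + t • n).re + η * c * (q + t • n).im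
      = σ * q.re + η * c * q.im + t := by
    intro q t
    simp [hn]
    linear_combination t * hcs + t * c ^ 2 * hη2
  have hnear : ∀ q : ℂ, ‖q - x‖ ≤ t0 → ∀ t : ℝ, 0 ≤ t → t ≤ t0 → ‖q + t • n - x‖ ≤ R / 20 := by
    intro q hq t h1 h2
    have e : q + t • n - x = (q - x) + t • n := by ring
    rw [e]
    refine (norm_add_le _ _).trans ?_
    rw [norm_smul, hnn, Real.norm_eq_abs, abs_of_nonneg h1]
    linarith
  have hxd : σ * x.re + η * c * x.im = 0 := by
    simp only [hx]
    linear_combination (-ρ * c * σ) * hη2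
  have hmem : ∀ q : ℂ, 0 ≤ σ * q.re + η * c * q.im → ‖q - x‖ ≤ t0 → q + t0 • n ∈ Ω := by
    intro q h0 hq
    have h1 := hnear q hq t0 ht.le le_rfl
    rw [(V.near hη hρ hR1 hR2 (z := q + t0 • n) (by rw [← hx]; linarith)).2.2.2, hdq]
    linarith
  set φ : ℂ → ℝ := fun z => -η * (M.B z).im - η * M.u z / 2 with hφ
  have hstep : ∀ q ∈ Ω, ‖q - x‖ < t0 → φ (q + t0 • n) ≤ φ q := by
    intro q hq hqx
    have hq2 := hmem q (V.cone η hη q hq).le hqx.le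
    have hl := line_mono (f := fun z => -φ z) (x := q) (y := q + t0 • n) (k := 0)
      (L := fun z => (-((-η / 4) • ((5:ℝ) • lin (M.P z * M.Q z / M.W z) ((1 + M.Q z ^ 2) / M.W z) -
          (3:ℝ) • lin (M.P z) (M.Q z)) - (η / 2) • lin (M.P z) (M.Q z)))) (by
        intro w hw
        have hwΩ := M.cv.segment_subset hq hq2 hw
        have h1 := (M.dG w hwΩ).hasFDerivAt
        have h2 := (M.du w hwΩ).hasFDerivAt
        have h3 := ((((h1.const_smul (5:ℝ)).sub (h2.const_smul (3:ℝ))).const_smul (-η / 4)).sub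
          (h2.const_smul (η / 2))).neg
        refine h3.congr_of_eventuallyEq (Eventually.of_forall fun z => ?_)
        simp [hφ, B]
        ring) (by
        intro w hw
        have hwΩ := M.cv.segment_subset hq hq2 hw
        have hwx : ‖w - x‖ ≤ R / 20 := by
          rw [segment_eq_image'] at hw
          obtain ⟨θ, hθ, rfl⟩ := hw
          have e : q + θ • (q + t0 • n - q) = q + (θ * t0) • n := by
            rw [add_sub_cancel_left, smul_smul]
          simp only [e]
          exact hnear q hqx.le _ (mul_nonneg hθ.1 ht.le) (by nlinarith [hθ.2])
        have k1 := V.near_est hη hρ hR hR1 hR2 hwΩ (by rw [← hx]; linarith)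
        have k2 := (V.normal_est hη hρ hR hR1 hR2 hwΩ (by rw [← hx]; linarith)).2
        have k3 := V.d_le (ρ := ρ) hη w
        rw [← hx] at k3
        have k4 := V.cone η hη w hwΩ
        rw [abs_of_pos k4] at k3
        set d := σ * w.re + η * c * w.im with hd
        have hW := M.Wpos w
        have k5 : 4 * d / R ≤ 1 / 5 := by
          rw [div_le_iff₀ hR]; linarith
        have k6 : 0 ≤ 4 * d / R := by positivity
        have k7 : (4 * d / R) ^ 2 ≤ 1 / 25 := by nlinarith
        set E := σ * M.Q w - η * c * M.P w with hE
        set U := -η * (σ * M.P w + η * c * M.Q w) with hU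
        have k8 : E ≤ M.W w / 5 := by
          apply le_of_sq_le_sq _ (by positivity)
          have : (4 * d / R) ^ 2 * M.W w ^ 2 ≤ 1 / 25 * M.W w ^ 2 := by gcongr
          nlinarith
        have hQ : M.Q w = -c * U + σ * E := by
          rw [hU, hE]
          linear_combination (-M.Q w) * hcs - c ^ 2 * M.Q w * hη2
        have hQ2 : M.Q w ≤ M.W w / 5 := by
          rw [hQ]
          have h1 := V.sle
          have h2 := V.s0
          have h3 := V.c0
          nlinarith [mul_nonneg h3 k2.le, mul_le_mul_of_nonneg_left k8 h2.le]
        have e2 : q + t0 • n - q = t0 • n := by ring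
        rw [e2]
        simp only [_root_.neg_apply, _root_.sub_apply, smul_apply, lin_apply, smul_eq_mul, Complex.smul_re,
          Complex.smul_im, hn]
        have e3 : -(-η / 4 * (5 * (M.P w * M.Q w / M.W w * (t0 * σ) + (1 + M.Q w ^ 2) / M.W w * (t0 * (η * c))) -
            3 * (M.P w * (t0 * σ) + M.Q w * (t0 * (η * c)))) -
            η / 2 * (M.P w * (t0 * σ) + M.Q w * (t0 * (η * c)))) =
            t0 / (4 * M.W w) * (U * (M.W w - 5 * M.Q w) + 5 * c) := by
          rw [hU]
          field_simp
          linear_combination (10 * c) * hη2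
        rw [e3]
        have h3 := V.c0
        have : 0 ≤ M.W w - 5 * M.Q w := by linarith
        positivity)
    linarith
  have hx0 : x + t0 • n ∈ Ω := hmem x hxd.ge (by simp; exact ht.le)
  have hφc : ContinuousAt φ (x + t0 • n) := by
    have h1 := (M.dG _ hx0).continuousAt
    have h2 := (M.du _ hx0).continuousAt
    have e : φ = fun z => -η * ((5 * M.G z - 3 * M.u z) / 4) - η * M.u z / 2 := rfl
    rw [e]
    fun_prop
  have hlim : Tendsto (fun q => φ (q + t0 • n)) (𝓝[Ω] x) (𝓝 (φ (x + t0 • n))) := by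
    have : Tendsto (fun q : ℂ => q + t0 • n) (𝓝[Ω] x) (𝓝 (x + t0 • n)) := by
      have : Continuous (fun q : ℂ => q + t0 • n) := by fun_prop
      exact (this.tendsto x).mono_left nhdsWithin_le_nhds
    exact hφc.tendsto.comp this
  have hu : Tendsto (fun z => η * M.u z) (𝓝[Ω] x) atTop := V.edge η hη ρ hρ hr
  have hsum := hlim.add_atTop (hu.const_mul_atTop (show (0:ℝ) < 1 / 2 by norm_num))
  refine tendsto_atTop_mono' _ ?_ hsum
  have hb : ball x t0 ∈ 𝓝[Ω] x := mem_nhdsWithin_of_mem_nhds (ball_mem_nhds x ht)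
  filter_upwards [self_mem_nhdsWithin, hb] with q hq hqb
  have := hstep q hq (by rwa [mem_ball, dist_eq_norm] at hqb)
  have e : φ q = -η * (M.B q).im - η * M.u q / 2 := rfl
  linarith

end VS
end MS

namespace MS
variable {Ω : Set ℂ} (M : MS Ω)

def Mh (z : ℂ) : ℂ := (3 / 4 : ℂ) • M.X z + (5 / 4 : ℂ) • M.Ps z - M.Y z
def kB (z : ℂ) : ℂ := (5 + 3 * M.D0 z) / 4
def lM (z : ℂ) : ℂ := (3 + 5 * M.D0 z) / 4 - M.C0 z

theorem H0_ne (z : ℂ) : M.H0 z ≠ 0 := by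
  intro h
  have := M.H0_im_pos z
  rw [h] at this
  simp at this

theorem H0_3 (z : ℂ) : M.H0 z + 3 ≠ 0 := by
  intro h
  have h1 := M.H0_im_pos z
  have := congrArg Complex.im h
  simp at this
  linarith

theorem H0_13 (z : ℂ) : 3 * M.H0 z + 1 ≠ 0 := by
  intro h
  have h1 := M.H0_im_pos z
  have := congrArg Complex.im h
  simp at this
  linarith

theorem kB_eq (z : ℂ) : 8 * M.kB z * M.H0 z = (3 * M.H0 z + 1) * (M.H0 z + 3) := by
  rw [kB]
  linear_combination 3 * M.H0_mul z - 3 * M.H0 z * M.H0_eq z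

theorem lM_eq (z : ℂ) : 8 * M.lM z * M.H0 z = (3 * M.H0 z + 1) ^ 2 := by
  rw [lM]
  linear_combination M.H0_mul z - 9 * M.H0 z * M.H0_eq z

theorem kB_ne (z : ℂ) : M.kB z ≠ 0 := by
  intro h
  have := M.kB_eq z
  rw [h] at this
  have h2 := mul_ne_zero (M.H0_13 z) (M.H0_3 z)
  apply h2
  rw [← this]; ring

theorem lk_eq (z : ℂ) : M.lM z / M.kB z = (3 * M.H0 z + 1) / (M.H0 z + 3) := by
  rw [div_eq_div_iff (M.kB_ne z) (M.H0_3 z)]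
  have h := mul_ne_zero (mul_ne_zero (show (8:ℂ) ≠ 0 by norm_num) (M.H0_ne z)) (M.H0_13 z)
  apply mul_left_cancel₀ h
  linear_combination (M.H0 z + 3) * (3 * M.H0 z + 1) * M.lM_eq z - (3 * M.H0 z + 1) ^ 2 * M.kB_eq z

theorem dB {z : ℂ} (hz : z ∈ Ω) : HasStrictFDerivAt M.B (M.kB z • M.DX z) z := by
  have h := ((M.dX hz).const_smul (5 / 4 : ℝ)).add ((M.dPs' hz).const_smul (3 / 4 : ℝ))
  have e : M.B = fun z => (5 / 4 : ℝ) • M.X z + (3 / 4 : ℝ) • M.Ps z := by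
    funext w
    apply Complex.ext <;> simp [B, bb, X, Ps] <;> ring
  rw [e]
  refine h.congr_fderiv ?_
  refine ContinuousLinearMap.ext fun v => ?_
  simp [kB]
  ring

theorem dMh {z : ℂ} (hz : z ∈ Ω) : HasStrictFDerivAt M.Mh (M.lM z • M.DX z) z := by
  have h := (((M.dX hz).const_smul (3 / 4 : ℂ)).add ((M.dPs' hz).const_smul (5 / 4 : ℂ))).sub (M.dY' hz)
  refine h.congr_fderiv ?_
  refine ContinuousLinearMap.ext fun v => ?_
  simp [lM]
  ring

theorem Mh_re (z : ℂ) : (M.Mh z).re = (3 * z.re + 5 * M.ψ z) / 4 - z.im := by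
  have e3 : ((3:ℂ)/4) = ((3/4 : ℝ) : ℂ) := by push_cast; ring
  have e5 : ((5:ℂ)/4) = ((5/4 : ℝ) : ℂ) := by push_cast; ring
  rw [Mh, e3, e5]
  simp [X, Ps, Y]
  ring

theorem kB_bound (z : ℂ) : Complex.normSq (M.kB z) * (1 + M.Q z ^ 2) ≤ 4 * M.W z ^ 2 := by
  have hq := M.Qp z
  have h3 := M.Wsq z
  have hW := M.Wpos z
  have e : M.kB z = ⟨(5 - 3 * (M.Q z * M.W z) / (1 + M.Q z ^ 2)) / 4, (-3 * M.P z / (1 + M.Q z ^ 2)) / 4⟩ := by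
    have e4 : M.kB z = (1 / 4 : ℝ) • ((5:ℝ) + (3 : ℝ) • M.D0 z : ℂ) := by
      simp [kB]; ring
    rw [e4]
    apply Complex.ext <;> simp [D0] <;> ring
  have e2 : Complex.normSq (M.kB z) * (1 + M.Q z ^ 2) =
      (25 * (1 + M.Q z ^ 2) - 30 * M.Q z * M.W z + 9 * (M.P z ^ 2 + M.Q z ^ 2)) / 16 := by
    rw [e, Complex.normSq_apply]
    field_simp
    ring_nf
    rw [h3]
    ring
  rw [e2]
  have hQ := abs_lt.1 (M.absQ_lt z)
  nlinarith [hQ.1, hQ.2, sq_nonneg (M.P z), sq_nonneg (M.Q z), mul_pos hW (show 0 < M.W z + M.Q z by linarith [hQ.1])]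

theorem H03_bound (z : ℂ) : Complex.normSq (M.H0 z + 3) ≤ 20 * M.W z / (M.W z + M.P z) := by
  have h := M.normSq_H0 z
  have e : 20 * M.W z / (M.W z + M.P z) = 10 * (1 + Complex.normSq (M.H0 z)) := by
    rw [h]; ring
  rw [e, Complex.normSq_apply, Complex.normSq_apply]
  simp
  nlinarith [sq_nonneg (3 * (M.H0 z).re - 1), sq_nonneg (M.H0 z).im]

theorem H_im (z : ℂ) : 0 < ((3 * M.H0 z + 1) / (M.H0 z + 3)).im := by
  have h1 := M.H0_im_pos z
  have h2 := Complex.normSq_pos.2 (M.H0_3 z)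
  rw [Complex.div_im, ← sub_div]
  apply div_pos _ h2
  simp
  nlinarith

namespace VS
variable {M} {r c σ : ℝ}

theorem bb_mono (V : VS M r c σ) {s s' y : ℝ} (h : s ≤ s') :
    (s' - s) / 2 ≤ M.bb ⟨s', y⟩ - M.bb ⟨s, y⟩ := by
  have h1 := V.psi_lip ⟨s', y⟩ ⟨s, y⟩
  have e : (⟨s', y⟩ : ℂ) - ⟨s, y⟩ = ((s' - s : ℝ) : ℂ) := by apply Complex.ext <;> simp
  rw [e, Complex.norm_real, Real.norm_eq_abs, abs_of_nonneg (show 0 ≤ s' - s by linarith)] at h1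
  have := (abs_le.1 h1).1
  simp only [bb]
  linarith

theorem bb_cont (V : VS M r c σ) : Continuous M.bb := by
  have := V.lip.continuous
  unfold bb
  fun_prop

theorem bb_le (V : VS M r c σ) (z : ℂ) : M.bb z ≤ 2 * ‖z‖ := by
  have h1 := V.psi_lip z 0
  rw [sub_zero, V.psi0, sub_zero] at h1
  have h2 := Complex.abs_re_le_norm z
  have := (abs_le.1 h1).2
  have := (abs_le.1 h2).2
  simp only [bb]
  linarith

theorem Mh_le (V : VS M r c σ) (z : ℂ) : |(M.Mh z).re| ≤ 3 * ‖z‖ := by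
  have h1 := V.psi_lip z 0
  rw [sub_zero, V.psi0, sub_zero] at h1
  have h2 := Complex.abs_re_le_norm z
  have h3 := Complex.abs_im_le_norm z
  rw [Mh_re]
  rw [abs_le] at *
  constructor <;> linarith [h1.1, h1.2, h2.1, h2.2, h3.1, h3.2]

theorem bb_ge (V : VS M r c σ) {z : ℂ} (hz : ‖z‖ < r) (hc : c * |z.im| ≤ σ * z.re) :
    3 / 4 * ‖z‖ ≤ M.bb z := by
  have hσ := V.s0
  have hσ1 := V.sle
  have hcc := V.c0
  have hcs := V.cs
  set ρ := ‖z‖ with hρ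
  have hρ0 : 0 ≤ ρ := norm_nonneg z
  have hsq : ρ ^ 2 = z.re ^ 2 + z.im ^ 2 := by
    rw [hρ, ← Complex.normSq_eq_norm_sq, Complex.normSq_apply]; ring
  have hre : 0 ≤ z.re := by
    have : 0 ≤ σ * z.re := le_trans (by positivity) hc
    by_contra h
    push Not at h
    nlinarith
  obtain ⟨η, hη, hηz⟩ : ∃ η : ℝ, (η = 1 ∨ η = -1) ∧ |z.im| = - η * z.im := by
    rcases abs_cases z.im with ⟨e, _⟩ | ⟨e, _⟩
    · exact ⟨-1, Or.inr rfl, by rw [e]; ring⟩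
    · exact ⟨1, Or.inl rfl, by rw [e]; ring⟩
  have hη2 : η ^ 2 = 1 := by rcases hη with rfl | rfl <;> norm_num
  have h1 := V.psi_lip z ⟨ρ * c, -η * ρ * σ⟩
  rw [V.psi_edge_eq hη hρ0 hz] at h1
  have h2 := (abs_le.1 h1).1
  have hy : |z.im| ≤ ρ := Complex.abs_im_le_norm z
  have hy0 := abs_nonneg z.im
  have hδ : ‖z - ⟨ρ * c, -η * ρ * σ⟩‖ ≤ 5 / 3 * z.re := by
    apply le_of_sq_le_sq _ (by positivity)
    rw [← Complex.normSq_eq_norm_sq, Complex.normSq_apply]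
    simp only [Complex.sub_re, Complex.sub_im]
    have e : (z.re - ρ * c) * (z.re - ρ * c) + (z.im - -η * ρ * σ) * (z.im - -η * ρ * σ) =
        2 * ρ ^ 2 - 2 * ρ * (z.re * c + |z.im| * σ) := by
      rw [hηz]
      linear_combination (-1) * hsq + ρ ^ 2 * hcs + ρ ^ 2 * σ ^ 2 * hη2
    rw [e]
    have k1 : |z.im| ≤ z.re * c + |z.im| * σ := by
      have : σ * |z.im| ≤ σ * (z.re * c + |z.im| * σ) := by
        nlinarith [mul_le_mul_of_nonneg_left hc hcc, mul_le_mul_of_nonneg_right hσ1 hy0]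
      exact le_of_mul_le_mul_left this hσ
    have k2 : z.re ^ 2 = (ρ - |z.im|) * (ρ + |z.im|) := by
      have := sq_abs z.im
      nlinarith
    rw [mul_pow, k2]
    nlinarith [mul_le_mul_of_nonneg_left k1 hρ0, mul_nonneg (sub_nonneg.2 hy) hy0, mul_nonneg (sub_nonneg.2 hy) hρ0]
  simp only [bb]
  linarith

/-- value on the boundary rays -/
theorem bb_edge (V : VS M r c σ) {y : ℝ} (hy : |y| < σ * r) :
    M.bb ⟨|y| / σ * c, y⟩ = (5 * c + 3) / (4 * σ) * |y| := by
  have hσ := V.s0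
  obtain ⟨η, hη, hηz⟩ : ∃ η : ℝ, (η = 1 ∨ η = -1) ∧ y = - η * |y| := by
    rcases abs_cases y with ⟨e, _⟩ | ⟨e, _⟩
    · exact ⟨-1, Or.inr rfl, by rw [e]; ring⟩
    · exact ⟨1, Or.inl rfl, by rw [e]; ring⟩
  have h := V.psi_edge_eq hη (ρ := |y| / σ) (by positivity) (by rw [div_lt_iff₀ hσ]; linarith)
  have e : -η * (|y| / σ) * σ = y := by
    rw [mul_assoc, div_mul_cancel₀ _ hσ.ne', ← hηz]
  rw [e] at h
  simp only [bb, h]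
  field_simp

/-- the slice description -/
theorem slice (V : VS M r c σ) {z : ℂ} (hb : M.bb z < r / 4) :
    (z ∈ Ω ∧ ‖z‖ < r) ↔ (5 * c + 3) / (4 * σ) * |z.im| < M.bb z := by
  have hσ := V.s0
  have hσ1 := V.sle
  have hcc := V.c0
  have hc1 := V.cle
  have hr := V.r0
  have hy0 := abs_nonneg z.im
  have hez : z = ⟨z.re, z.im⟩ := rfl
  constructor
  · rintro ⟨hz, hzr⟩
    have h1 := (V.mem_iff hzr).1 hz
    have hre : |z.im| / σ * c < z.re := by
      rw [div_mul_eq_mul_div, div_lt_iff₀ hσ]; linarith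
    have hyr : |z.im| < σ * r := by
      have hsq : ‖z‖ ^ 2 = z.re ^ 2 + z.im ^ 2 := by
        rw [← Complex.normSq_eq_norm_sq, Complex.normSq_apply]; ring
      have h3 : |z.im| ≤ σ * ‖z‖ := by
        apply le_of_sq_le_sq _ (by positivity)
        rw [mul_pow, hsq, sq_abs]
        have : (c * |z.im|) ^ 2 ≤ (σ * z.re) ^ 2 := by gcongr
        rw [mul_pow, mul_pow, sq_abs] at this
        nlinarith [V.cs]
      exact lt_of_le_of_lt h3 (by gcongr)
    have h2 := V.bb_edge hyr
    have h4 := V.bb_mono (y := z.im) hre.le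
    rw [h2, ← hez] at h4
    linarith
  · intro h
    have h1 : |z.im| < σ * (r / 3) := by
      have : (5 * c + 3) / (4 * σ) * |z.im| < r / 4 := by linarith
      rw [div_mul_eq_mul_div, div_lt_iff₀ (by positivity)] at this
      nlinarith [mul_nonneg hcc hy0]
    have h2 := V.bb_edge (y := z.im) (by nlinarith)
    have hre : |z.im| / σ * c < z.re := by
      by_contra hcon
      push Not at hcon
      have := V.bb_mono (y := z.im) hcon
      rw [h2, ← hez] at this
      linarith
    have h3 : |z.im| / σ < r / 3 := by rw [div_lt_iff₀ hσ]; linarith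
    have h30 : 0 ≤ |z.im| / σ := by positivity
    have hyr3 : |z.im| < r / 3 := by nlinarith
    have h4 : z.re < r / 2 := by
      by_contra hcon
      push Not at hcon
      have h5 := V.bb_mono (y := z.im) hcon
      have h6 := V.bb_ge (z := ⟨r / 2, z.im⟩) (by
        refine lt_of_le_of_lt (Complex.norm_le_abs_re_add_abs_im _) ?_
        simp only
        rw [abs_of_pos (by linarith)]
        linarith) (by
        simp only
        nlinarith)
      have h7 : r / 2 ≤ ‖(⟨r / 2, z.im⟩ : ℂ)‖ := by
        have := Complex.abs_re_le_norm ⟨r / 2, z.im⟩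
        simp only at this
        rwa [abs_of_pos (by linarith)] at this
      rw [← hez] at h5
      linarith
    have h0 : 0 ≤ |z.im| / σ * c := by positivity
    have hn : ‖z‖ < r := by
      refine lt_of_le_of_lt (Complex.norm_le_abs_re_add_abs_im _) ?_
      rw [abs_of_pos (by linarith)]
      linarith
    refine ⟨V.full z hn ?_, hn⟩
    rw [div_mul_eq_mul_div, div_lt_iff₀ hσ] at hre
    linarith

end VS
end MS

namespace MS
variable {Ω : Set ℂ} (M : MS Ω)

def Th (z : ℂ) : ℂ := ⟨M.bb z, z.im⟩
def gT (w : ℂ) : ℂ := Function.invFun M.Th w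
def V0 (r : ℝ) : Set ℂ := {z | (z ∈ Ω ∧ ‖z‖ < r) ∧ M.bb z < r / 4}

namespace VS
variable {M} {r c σ : ℝ}

theorem Th_dist (V : VS M r c σ) (z z' : ℂ) : ‖z - z'‖ ≤ 5 * ‖M.Th z - M.Th z'‖ := by
  have h1 := V.psi_lip z z'
  have h2 := Complex.norm_le_abs_re_add_abs_im (z - z')
  have h3 := Complex.abs_re_le_norm (M.Th z - M.Th z')
  have h4 := Complex.abs_im_le_norm (M.Th z - M.Th z')
  have e1 : (M.Th z - M.Th z').re = (5 * (z - z').re + 3 * (M.ψ z - M.ψ z')) / 4 := by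
    simp [Th, bb]; ring
  have e2 : (M.Th z - M.Th z').im = (z - z').im := by simp [Th]
  rw [e1] at h3
  rw [e2] at h4
  have h5 := h1.trans h2
  have h6 : |(z - z').re| ≤ 2 * ‖M.Th z - M.Th z'‖ + 3 / 2 * |(z - z').im| := by
    rw [abs_le] at h3 h5
    rcases abs_cases (z - z').re with ⟨e, _⟩ | ⟨e, _⟩ <;> rw [e] at h5 ⊢ <;> linarith [h3.1, h3.2, h5.1, h5.2]
  linarith [norm_nonneg (M.Th z - M.Th z')]

theorem Th_inj (V : VS M r c σ) : Function.Injective M.Th := by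
  intro z z' h
  have := V.Th_dist z z'
  rw [h, sub_self, norm_zero, mul_zero] at this
  exact sub_eq_zero.1 (norm_le_zero_iff.1 this)

theorem Th_surj (V : VS M r c σ) : Function.Surjective M.Th := by
  intro w
  set f : ℝ → ℝ := fun s => M.bb ⟨s, w.im⟩ with hf
  have hfc : Continuous f := by
    have h1 : Continuous (fun s : ℝ => (⟨s, w.im⟩ : ℂ)) := by
      have : (fun s : ℝ => (⟨s, w.im⟩ : ℂ)) = fun s : ℝ => (s : ℂ) + w.im * Complex.I := by
        funext s; apply Complex.ext <;> simp
      rw [this]; fun_prop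
    exact V.bb_cont.comp h1
  have k : 0 ≤ |w.re - f 0| := abs_nonneg _
  have k1 := le_abs_self (w.re - f 0)
  have k2 := neg_abs_le (w.re - f 0)
  set a := 2 * |w.re - f 0| with ha
  have m1 := V.bb_mono (y := w.im) (s := 0) (s' := a) (by positivity)
  have m2 := V.bb_mono (y := w.im) (s := -a) (s' := 0) (by linarith)
  have : w.re ∈ Icc (f (-a)) (f a) := by
    constructor
    · simp only [hf] at *; linarith
    · simp only [hf] at *; linarith
  obtain ⟨s, _, hs⟩ := intermediate_value_Icc (show -a ≤ a by linarith) hfc.continuousOn this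
  exact ⟨⟨s, w.im⟩, Complex.ext hs rfl⟩

theorem gT_right (V : VS M r c σ) (w : ℂ) : M.Th (M.gT w) = w :=
  Function.rightInverse_invFun V.Th_surj w
theorem gT_left (V : VS M r c σ) (z : ℂ) : M.gT (M.Th z) = z :=
  Function.leftInverse_invFun V.Th_inj z

theorem gT_cont (V : VS M r c σ) : Continuous M.gT := by
  have : LipschitzWith 5 M.gT := LipschitzWith.of_dist_le_mul fun x y => by
    have := V.Th_dist (M.gT x) (M.gT y)
    rw [V.gT_right, V.gT_right] at this
    rw [dist_eq_norm, dist_eq_norm]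
    simpa using this
  exact this.continuous

theorem gT_bb (V : VS M r c σ) (w : ℂ) : M.bb (M.gT w) = w.re :=
  congrArg Complex.re (V.gT_right w)
theorem gT_im (V : VS M r c σ) (w : ℂ) : (M.gT w).im = w.im := by
  have := congrArg Complex.im (V.gT_right w)
  exact this

theorem V0_open (V : VS M r c σ) : IsOpen (M.V0 r) := by
  have h1 : IsOpen {z : ℂ | ‖z‖ < r} := isOpen_lt continuous_norm continuous_const
  have h2 : IsOpen {z : ℂ | M.bb z < r / 4} := isOpen_lt V.bb_cont continuous_const
  exact (M.op.inter h1).inter h2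

theorem mem_V0 (V : VS M r c σ) (w : ℂ) (hw : w.re < r / 4) :
    M.gT w ∈ M.V0 r ↔ (5 * c + 3) / (4 * σ) * |w.im| < w.re := by
  have h := V.slice (z := M.gT w) (by rw [V.gT_bb]; exact hw)
  rw [V.gT_bb, V.gT_im] at h
  rw [← h]
  constructor
  · intro h1; exact h1.1
  · intro h1; exact ⟨h1, by rw [V.gT_bb]; exact hw⟩

/-- derivative along slices -/
theorem slice_deriv (V : VS M r c σ) {w : ℂ} (hw : M.gT w ∈ M.V0 r) :
    ∃ k > 0, HasDerivAt (fun y : ℝ => (M.B (M.gT ⟨w.re, y⟩)).im) k w.im := by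
  have hz : M.gT w ∈ Ω := hw.1.1
  set z := M.gT w with hzd
  have hB := M.dB hz
  set DB := M.kB z • M.DX z with hDB
  have hTh : HasStrictFDerivAt M.Th (cl ⟨(DB 1).re, 0⟩ ⟨(DB Complex.I).re, 1⟩) z := by
    refine strict_pair (α := (DB 1).re) (β := (DB Complex.I).re) ?_ (strict_im z)
    have h := Complex.reCLM.hasStrictFDerivAt.comp z hB
    refine h.congr_fderiv ?_
    apply lin_eq_of <;> rfl
  have hdet := M.detDX z (M.kB z)
  rw [← hDB] at hdet
  have hk := Complex.normSq_pos.2 (M.kB_ne z)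
  have hq := M.Qp z
  have hW := M.Wpos z
  have hdpos : 0 < (DB 1).re * (DB Complex.I).im - (DB 1).im * (DB Complex.I).re := by
    rw [hdet]; positivity
  have hbs : 0 < (DB 1).re := by
    have e : (DB 1).re = (5 - 3 * (M.Q z / M.W z)) / 4 := by
      have h1 : HasFDerivAt M.bb ((1/4:ℝ) • ((5:ℝ) • lin 1 0 + (3:ℝ) • lin (-M.Q z / M.W z) (M.P z / M.W z))) z := by
        have := (((strict_re z).hasFDerivAt.const_smul (5:ℝ)).add
          ((M.dψ z hz).hasFDerivAt.const_smul (3:ℝ))).const_smul (1/4:ℝ)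
        refine this.congr_of_eventuallyEq (Eventually.of_forall fun w => ?_)
        simp [bb]; ring
      have h2 := Complex.reCLM.hasFDerivAt.comp z hB.hasFDerivAt
      have h3 := h2.unique h1
      have h4 := congrArg (fun L => L 1) h3
      simp only [ContinuousLinearMap.comp_apply, Complex.reCLM_apply] at h4
      rw [h4]
      simp
      ring
    rw [e]
    have := (abs_lt.1 (M.absQ_lt z)).2
    have : M.Q z / M.W z < 1 := by rw [div_lt_one hW]; exact this
    linarith
  obtain ⟨L, hL, hg⟩ := inv_fderiv (g := M.gT) hTh (by simp; exact hbs.ne')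
    (Eventually.of_forall fun y => V.gT_left y)
  have eTh : M.Th z = w := V.gT_right w
  rw [eTh] at hg
  have hB' : HasFDerivAt M.B DB (M.gT w) := hB.hasFDerivAt
  have h1 := Complex.imCLM.hasFDerivAt.comp w (hB'.comp w hg)
  have hw' : w = (⟨w.re, w.im⟩ : ℂ) := rfl
  have h0 : HasDerivAt (fun y : ℝ => (⟨w.re, y⟩ : ℂ)) Complex.I w.im := by
    have e : (fun y : ℝ => (⟨w.re, y⟩ : ℂ)) = fun y : ℝ => (w.re : ℂ) + y * Complex.I := by
      funext s; apply Complex.ext <;> simp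
    rw [e]
    have := ((Complex.ofRealCLM.hasDerivAt (x := w.im)).mul_const Complex.I).const_add (w.re : ℂ)
    simpa using this
  have h2 := h1.comp_hasDerivAt w.im h0
  refine ⟨_, ?_, h2⟩
  simp only [ContinuousLinearMap.comp_apply, Complex.imCLM_apply]
  set v := L Complex.I with hv
  have hvI := hL Complex.I
  rw [← hv] at hvI
  have v1 := congrArg Complex.re hvI
  have v2 := congrArg Complex.im hvI
  simp at v1 v2
  have hv' : v = (v.re : ℝ) • (1:ℂ) + (v.im : ℝ) • Complex.I := by
    apply Complex.ext <;> simp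
  rw [hv', map_add, map_smul, map_smul]
  simp
  rw [v2] at v1 ⊢
  have : 0 < (DB 1).re * (v.re * (DB 1).im + 1 * (DB Complex.I).im) := by
    have e : (DB 1).re * (v.re * (DB 1).im + 1 * (DB Complex.I).im) =
        (DB 1).re * (DB Complex.I).im - (DB 1).im * (DB Complex.I).re := by
      linear_combination (DB 1).im * v1
    rw [e]; exact hdpos
  exact (mul_pos_iff_of_pos_left hbs).1 this

theorem slice_mono (V : VS M r c σ) {β : ℝ} (hβ : β < r / 4) :
    StrictMonoOn (fun y : ℝ => (M.B (M.gT ⟨β, y⟩)).im) {y | M.gT ⟨β, y⟩ ∈ M.V0 r} := by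
  have hset : {y : ℝ | M.gT ⟨β, y⟩ ∈ M.V0 r} = {y : ℝ | (5 * c + 3) / (4 * σ) * |y| < β} := by
    ext y
    exact V.mem_V0 ⟨β, y⟩ hβ
  have hm : 0 < (5 * c + 3) / (4 * σ) := by have := V.c0; have := V.s0; positivity
  have hconv : Convex ℝ {y : ℝ | M.gT ⟨β, y⟩ ∈ M.V0 r} := by
    rw [hset]
    have : {y : ℝ | (5 * c + 3) / (4 * σ) * |y| < β} = ball 0 (β / ((5 * c + 3) / (4 * σ))) := by
      ext y
      rw [mem_ball, dist_zero_right, Real.norm_eq_abs, lt_div_iff₀ hm, mul_comm |y|]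
      rfl
    rw [this]
    exact convex_ball _ _
  refine strictMonoOn_of_deriv_pos hconv ?_ ?_
  · intro y hy
    obtain ⟨k, _, h⟩ := V.slice_deriv (w := ⟨β, y⟩) hy
    exact h.continuousAt.continuousWithinAt
  · intro y hy
    have hy2 : y ∈ {y : ℝ | M.gT ⟨β, y⟩ ∈ M.V0 r} := interior_subset hy
    obtain ⟨k, hk, h⟩ := V.slice_deriv (w := ⟨β, y⟩) hy2
    rw [h.deriv]
    exact hk

theorem B_inj (V : VS M r c σ) : InjOn M.B (M.V0 r) := by
  intro z hz z' hz' h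
  have e1 : M.bb z = M.bb z' := congrArg Complex.re h
  have e2 : (M.B z).im = (M.B z').im := congrArg Complex.im h
  have g1 : M.gT ⟨M.bb z, z.im⟩ = z := V.gT_left z
  have g2 : M.gT ⟨M.bb z, z'.im⟩ = z' := by rw [e1]; exact V.gT_left z'
  have hm := (V.slice_mono (β := M.bb z) hz.2).injOn
  have := @hm z.im (by show M.gT ⟨M.bb z, z.im⟩ ∈ M.V0 r; rw [g1]; exact hz) z'.im (by show M.gT ⟨M.bb z, z'.im⟩ ∈ M.V0 r; rw [g2]; exact hz')
    (by simp only [g1, g2]; exact e2)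
  rw [← g1, ← g2, this]

theorem B_surj (V : VS M r c σ) {w : ℂ} (h0 : 0 < w.re) (h1 : w.re < r / 4) :
    ∃ z ∈ M.V0 r, M.B z = w := by
  have hσ := V.s0
  have hc := V.c0
  have hrr := V.r0
  have hm : 0 < (5 * c + 3) / (4 * σ) := by positivity
  set m := (5 * c + 3) / (4 * σ) with hmd
  set y0 := w.re / m with hy0
  have hy0p : 0 < y0 := by positivity
  have hmem : ∀ y, -y0 < y → y < y0 → M.gT ⟨w.re, y⟩ ∈ M.V0 r := by
    intro y h2 h3
    rw [V.mem_V0 ⟨w.re, y⟩ h1]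
    have : |y| < y0 := abs_lt.2 ⟨h2, h3⟩
    rw [hy0, lt_div_iff₀ hm] at this
    simp only
    linarith
  set h : ℝ → ℝ := fun y => (M.B (M.gT ⟨w.re, y⟩)).im with hh
  have hcont : ContinuousOn h (Ioo (-y0) y0) := by
    intro y hy
    obtain ⟨k, _, h⟩ := V.slice_deriv (w := ⟨w.re, y⟩) (hmem y hy.1 hy.2)
    exact h.continuousAt.continuousWithinAt
  have hρr : y0 / σ < r := by
    rw [hy0, hmd, div_div, div_lt_iff₀ (by positivity)]
    have : (5 * c + 3) / (4 * σ) * σ = (5 * c + 3) / 4 := by field_simp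
    rw [this]
    nlinarith [mul_nonneg hc hrr.le]
  have hpath : Continuous (fun y : ℝ => M.gT ⟨w.re, y⟩) := by
    have : (fun y : ℝ => (⟨w.re, y⟩ : ℂ)) = fun y : ℝ => (w.re : ℂ) + y * Complex.I := by
      funext s; apply Complex.ext <;> simp
    have h2 : Continuous (fun y : ℝ => (⟨w.re, y⟩ : ℂ)) := by rw [this]; fun_prop
    exact V.gT_cont.comp h2
  have hend : ∀ η : ℝ, (η = 1 ∨ η = -1) →
      M.gT ⟨w.re, -η * y0⟩ = ⟨y0 / σ * c, -η * (y0 / σ) * σ⟩ := by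
    intro η hη
    apply V.Th_inj
    rw [V.gT_right]
    have habs : |-η * y0| = y0 := by
      rcases hη with rfl | rfl
      · rw [neg_one_mul, abs_neg, abs_of_pos hy0p]
      · rw [neg_neg, one_mul, abs_of_pos hy0p]
    have hb := V.bb_edge (y := -η * y0) (by
      rw [habs]; rw [div_lt_iff₀ hσ] at hρr; linarith)
    rw [habs] at hb
    have e : -η * (y0 / σ) * σ = -η * y0 := by field_simp
    rw [e]
    apply Complex.ext
    · simp only [Th]
      rw [hb, hy0, ← hmd]
      field_simp
    · simp [Th]
  have hlim : ∀ η : ℝ, (η = 1 ∨ η = -1) →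
      Tendsto (fun y => -η * h y) (𝓝[Ioo (-y0) y0] (-η * y0)) atTop := by
    intro η hη
    have hL := V.im_limit hη (ρ := y0 / σ) (by positivity) hρr
    rw [← hend η hη] at hL
    have ht : Tendsto (fun y : ℝ => M.gT ⟨w.re, y⟩) (𝓝[Ioo (-y0) y0] (-η * y0))
        (𝓝[Ω] (M.gT ⟨w.re, -η * y0⟩)) := by
      refine tendsto_nhdsWithin_iff.2 ⟨(hpath.tendsto _).mono_left nhdsWithin_le_nhds, ?_⟩
      filter_upwards [self_mem_nhdsWithin] with y hy
      exact (hmem y hy.1 hy.2).1.1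
    exact hL.comp ht
  have hup := hlim (-1) (Or.inr rfl)
  have hlo := hlim 1 (Or.inl rfl)
  simp only [neg_neg, one_mul, neg_one_mul, neg_mul] at hup hlo
  have n1 : (𝓝[Ioo (-y0) y0] y0).NeBot := by
    rw [nhdsWithin_Ioo_eq_nhdsLT (by linarith)]; infer_instance
  have n2 : (𝓝[Ioo (-y0) y0] (-y0)).NeBot := by
    rw [nhdsWithin_Ioo_eq_nhdsGT (by linarith)]; infer_instance
  obtain ⟨y1, hy1, hy1m⟩ := ((hup.eventually (eventually_ge_atTop w.im)).and self_mem_nhdsWithin).exists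
  obtain ⟨y2, hy2, hy2m⟩ := ((hlo.eventually (eventually_ge_atTop (-w.im))).and self_mem_nhdsWithin).exists
  obtain ⟨y, hy, hyw⟩ := isPreconnected_Ioo.intermediate_value hy2m hy1m hcont
    ⟨show h y2 ≤ w.im by linarith, hy1⟩
  refine ⟨M.gT ⟨w.re, y⟩, hmem y hy.1 hy.2, Complex.ext ?_ hyw⟩
  exact V.gT_bb _

/-- Curvature bound near a vertex. -/
theorem thmB (V : VS M r c σ) {x : ℂ} (hx : x ∈ Ω) (hxr : ‖x‖ < r / 16) :
    |M.a x * M.c x - M.b x ^ 2| / M.W x ^ 4 ≤ 25 * (384 / r) ^ 2 := by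
  have hr := V.r0
  have hbx : M.bb x < r / 8 := by have := V.bb_le x; linarith
  have hxV : x ∈ M.V0 r := ⟨⟨hx, by linarith⟩, by linarith⟩
  have hVpos : ∀ z ∈ M.V0 r, 3 / 4 * ‖z‖ ≤ M.bb z ∧ 0 < M.bb z := by
    intro z hz
    have h1 := (V.mem_iff hz.1.2).1 hz.1.1
    have h2 := V.bb_ge hz.1.2 h1.le
    refine ⟨h2, ?_⟩
    have : z ≠ 0 := by
      rintro rfl
      simp at h1
    have := norm_pos_iff.2 this
    linarith
  set g := Function.invFunOn M.B (M.V0 r) with hg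
  have hgV : ∀ z : ℂ, 0 < z.re → z.re < r / 4 → g z ∈ M.V0 r ∧ M.B (g z) = z := by
    intro z h0 h1
    obtain ⟨y, hy, hyz⟩ := V.B_surj h0 h1
    exact ⟨Function.invFunOn_mem ⟨y, hy, hyz⟩, Function.invFunOn_eq ⟨y, hy, hyz⟩⟩
  set f : ℂ → ℂ := fun z => M.Mh (g z) with hf
  set f' : ℂ → ℂ := fun z => M.lM (g z) / M.kB (g z) with hf'
  have hder : ∀ z : ℂ, 0 < z.re → z.re < r / 4 → HasDerivAt f (f' z) z := by
    intro z h0 h1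
    obtain ⟨h2, h3⟩ := hgV z h0 h1
    have := M.coord V.V0_open (M.dB h2.1.1) (M.kB_ne _) V.B_inj h2 (M.dMh h2.1.1).hasFDerivAt
    rw [h3] at this
    exact this
  have hstrip := strip_lemma (f := f) (f' := f') (β := r / 4) (C := 4) (z := M.B x)
    (by linarith) (by norm_num) hder (by
      intro z h0 h1
      obtain ⟨h2, h3⟩ := hgV z h0 h1
      have h4 := V.Mh_le (g z)
      have h5 := (hVpos _ h2).1
      have h6 : M.bb (g z) = z.re := congrArg Complex.re h3
      rw [h6] at h5
      simp only [hf]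
      linarith) (by
      intro z h0 h1
      simp only [hf']
      rw [M.lk_eq]
      exact M.H_im _) (hVpos x hxV).2 (by
        show M.bb x ≤ r / 4 / 2
        linarith)
  have hSo : IsOpen {z : ℂ | 0 < z.re ∧ z.re < r / 4} :=
    (isOpen_lt continuous_const Complex.continuous_re).inter
      (isOpen_lt Complex.continuous_re continuous_const)
  have hBxS : M.B x ∈ {z : ℂ | 0 < z.re ∧ z.re < r / 4} := ⟨(hVpos x hxV).2, by
    show M.bb x < r / 4
    linarith⟩
  have hfd : DifferentiableOn ℂ f {z : ℂ | 0 < z.re ∧ z.re < r / 4} := fun z hz =>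
    (hder z hz.1 hz.2).differentiableAt.differentiableWithinAt
  have hf'd : DifferentiableAt ℂ f' (M.B x) := by
    have h1 := (hfd.deriv hSo).differentiableAt (hSo.mem_nhds hBxS)
    refine h1.congr_of_eventuallyEq ?_
    filter_upwards [hSo.mem_nhds hBxS] with z hz
    exact (hder z hz.1 hz.2).deriv.symm
  set m := deriv f' (M.B x) with hm
  have hgB : ∀ y ∈ M.V0 r, g (M.B y) = y := by
    intro y hy
    exact V.B_inj (Function.invFunOn_mem ⟨y, hy, rfl⟩) hy (Function.invFunOn_eq ⟨y, hy, rfl⟩)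
  have hf'B : ∀ y ∈ M.V0 r, f' (M.B y) = (3 * M.H0 y + 1) / (M.H0 y + 3) := by
    intro y hy
    simp only [hf', hgB y hy]
    exact M.lk_eq y
  have h3 : ∀ y ∈ M.V0 r, 3 - f' (M.B y) = 8 / (M.H0 y + 3) := by
    intro y hy
    rw [hf'B y hy]
    have := M.H0_3 y
    field_simp
    ring
  have h3ne : 3 - f' (M.B x) ≠ 0 := by
    rw [h3 x hxV]
    exact div_ne_zero (by norm_num) (M.H0_3 x)
  have hh : HasDerivAt (fun w => (3 * f' w - 1) / (3 - f' w)) (m * (M.H0 x + 3) ^ 2 / 8) (M.B x) := by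
    have h1 := hf'd.hasDerivAt
    have h2 := ((h1.const_mul 3).sub_const 1).div (h1.const_sub 3) h3ne
    refine (show HasDerivAt (fun w => (3 * f' w - 1) / (3 - f' w)) _ _ from h2).congr_deriv ?_
    rw [h3 x hxV]
    have e : f' (M.B x) = 3 - 8 / (M.H0 x + 3) := by rw [← h3 x hxV]; ring
    rw [e, ← hm]
    have := M.H0_3 x
    field_simp
    ring
  have hcurv := M.curv_coord V.V0_open (fun z hz => hz.1.1) (M.dB hx).hasFDerivAt hxV hh (by
    intro y hy
    rw [h3 y hy, hf'B y hy]
    have := M.H0_3 y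
    field_simp
    ring)
  have hW := M.Wpos x
  have hS := M.S_pos x
  have b1 := M.kB_bound x
  have b2 := M.H03_bound x
  have b3 : Complex.normSq m ≤ (384 / r) ^ 2 := by
    rw [Complex.normSq_eq_norm_sq]
    have : 24 * 4 / (r / 4) = 384 / r := by field_simp; norm_num
    rw [this] at hstrip
    gcongr
  rw [hcurv, div_le_iff₀ (by positivity)]
  have e : Complex.normSq (m * (M.H0 x + 3) ^ 2 / 8) =
      Complex.normSq m * Complex.normSq (M.H0 x + 3) ^ 2 / 64 := by
    rw [Complex.normSq_div, Complex.normSq_mul, map_pow]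
    norm_num
  rw [e]
  have b4 : Complex.normSq (M.H0 x + 3) * (M.W x + M.P x) ≤ 20 * M.W x := by
    rwa [le_div_iff₀ hS] at b2
  have n0 := Complex.normSq_nonneg m
  have n1 := Complex.normSq_nonneg (M.H0 x + 3)
  have n2 := Complex.normSq_nonneg (M.kB x)
  have hq := M.Qp x
  calc Complex.normSq m * Complex.normSq (M.H0 x + 3) ^ 2 / 64 * Complex.normSq (M.kB x) *
        (1 + M.Q x ^ 2) * (M.W x + M.P x) ^ 2
      = Complex.normSq m * (Complex.normSq (M.H0 x + 3) * (M.W x + M.P x)) ^ 2 / 64 *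
        (Complex.normSq (M.kB x) * (1 + M.Q x ^ 2)) := by ring
    _ ≤ (384 / r) ^ 2 * (20 * M.W x) ^ 2 / 64 * (4 * M.W x ^ 2) := by gcongr
    _ = 25 * (384 / r) ^ 2 * M.W x ^ 4 := by ring

end VS
end MS

theorem grad_coord (u : Pt → ℝ) (q : Pt) (i : Fin 2) : gradient u q i = pd i u q := by
  have h : inner ℝ (gradient u q) (EuclideanSpace.single i (1:ℝ)) = fderiv ℝ u q (EuclideanSpace.single i 1) := by
    unfold gradient
    rw [InnerProductSpace.toDual_symm_apply]
  rw [EuclideanSpace.inner_single_right] at h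
  simpa [pd] using h

theorem grad_norm (u : Pt → ℝ) (q : Pt) : ‖gradient u q‖ ^ 2 = pd 0 u q ^ 2 + pd 1 u q ^ 2 := by
  rw [EuclideanSpace.norm_sq_eq]
  simp [Fin.sum_univ_two, grad_coord]

theorem pt_decomp (v : Pt) : v = v 0 • EuclideanSpace.single (0 : Fin 2) (1:ℝ) + v 1 • EuclideanSpace.single (1 : Fin 2) (1:ℝ) := by
  ext i
  fin_cases i <;> simp

theorem clm_decomp (L : Pt →L[ℝ] ℝ) (v : Pt) :
    L v = v 0 * L (EuclideanSpace.single 0 1) + v 1 * L (EuclideanSpace.single 1 1) := by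
  conv_lhs => rw [pt_decomp v]
  simp

theorem second_order {Ω : Set Pt} {u : Pt → ℝ} (hm : MinimalGraph Ω u) {q : Pt} (hq : q ∈ Ω) :
    DifferentiableAt ℝ u q ∧ (∀ i, DifferentiableAt ℝ (pd i u) q) ∧
    pd 1 (pd 0 u) q = pd 0 (pd 1 u) q ∧
    (1 + pd 1 u q ^ 2) * pd 0 (pd 0 u) q - 2 * pd 0 u q * pd 1 u q * pd 1 (pd 0 u) q +
      (1 + pd 0 u q ^ 2) * pd 1 (pd 1 u) q = 0 := by
  obtain ⟨ho, hc, hmse⟩ := hm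
  have hcd : ContDiffAt ℝ 2 u q := hc.contDiffAt (ho.mem_nhds hq)
  have hdu : DifferentiableAt ℝ u q := hcd.differentiableAt (by norm_num)
  have hd2 : DifferentiableAt ℝ (fderiv ℝ u) q :=
    (hcd.fderiv_right (m := 1) (by norm_num)).differentiableAt (by norm_num)
  have hpd : ∀ i, HasFDerivAt (pd i u)
      ((fderiv ℝ (fderiv ℝ u) q).flip (EuclideanSpace.single i 1)) q := by
    intro i
    have := hd2.hasFDerivAt.clm_apply (hasFDerivAt_const (EuclideanSpace.single i (1:ℝ) : Pt) q)
    refine (this.congr_fderiv ?_)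
    ext v
    simp
  have hpdd : ∀ i, DifferentiableAt ℝ (pd i u) q := fun i => (hpd i).differentiableAt
  have hpp : ∀ i j, pd j (pd i u) q =
      fderiv ℝ (fderiv ℝ u) q (EuclideanSpace.single j 1) (EuclideanSpace.single i 1) := by
    intro i j
    rw [pd, (hpd i).fderiv]
    rfl
  have hsymm : pd 1 (pd 0 u) q = pd 0 (pd 1 u) q := by
    rw [hpp, hpp]
    exact (hcd.isSymmSndFDerivAt (by simp)) _ _
  refine ⟨hdu, hpdd, hsymm, ?_⟩
  have hpos : ∀ z, 0 < 1 + pd 0 u z ^ 2 + pd 1 u z ^ 2 := fun z => by positivity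
  have hWeq : Wu u = fun z => Real.sqrt (1 + pd 0 u z ^ 2 + pd 1 u z ^ 2) := by
    funext z
    rw [Wu, grad_norm, add_assoc]
  set W := Real.sqrt (1 + pd 0 u q ^ 2 + pd 1 u q ^ 2) with hW
  have hWp : 0 < W := Real.sqrt_pos.2 (hpos q)
  have hWsq : W ^ 2 = 1 + pd 0 u q ^ 2 + pd 1 u q ^ 2 := Real.sq_sqrt (hpos q).le
  have dW : HasFDerivAt (Wu u) ((1 / W) • (pd 0 u q • fderiv ℝ (pd 0 u) q + pd 1 u q • fderiv ℝ (pd 1 u) q)) q := by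
    rw [hWeq]
    have h1 := ((((hpdd 0).hasFDerivAt.pow 2).const_add 1).add ((hpdd 1).hasFDerivAt.pow 2)).sqrt (hpos q).ne'
    refine (show HasFDerivAt (fun z => Real.sqrt (1 + pd 0 u z ^ 2 + pd 1 u z ^ 2)) _ q from h1).congr_fderiv ?_
    ext v
    simp [← hW]
    field_simp
  have hWq : Wu u q = W := by rw [hWeq]
  have dWi : HasFDerivAt (fun z => (Wu u z)⁻¹)
      (-(1 / W ^ 3) • (pd 0 u q • fderiv ℝ (pd 0 u) q + pd 1 u q • fderiv ℝ (pd 1 u) q)) q := by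
    have h1 := (hasDerivAt_inv (by rw [hWq]; exact hWp.ne')).comp_hasFDerivAt q dW
    refine h1.congr_fderiv ?_
    ext v
    simp [hWq]
    field_simp
  have hgd : DifferentiableAt ℝ (fun z => gradient u z) q := by
    unfold gradient
    exact ((InnerProductSpace.toDual ℝ Pt).symm.toContinuousLinearEquiv.differentiableAt).comp q hd2
  have hX : DifferentiableAt ℝ (fun z => (Wu u z)⁻¹ • gradient u z) q := dWi.differentiableAt.smul hgd
  have hcomp : ∀ i : Fin 2, fderiv ℝ (fun z => (Wu u z)⁻¹ • gradient u z) q (EuclideanSpace.single i 1) i =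
      -(1 / W ^ 3) * (pd 0 u q * pd i (pd 0 u) q + pd 1 u q * pd i (pd 1 u) q) * pd i u q +
      1 / W * pd i (pd i u) q := by
    intro i
    have h1 := (EuclideanSpace.proj (𝕜 := ℝ) i : Pt →L[ℝ] ℝ).hasFDerivAt.comp q hX.hasFDerivAt
    have h2 := dWi.mul (hpdd i).hasFDerivAt
    have e : ((EuclideanSpace.proj (𝕜 := ℝ) i : Pt →L[ℝ] ℝ) ∘ fun z => (Wu u z)⁻¹ • gradient u z) =
        (fun z => (Wu u z)⁻¹) * pd i u := by
      funext z
      simp [grad_coord]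
    rw [e] at h1
    have h3 := congrArg (fun L => L (EuclideanSpace.single i 1)) (h1.unique h2)
    have h4 : fderiv ℝ (fun z => (Wu u z)⁻¹ • gradient u z) q (EuclideanSpace.single i 1) i = _ := h3
    rw [h4]
    simp [hWq, pd]
    ring
  have h := hmse q hq
  rw [Fin.sum_univ_two, hcomp, hcomp, ← hsymm] at h
  have h5 : W ^ 3 * ((-(1 / W ^ 3) * (pd 0 u q * pd 0 (pd 0 u) q + pd 1 u q * pd 1 (pd 0 u) q) * pd 0 u q +
      1 / W * pd 0 (pd 0 u) q) + (-(1 / W ^ 3) * (pd 0 u q * pd 1 (pd 0 u) q + pd 1 u q * pd 1 (pd 1 u) q) * pd 1 u q +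
      1 / W * pd 1 (pd 1 u) q)) = 0 := by rw [h, mul_zero]
  have h6 : W ^ 3 * ((-(1 / W ^ 3) * (pd 0 u q * pd 0 (pd 0 u) q + pd 1 u q * pd 1 (pd 0 u) q) * pd 0 u q +
      1 / W * pd 0 (pd 0 u) q) + (-(1 / W ^ 3) * (pd 0 u q * pd 1 (pd 0 u) q + pd 1 u q * pd 1 (pd 1 u) q) * pd 1 u q +
      1 / W * pd 1 (pd 1 u) q)) = W ^ 2 * (pd 0 (pd 0 u) q + pd 1 (pd 1 u) q) -
      (pd 0 u q * pd 0 (pd 0 u) q + pd 1 u q * pd 1 (pd 0 u) q) * pd 0 u q -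
      (pd 0 u q * pd 1 (pd 0 u) q + pd 1 u q * pd 1 (pd 1 u) q) * pd 1 u q := by
    field_simp
    ring
  rw [h6, hWsq] at h5
  linarith

theorem frm_alg {A B C P Q x y ε s : ℝ} (hε : ε ^ 2 = 1) (hτ : x ^ 2 + y ^ 2 = 1) (hs : s ^ 2 = 1) :
    ((1 + Q ^ 2) * A - 2 * P * Q * B + (1 + P ^ 2) * C = 0 →
      (1 + (s * (P * x + Q * y)) ^ 2) * (s * (A * (ε * y) * (ε * y) + 2 * B * (ε * y) * -(ε * x) + C * -(ε * x) * -(ε * x)))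
      - 2 * (s * (P * (ε * y) + Q * -(ε * x))) * (s * (P * x + Q * y)) *
        (s * (A * (ε * y) * x + B * (ε * y * y + -(ε * x) * x) + C * -(ε * x) * y))
      + (1 + (s * (P * (ε * y) + Q * -(ε * x))) ^ 2) * (s * (A * x * x + 2 * B * x * y + C * y * y)) = 0) ∧
    (s * (P * (ε * y) + Q * -(ε * x))) ^ 2 + (s * (P * x + Q * y)) ^ 2 = P ^ 2 + Q ^ 2 ∧
    A * C - B ^ 2 = (s * (A * (ε * y) * (ε * y) + 2 * B * (ε * y) * -(ε * x) + C * -(ε * x) * -(ε * x))) *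
      (s * (A * x * x + 2 * B * x * y + C * y * y)) -
      (s * (A * (ε * y) * x + B * (ε * y * y + -(ε * x) * x) + C * -(ε * x) * y)) ^ 2 := by
  have key : ∀ e t : ℝ, (e = 1 ∨ e = -1) → (t = 1 ∨ t = -1) → ((1 + Q ^ 2) * A - 2 * P * Q * B + (1 + P ^ 2) * C = 0 →
      (1 + (t * (P * x + Q * y)) ^ 2) * (t * (A * (e * y) * (e * y) + 2 * B * (e * y) * -(e * x) + C * -(e * x) * -(e * x)))
      - 2 * (t * (P * (e * y) + Q * -(e * x))) * (t * (P * x + Q * y)) *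
        (t * (A * (e * y) * x + B * (e * y * y + -(e * x) * x) + C * -(e * x) * y))
      + (1 + (t * (P * (e * y) + Q * -(e * x))) ^ 2) * (t * (A * x * x + 2 * B * x * y + C * y * y)) = 0) ∧
    (t * (P * (e * y) + Q * -(e * x))) ^ 2 + (t * (P * x + Q * y)) ^ 2 = P ^ 2 + Q ^ 2 ∧
    A * C - B ^ 2 = (t * (A * (e * y) * (e * y) + 2 * B * (e * y) * -(e * x) + C * -(e * x) * -(e * x))) *
      (t * (A * x * x + 2 * B * x * y + C * y * y)) -
      (t * (A * (e * y) * x + B * (e * y * y + -(e * x) * x) + C * -(e * x) * y)) ^ 2 := by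
    intro e t he ht
    rcases he with rfl | rfl <;> rcases ht with rfl | rfl
    · refine ⟨fun hm => ?_, ?_, ?_⟩
      · linear_combination hm + (A + C + (Q ^ 2 * A - 2 * P * Q * B + P ^ 2 * C) * (x ^ 2 + y ^ 2 + 1)) * hτ
      · linear_combination (P ^ 2 + Q ^ 2) * hτ
      · linear_combination -(A * C - B ^ 2) * (x ^ 2 + y ^ 2 + 1) * hτ
    · refine ⟨fun hm => ?_, ?_, ?_⟩
      · linear_combination -hm - (A + C + (Q ^ 2 * A - 2 * P * Q * B + P ^ 2 * C) * (x ^ 2 + y ^ 2 + 1)) * hτ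
      · linear_combination (P ^ 2 + Q ^ 2) * hτ
      · linear_combination -(A * C - B ^ 2) * (x ^ 2 + y ^ 2 + 1) * hτ
    · refine ⟨fun hm => ?_, ?_, ?_⟩
      · linear_combination hm + (A + C + (Q ^ 2 * A - 2 * P * Q * B + P ^ 2 * C) * (x ^ 2 + y ^ 2 + 1)) * hτ
      · linear_combination (P ^ 2 + Q ^ 2) * hτ
      · linear_combination -(A * C - B ^ 2) * (x ^ 2 + y ^ 2 + 1) * hτ
    · refine ⟨fun hm => ?_, ?_, ?_⟩
      · linear_combination -hm - (A + C + (Q ^ 2 * A - 2 * P * Q * B + P ^ 2 * C) * (x ^ 2 + y ^ 2 + 1)) * hτ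
      · linear_combination (P ^ 2 + Q ^ 2) * hτ
      · linear_combination -(A * C - B ^ 2) * (x ^ 2 + y ^ 2 + 1) * hτ
  have pm : ∀ t : ℝ, t ^ 2 = 1 → t = 1 ∨ t = -1 := by
    intro t ht
    have : (t - 1) * (t + 1) = 0 := by linear_combination ht
    rcases mul_eq_zero.1 this with h | h
    · left; linarith
    · right; linarith
  exact key ε s (pm ε hε) (pm s hs)

/-- An orthonormal frame of the plane as a homeomorphism. -/
def frm (p v τ : Pt) (ε : ℝ) (hε : ε ^ 2 = 1) (hτ : τ 0 ^ 2 + τ 1 ^ 2 = 1) (h0 : v 0 = ε * τ 1)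
    (h1 : v 1 = -(ε * τ 0)) : ℂ ≃ₜ Pt where
  toFun z := p + z.re • v + z.im • τ
  invFun q := ⟨(q 0 - p 0) * v 0 + (q 1 - p 1) * v 1, (q 0 - p 0) * τ 0 + (q 1 - p 1) * τ 1⟩
  left_inv z := by
    apply Complex.ext
    · simp [h0, h1]
      linear_combination z.re * (τ 0 ^ 2 + τ 1 ^ 2) * hε + z.re * hτ
    · simp [h0, h1]
      linear_combination z.im * hτ
  right_inv q := by
    ext i
    fin_cases i
    · simp [h0, h1]
      linear_combination (q 0 - p 0) * hτ + (q 0 - p 0) * τ 1 ^ 2 * hε - (q 1 - p 1) * τ 0 * τ 1 * hε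
    · simp [h0, h1]
      linear_combination (q 1 - p 1) * hτ + (q 1 - p 1) * τ 0 ^ 2 * hε - (q 0 - p 0) * τ 0 * τ 1 * hε
  continuous_toFun := by
    have := Complex.continuous_re
    have := Complex.continuous_im
    fun_prop
  continuous_invFun := by
    have e : (fun q : Pt => (⟨(q 0 - p 0) * v 0 + (q 1 - p 1) * v 1, (q 0 - p 0) * τ 0 + (q 1 - p 1) * τ 1⟩ : ℂ)) =
      fun q : Pt => (((q 0 - p 0) * v 0 + (q 1 - p 1) * v 1 : ℝ) : ℂ) +
        (((q 0 - p 0) * τ 0 + (q 1 - p 1) * τ 1 : ℝ) : ℂ) * Complex.I := by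
      funext q; apply Complex.ext <;> simp
    show Continuous (fun q : Pt => (⟨(q 0 - p 0) * v 0 + (q 1 - p 1) * v 1, (q 0 - p 0) * τ 0 + (q 1 - p 1) * τ 1⟩ : ℂ))
    rw [e]
    fun_prop

section
variable {p v τ : Pt} {ε : ℝ} {hε : ε ^ 2 = 1} {hτ : τ 0 ^ 2 + τ 1 ^ 2 = 1} {h0 : v 0 = ε * τ 1}
    {h1 : v 1 = -(ε * τ 0)}

theorem frm_apply (z : ℂ) : frm p v τ ε hε hτ h0 h1 z = p + z.re • v + z.im • τ := rfl

theorem frm_zero : frm p v τ ε hε hτ h0 h1 0 = p := by simp [frm_apply]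

theorem frm_dist (z w : ℂ) :
    dist (frm p v τ ε hε hτ h0 h1 z) (frm p v τ ε hε hτ h0 h1 w) = ‖z - w‖ := by
  have : dist (frm p v τ ε hε hτ h0 h1 z) (frm p v τ ε hε hτ h0 h1 w) ^ 2 = ‖z - w‖ ^ 2 := by
    rw [dist_eq_norm, EuclideanSpace.norm_sq_eq, ← Complex.normSq_eq_norm_sq, Complex.normSq_apply]
    simp [Fin.sum_univ_two, frm_apply, h0, h1]
    linear_combination ((z.re - w.re) ^ 2 * (τ 0 ^ 2 + τ 1 ^ 2)) * hε +
      ((z.re - w.re) ^ 2 + (z.im - w.im) ^ 2) * hτ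
  exact (pow_left_inj₀ dist_nonneg (norm_nonneg _) two_ne_zero).1 this

theorem frm_frontier (Ω : Set Pt) (z : ℂ) : z ∈ frontier (frm p v τ ε hε hτ h0 h1 ⁻¹' Ω) ↔
    frm p v τ ε hε hτ h0 h1 z ∈ frontier Ω := by
  rw [← (frm p v τ ε hε hτ h0 h1).preimage_frontier]
  rfl

theorem frm_tendsto (Ω : Set Pt) (z : ℂ) :
    Tendsto (frm p v τ ε hε hτ h0 h1) (𝓝[frm p v τ ε hε hτ h0 h1 ⁻¹' Ω] z)
      (𝓝[Ω] (frm p v τ ε hε hτ h0 h1 z)) := by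
  refine tendsto_nhdsWithin_iff.2 ⟨?_, ?_⟩
  · exact ((frm p v τ ε hε hτ h0 h1).continuous.tendsto z).mono_left nhdsWithin_le_nhds
  · filter_upwards [self_mem_nhdsWithin] with y hy using hy

theorem frm_fderiv {f : Pt → ℝ} {z : ℂ} (hf : DifferentiableAt ℝ f (frm p v τ ε hε hτ h0 h1 z)) :
    HasFDerivAt (fun w => f (frm p v τ ε hε hτ h0 h1 w))
      (lin (pd 0 f (frm p v τ ε hε hτ h0 h1 z) * v 0 + pd 1 f (frm p v τ ε hε hτ h0 h1 z) * v 1)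
        (pd 0 f (frm p v τ ε hε hτ h0 h1 z) * τ 0 + pd 1 f (frm p v τ ε hε hτ h0 h1 z) * τ 1)) z := by
  have hd : HasFDerivAt (frm p v τ ε hε hτ h0 h1)
      (Complex.reCLM.smulRight v + Complex.imCLM.smulRight τ) z := by
    have := ((Complex.reCLM.smulRight v + Complex.imCLM.smulRight τ).hasFDerivAt (x := z)).const_add p
    refine this.congr_of_eventuallyEq (Eventually.of_forall fun w => ?_)
    simp [frm_apply, add_assoc]
  have h := hf.hasFDerivAt.comp z hd
  refine (show HasFDerivAt (fun w => f (frm p v τ ε hε hτ h0 h1 w)) _ z from h).congr_fderiv ?_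
  apply lin_eq_of
  · simp [pd]
    rw [clm_decomp]; ring
  · simp [pd]
    rw [clm_decomp]; ring

theorem frm_MS {Ω : Set Pt} {u : Pt → ℝ} (hm : MinimalGraph Ω u) (hc : Convex ℝ Ω) {s : ℝ} (hs : s ^ 2 = 1) :
    ∃ M : MS (frm p v τ ε hε hτ h0 h1 ⁻¹' Ω), (∀ z, M.u z = s * u (frm p v τ ε hε hτ h0 h1 z)) ∧
      ∀ z, frm p v τ ε hε hτ h0 h1 z ∈ Ω →
        |gaussK u (frm p v τ ε hε hτ h0 h1 z)| = |M.a z * M.c z - M.b z ^ 2| / M.W z ^ 4 := by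
  set φ := frm p v τ ε hε hτ h0 h1 with hφ
  have hcv : Convex ℝ (φ ⁻¹' Ω) := by
    intro x hx y hy a b ha hb hab
    show φ (a • x + b • y) ∈ Ω
    have e : φ (a • x + b • y) = a • φ x + b • φ y := by
      simp only [hφ, frm_apply]
      ext i
      simp
      linear_combination (-(p i)) * hab
    rw [e]
    exact hc hx hy ha hb hab
  have so := fun z (hz : z ∈ φ ⁻¹' Ω) => second_order hm (show φ z ∈ Ω from hz)
  obtain ⟨M, e1, e2, e3, e4, e5, e6⟩ := exists_MS (Ω := φ ⁻¹' Ω) (hm.1.preimage φ.continuous) hcv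
    (u := fun z => s * u (φ z))
    (P := fun z => s * (pd 0 u (φ z) * v 0 + pd 1 u (φ z) * v 1))
    (Q := fun z => s * (pd 0 u (φ z) * τ 0 + pd 1 u (φ z) * τ 1))
    (a := fun z => s * (pd 0 (pd 0 u) (φ z) * v 0 * v 0 + 2 * pd 1 (pd 0 u) (φ z) * v 0 * v 1 +
      pd 1 (pd 1 u) (φ z) * v 1 * v 1))
    (b := fun z => s * (pd 0 (pd 0 u) (φ z) * v 0 * τ 0 + pd 1 (pd 0 u) (φ z) * (v 0 * τ 1 + v 1 * τ 0) +
      pd 1 (pd 1 u) (φ z) * v 1 * τ 1))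
    (c := fun z => s * (pd 0 (pd 0 u) (φ z) * τ 0 * τ 0 + 2 * pd 1 (pd 0 u) (φ z) * τ 0 * τ 1 +
      pd 1 (pd 1 u) (φ z) * τ 1 * τ 1))
    (by
      intro z hz
      have := (frm_fderiv (hε := hε) (hτ := hτ) (h0 := h0) (h1 := h1) (so z hz).1).const_smul s
      refine this.congr_fderiv ?_
      apply lin_eq_of <;> simp [hφ])
    (by
      intro z hz
      have k0 := (frm_fderiv (hε := hε) (hτ := hτ) (h0 := h0) (h1 := h1) ((so z hz).2.1 0))
      have k1 := (frm_fderiv (hε := hε) (hτ := hτ) (h0 := h0) (h1 := h1) ((so z hz).2.1 1))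
      have := ((k0.mul_const (v 0)).add (k1.mul_const (v 1))).const_smul s
      refine this.congr_fderiv ?_
      have hsy := (so z hz).2.2.1
      apply lin_eq_of <;> simp [← hφ, ← hsy] <;> ring)
    (by
      intro z hz
      have k0 := (frm_fderiv (hε := hε) (hτ := hτ) (h0 := h0) (h1 := h1) ((so z hz).2.1 0))
      have k1 := (frm_fderiv (hε := hε) (hτ := hτ) (h0 := h0) (h1 := h1) ((so z hz).2.1 1))
      have := ((k0.mul_const (τ 0)).add (k1.mul_const (τ 1))).const_smul s
      refine this.congr_fderiv ?_
      have hsy := (so z hz).2.2.1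
      apply lin_eq_of <;> simp [← hφ, ← hsy] <;> ring)
    (by
      intro z hz
      have hmse := (so z hz).2.2.2
      simp only [h0, h1]
      exact (frm_alg hε hτ hs).1 hmse)
  refine ⟨M, fun z => by rw [e1], fun z hz => ?_⟩
  have hW : M.W z ^ 4 = (1 + ‖gradient u (φ z)‖ ^ 2) ^ 2 := by
    have : M.W z ^ 2 = 1 + ‖gradient u (φ z)‖ ^ 2 := by
      rw [M.Wsq, grad_norm, e2, e3]
      simp only [h0, h1]
      rw [add_assoc, (frm_alg (A := 0) (B := 0) (C := 0) hε hτ hs).2.1]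
    rw [← this]; ring
  rw [hW, gaussK, abs_div, abs_of_pos (show 0 < (1 + ‖gradient u (φ z)‖ ^ 2) ^ 2 by positivity), e4, e5, e6]
  congr 2
  simp only [h0, h1]
  exact (frm_alg (P := 0) (Q := 0) hε hτ hs).2.2
end

theorem side_of_edge {Ω : Set Pt} (ho : IsOpen Ω) (hc : Convex ℝ Ω) {P Q : Pt} (hd : dist P Q = 1)
    (hseg : segment ℝ P Q ⊆ frontier Ω) :
    ∃ δ : ℝ, (δ = 1 ∨ δ = -1) ∧ ∀ w ∈ Ω, 0 < δ * cross2 (Q - P) (w - P) := by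
  have hmid : (1 / 2 : ℝ) • P + (1 / 2 : ℝ) • Q ∈ segment ℝ P Q :=
    ⟨1 / 2, 1 / 2, by norm_num, by norm_num, by norm_num, rfl⟩
  set m := (1 / 2 : ℝ) • P + (1 / 2 : ℝ) • Q with hm
  have hmn : m ∉ Ω := by
    have h := hseg hmid
    rw [ho.frontier_eq] at h
    exact h.2
  obtain ⟨f, hf⟩ := geometric_hahn_banach_open_point hc ho hmn
  have hcl : ∀ x ∈ frontier Ω, f x ≤ f m := by
    intro x hx
    have hs : closure Ω ⊆ {x | f x ≤ f m} :=
      closure_minimal (fun z hz => (hf z hz).le) (isClosed_le f.continuous continuous_const)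
    exact hs hx.1
  have hP := hcl P (hseg (left_mem_segment ℝ P Q))
  have hQ := hcl Q (hseg (right_mem_segment ℝ P Q))
  have hfm : f m = 1 / 2 * f P + 1 / 2 * f Q := by simp [hm]
  have hPm : f P = f m := by linarith
  have hQm : f Q = f m := by linarith
  set F0 := f (EuclideanSpace.single 0 1)
  set F1 := f (EuclideanSpace.single 1 1)
  have dP := clm_decomp f P
  have dQ := clm_decomp f Q
  have hsq : (Q 0 - P 0) ^ 2 + (Q 1 - P 1) ^ 2 = 1 := by
    have : dist Q P ^ 2 = 1 := by rw [dist_comm, hd]; norm_num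
    rw [dist_eq_norm, EuclideanSpace.norm_sq_eq] at this
    simpa [Fin.sum_univ_two] using this
  have hz : (Q 0 - P 0) * F0 + (Q 1 - P 1) * F1 = 0 := by linarith
  have hk : ∀ w ∈ Ω, (F1 * (Q 0 - P 0) - F0 * (Q 1 - P 1)) * cross2 (Q - P) (w - P) < 0 := by
    intro w hw
    have h1 := hf w hw
    have dw := clm_decomp f w
    have e : (F1 * (Q 0 - P 0) - F0 * (Q 1 - P 1)) * cross2 (Q - P) (w - P) = f w - f P := by
      rw [dw, dP]
      simp only [cross2, PiLp.sub_apply]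
      change _ = w 0 * F0 + w 1 * F1 - (P 0 * F0 + P 1 * F1)
      linear_combination ((w 0 - P 0) * F0 + (w 1 - P 1) * F1) * hsq -
        ((w 0 - P 0) * (Q 0 - P 0) + (w 1 - P 1) * (Q 1 - P 1)) * hz
    rw [e]; linarith
  set k := F1 * (Q 0 - P 0) - F0 * (Q 1 - P 1)
  rcases lt_or_ge 0 k with h | h
  · refine ⟨-1, Or.inr rfl, fun w hw => ?_⟩
    have := hk w hw
    have := (neg_of_mul_neg_right this h.le)
    linarith
  · refine ⟨1, Or.inl rfl, fun w hw => ?_⟩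
    have h2 := hk w hw
    by_contra h3
    have := mul_nonneg_of_nonpos_of_nonpos h (show cross2 (Q - P) (w - P) ≤ 0 by linarith)
    linarith

theorem side_closure {Ω : Set Pt} {P Q : Pt} {δ : ℝ} (h : ∀ w ∈ Ω, 0 < δ * cross2 (Q - P) (w - P)) {x : Pt}
    (hx : x ∈ closure Ω) : 0 ≤ δ * cross2 (Q - P) (x - P) := by
  have hs : closure Ω ⊆ {x | 0 ≤ δ * cross2 (Q - P) (x - P)} :=
    closure_minimal (fun z hz => (h z hz).le) (isClosed_le continuous_const (by unfold cross2; fun_prop))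
  exact hs hx

theorem seg_param {p q x : Pt} (hx : x ∈ segment ℝ p q) : ∃ t : ℝ, 0 ≤ t ∧ x = p + t • (q - p) := by
  obtain ⟨a, b, ha, hb, hab, rfl⟩ := hx
  refine ⟨b, hb, ?_⟩
  have : a = 1 - b := by linarith
  subst this
  module

theorem open_seg_param {p q : Pt} {t : ℝ} (h0 : 0 < t) (h1 : t < 1) : p + t • (q - p) ∈ openSegment ℝ p q :=
  ⟨1 - t, t, by linarith, h0, by ring, by module⟩

theorem sumsq_zero {x y : ℝ} (h : x ^ 2 + y ^ 2 = 0) : x = 0 ∧ y = 0 := by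
  constructor
  · have : x ^ 2 = 0 := le_antisymm (by linarith [sq_nonneg y]) (sq_nonneg x)
    exact pow_eq_zero_iff two_ne_zero |>.1 this
  · have : y ^ 2 = 0 := le_antisymm (by linarith [sq_nonneg x]) (sq_nonneg y)
    exact pow_eq_zero_iff two_ne_zero |>.1 this

set_option maxHeartbeats 1600000 in
theorem vertex_case {Ω : Set Pt} {u : Pt → ℝ} (hm : MinimalGraph Ω u) (hc : Convex ℝ Ω) {p pa pb : Pt}
    (ha : dist p pa = 1) (hb : dist p pb = 1) (hab : pa ≠ pb)
    (sa : segment ℝ p pa ⊆ frontier Ω) (sb : segment ℝ p pb ⊆ frontier Ω) {r : ℝ} (hr : 0 < r) (hr1 : r ≤ 1)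
    (hball : ball p r ∩ frontier Ω ⊆ segment ℝ p pa ∪ segment ℝ p pb) {s : ℝ} (hs : s ^ 2 = 1)
    (ea : ∀ t ∈ openSegment ℝ p pa, Tendsto (fun z => -s * u z) (𝓝[Ω] t) atTop)
    (eb : ∀ t ∈ openSegment ℝ p pb, Tendsto (fun z => s * u z) (𝓝[Ω] t) atTop)
    {q : Pt} (hq : q ∈ Ω) (hqr : dist q p < r / 16) : |gaussK u q| ≤ 25 * (384 / r) ^ 2 := by
  have ho := hm.1
  obtain ⟨δ, hδ, hda⟩ := side_of_edge ho hc ha sa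
  obtain ⟨δ', hδ', hdb⟩ := side_of_edge ho hc hb sb
  have hca := side_closure hda (sb (right_mem_segment ℝ p pb)).1
  have hcb := side_closure hdb (sa (right_mem_segment ℝ p pa)).1
  have sq1 : ∀ x : Pt, dist p x = 1 → (x 0 - p 0) ^ 2 + (x 1 - p 1) ^ 2 = 1 := by
    intro x hx
    have : dist x p ^ 2 = 1 := by rw [dist_comm, hx]; norm_num
    rw [dist_eq_norm, EuclideanSpace.norm_sq_eq] at this
    simpa [Fin.sum_univ_two] using this
  have hA := sq1 pa ha
  have hB := sq1 pb hb
  have hpaa : ∀ i, (pa - p) i = pa i - p i := fun i => by simp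
  have hpbb : ∀ i, (pb - p) i = pb i - p i := fun i => by simp
  set a0 := pa 0 - p 0 with ha0
  set a1 := pa 1 - p 1 with ha1
  set b0 := pb 0 - p 0 with hb0
  set b1 := pb 1 - p 1 with hb1
  have hne : ¬ (a0 = b0 ∧ a1 = b1) := by
    rintro ⟨h0, h1⟩
    apply hab
    ext i
    fin_cases i
    · show pa 0 = pb 0
      linarith
    · show pa 1 = pb 1
      linarith
  have hw0 := hda q hq
  have hw0' := hdb q hq
  have hcr : cross2 (pa - p) (pb - p) = a0 * b1 - a1 * b0 := by simp [cross2, ha0, ha1, hb0, hb1]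
  have hcr' : cross2 (pb - p) (pa - p) = -(a0 * b1 - a1 * b0) := by
    simp only [cross2, hpaa, hpbb, ← ha0, ← ha1, ← hb0, ← hb1]; ring
  rw [hcr] at hca
  rw [hcr'] at hcb
  have hδ2 : δ ^ 2 = 1 := by rcases hδ with rfl | rfl <;> norm_num
  have hdd : δ' = -δ := by
    by_contra hcon
    have hsame : δ' = δ := by
      rcases hδ with rfl | rfl <;> rcases hδ' with rfl | rfl <;> first | rfl | (exfalso; apply hcon; norm_num)
    subst hsame
    have hz : δ' * (a0 * b1 - a1 * b0) = 0 := by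
      have : δ' * -(a0 * b1 - a1 * b0) = -(δ' * (a0 * b1 - a1 * b0)) := by ring
      linarith
    have hz2 : a0 * b1 - a1 * b0 = 0 := by
      linear_combination δ' * hz - (a0 * b1 - a1 * b0) * hδ2
    have hsum : (a0 * b0 + a1 * b1) ^ 2 = 1 := by
      linear_combination (b0 ^ 2 + b1 ^ 2) * hA + hB - (a0 * b1 - a1 * b0) * hz2
    have hb' : b0 = -a0 ∧ b1 = -a1 := by
      have : (a0 * b0 + a1 * b1 - 1) * (a0 * b0 + a1 * b1 + 1) = 0 := by linear_combination hsum
      rcases mul_eq_zero.1 this with h | h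
      · exfalso
        apply hne
        have : (a0 - b0) ^ 2 + (a1 - b1) ^ 2 = 0 := by linear_combination hA + hB - 2 * h
        have := sumsq_zero this
        constructor <;> linarith [this.1, this.2]
      · have : (a0 + b0) ^ 2 + (a1 + b1) ^ 2 = 0 := by linear_combination hA + hB + 2 * h
        have := sumsq_zero this
        constructor <;> linarith [this.1, this.2]
    have e : cross2 (pb - p) (q - p) = -cross2 (pa - p) (q - p) := by
      simp only [cross2, hpaa, hpbb, ← ha0, ← ha1, ← hb0, ← hb1, hb'.1, hb'.2]; ring
    rw [e] at hw0'
    linarith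
  subst hdd
  -- the frame
  have hD : 0 < (a0 - b0) ^ 2 + (a1 - b1) ^ 2 := by
    rcases not_and_or.1 hne with h | h
    · have := sq_pos_of_ne_zero (sub_ne_zero.2 h)
      positivity
    · have := sq_pos_of_ne_zero (sub_ne_zero.2 h)
      positivity
  obtain ⟨σ, hσ, hσ2⟩ : ∃ σ : ℝ, 0 < σ ∧ 4 * σ ^ 2 = (a0 - b0) ^ 2 + (a1 - b1) ^ 2 := by
    refine ⟨Real.sqrt ((a0 - b0) ^ 2 + (a1 - b1) ^ 2) / 2, by positivity, ?_⟩
    rw [div_pow, Real.sq_sqrt hD.le]; ring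
  obtain ⟨t0, ht0⟩ : ∃ t0, a0 - b0 = 2 * σ * t0 := ⟨(a0 - b0) / (2 * σ), by field_simp⟩
  obtain ⟨t1, ht1⟩ : ∃ t1, a1 - b1 = 2 * σ * t1 := ⟨(a1 - b1) / (2 * σ), by field_simp⟩
  have htau : t0 ^ 2 + t1 ^ 2 = 1 := by
    rw [ht0, ht1] at hσ2
    have : σ ^ 2 * (t0 ^ 2 + t1 ^ 2 - 1) = 0 := by linear_combination -hσ2 / 4
    rcases mul_eq_zero.1 this with h | h
    · exact absurd h (by positivity)
    · linarith
  have hat : a0 * t0 + a1 * t1 = σ := by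
    have : 2 * σ * (a0 * t0 + a1 * t1 - σ) = 0 := by
      linear_combination -a0 * ht0 - a1 * ht1 - hσ2 / 2 + hA / 2 - hB / 2
    rcases mul_eq_zero.1 this with h | h
    · exact absurd h (by positivity)
    · linarith
  obtain ⟨c, hcdef⟩ : ∃ c, c = δ * (a1 * t0 - a0 * t1) := ⟨_, rfl⟩
  have hc0 : 0 ≤ c := by
    have : 2 * σ * c = δ * (a0 * b1 - a1 * b0) := by
      rw [hcdef]
      linear_combination -δ * a1 * ht0 + δ * a0 * ht1
    by_contra h
    push Not at h
    nlinarith [mul_pos hσ (neg_pos.2 h)]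
  set τ : Pt := !₂[t0, t1] with hτdef
  set v : Pt := !₂[-δ * t1, δ * t0] with hvdef
  have tz : τ 0 = t0 := by simp [hτdef]
  have tw : τ 1 = t1 := by simp [hτdef]
  have vz : v 0 = -δ * t1 := by simp [hvdef]
  have vo : v 1 = δ * t0 := by simp [hvdef]
  have eA0 : a0 = c * (-δ * t1) + σ * t0 := by
    rw [hcdef]
    linear_combination -a0 * htau + t0 * hat + (a1 * t0 - a0 * t1) * t1 * hδ2
  have eA1 : a1 = c * (δ * t0) + σ * t1 := by
    rw [hcdef]
    linear_combination -a1 * htau + t1 * hat - (a1 * t0 - a0 * t1) * t0 * hδ2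
  have eB0 : b0 = c * (-δ * t1) - σ * t0 := by linarith
  have eB1 : b1 = c * (δ * t0) - σ * t1 := by linarith
  have hcs : c ^ 2 + σ ^ 2 = 1 := by
    have := hA
    rw [eA0, eA1] at this
    linear_combination this - c ^ 2 * (t0 ^ 2 + t1 ^ 2) * hδ2 - (c ^ 2 + σ ^ 2) * htau
  have hε : (-δ) ^ 2 = 1 := by rw [neg_sq, hδ2]
  have hτ' : τ 0 ^ 2 + τ 1 ^ 2 = 1 := by rw [tz, tw, htau]
  have h0' : v 0 = -δ * τ 1 := by rw [vz, tw]
  have h1' : v 1 = -(-δ * τ 0) := by rw [vo, tz]; ring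
  have hex := frm_MS (p := p) (hε := hε) (hτ := hτ') (h0 := h0') (h1 := h1') hm hc hs
  set φ := frm p v τ (-δ) hε hτ' h0' h1' with hφ
  obtain ⟨M, hMu, hMK⟩ := hex
  have phia : ∀ t : ℝ, φ ⟨t * c, t * σ⟩ = p + t • (pa - p) := by
    intro t
    rw [hφ, frm_apply]
    ext i
    fin_cases i
    · simp [tz, vz, ← ha0]
      linear_combination -t * eA0
    · simp [tw, vo, ← ha1]
      linear_combination -t * eA1
  have phib : ∀ t : ℝ, φ ⟨t * c, -(t * σ)⟩ = p + t • (pb - p) := by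
    intro t
    rw [hφ, frm_apply]
    ext i
    fin_cases i
    · simp [tz, vz, ← hb0]
      linear_combination -t * eB0
    · simp [tw, vo, ← hb1]
      linear_combination -t * eB1
  have hp0 : φ 0 = p := frm_zero
  have phid : ∀ z, dist (φ z) p = ‖z‖ := by
    intro z
    have := frm_dist (p := p) (hε := hε) (hτ := hτ') (h0 := h0') (h1 := h1') z 0
    rw [frm_zero, sub_zero] at this
    exact this
  have c0 : ∀ z, (φ z - p) 0 = z.re * (-δ * t1) + z.im * t0 := by
    intro z; rw [hφ, frm_apply]; simp [tz, vz]; ring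
  have c1 : ∀ z, (φ z - p) 1 = z.re * (δ * t0) + z.im * t1 := by
    intro z; rw [hφ, frm_apply]; simp [tw, vo]; ring
  have cone : ∀ η : ℝ, (η = 1 ∨ η = -1) → ∀ z ∈ φ ⁻¹' Ω, 0 < σ * z.re + η * c * z.im := by
    intro η hη z hz
    rcases hη with rfl | rfl
    · have h := hdb (φ z) hz
      rw [cross2, c0, c1, hpbb, hpbb, ← hb0, ← hb1, eB0, eB1] at h
      refine h.trans_eq ?_
      linear_combination (σ * z.re + c * z.im) * (htau + (t0 ^ 2 + t1 ^ 2) * hδ2)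
    · have h := hda (φ z) hz
      rw [cross2, c0, c1, hpaa, hpaa, ← ha0, ← ha1, eA0, eA1] at h
      refine h.trans_eq ?_
      linear_combination (σ * z.re - c * z.im) * (htau + (t0 ^ 2 + t1 ^ 2) * hδ2)
  have conv : Convex ℝ {z : ℂ | ‖z‖ < r ∧ c * |z.im| < σ * z.re} := by
    have e : {z : ℂ | ‖z‖ < r ∧ c * |z.im| < σ * z.re} = ball 0 r ∩ {z : ℂ | c * |z.im| < σ * z.re} := by
      ext z; simp
    rw [e]
    refine (convex_ball 0 r).inter ?_
    intro x hx y hy α β hα hβ hαβ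
    simp only [mem_ofPred_eq] at hx hy ⊢
    simp only [Complex.add_im, Complex.add_re, Complex.real_smul, Complex.mul_im, Complex.mul_re, Complex.ofReal_re,
      Complex.ofReal_im, zero_mul, add_zero, sub_zero]
    have h1 : |α * x.im + β * y.im| ≤ α * |x.im| + β * |y.im| := by
      refine (abs_add_le _ _).trans ?_
      rw [abs_mul, abs_mul, abs_of_nonneg hα, abs_of_nonneg hβ]
    have h2 := mul_le_mul_of_nonneg_left h1 hc0
    rcases hα.eq_or_lt with h | h
    · subst h
      have : β = 1 := by linarith
      subst this
      simpa using hy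
    · have h3 := mul_lt_mul_of_pos_left hx h
      have h4 := mul_le_mul_of_nonneg_left hy.le hβ
      nlinarith
  have conb : ∀ z ∈ φ ⁻¹' Ω, c * |z.im| < σ * z.re := by
    intro z hz
    have k1 := cone 1 (Or.inl rfl) z hz
    have k2 := cone (-1) (Or.inr rfl) z hz
    rcases abs_cases z.im with h | h <;> rw [h.1] <;> linarith
  have hfull : {z : ℂ | ‖z‖ < r ∧ c * |z.im| < σ * z.re} ⊆ φ ⁻¹' Ω := by
    refine conv.isPreconnected.subset_left_of_subset_union (v := (closure (φ ⁻¹' Ω))ᶜ)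
      (ho.preimage φ.continuous) isClosed_closure.isOpen_compl ?_ ?_ ?_
    · exact disjoint_compl_right.mono_left subset_closure
    · intro z hz
      by_contra hcon
      simp only [mem_union, mem_compl_iff, not_or, not_not] at hcon
      have hfz : z ∈ frontier (φ ⁻¹' Ω) := by
        rw [(ho.preimage φ.continuous).frontier_eq]
        exact ⟨hcon.2, hcon.1⟩
      have hfz' := (frm_frontier Ω z).1 hfz
      have hz2 := hz.2
      rcases hball ⟨by rw [mem_ball]; exact (phid z).trans_lt hz.1, hfz'⟩ with h | h
      · obtain ⟨t, ht, e⟩ := seg_param h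
        rw [← phia] at e
        have e2 := φ.injective e
        rw [e2] at hz2
        simp only at hz2
        rw [abs_of_nonneg (by positivity)] at hz2
        nlinarith
      · obtain ⟨t, ht, e⟩ := seg_param h
        rw [← phib] at e
        have e2 := φ.injective e
        rw [e2] at hz2
        simp only at hz2
        rw [abs_neg, abs_of_nonneg (by positivity)] at hz2
        nlinarith
    · have h0 : (0 : ℂ) ∈ frontier (φ ⁻¹' Ω) := by
        refine (frm_frontier Ω 0).2 ?_
        rw [frm_zero]
        exact sa (left_mem_segment ℝ p pa)
      obtain ⟨z, hz, hzd⟩ := Metric.mem_closure_iff.1 h0.1 r hr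
      refine ⟨z, ⟨?_, conb z hz⟩, hz⟩
      rwa [dist_zero_left] at hzd
  obtain ⟨N, n1, n2, n3, n4, n5, n6, n7, n8, n9⟩ := M.normalize
  have V : MS.VS N r c σ := by
    refine ⟨hr, hc0, hσ, hcs, cone, fun z h1 h2 => hfull ⟨h1, h2⟩, ?_, n8, n9⟩
    intro η hη ρ hρ hρr
    rcases hη with rfl | rfl
    · have e : (⟨ρ * c, -1 * ρ * σ⟩ : ℂ) = ⟨ρ * c, -(ρ * σ)⟩ := by congr 1; ring
      rw [e]
      have h1 := eb (φ ⟨ρ * c, -(ρ * σ)⟩) (by rw [phib]; exact open_seg_param hρ (by linarith))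
      refine (h1.comp (frm_tendsto Ω _)).congr fun z => ?_
      simp only [Function.comp, n1, hMu, one_mul, ← hφ]
    · have e : (⟨ρ * c, - -1 * ρ * σ⟩ : ℂ) = ⟨ρ * c, ρ * σ⟩ := by congr 1; ring
      rw [e]
      have h1 := ea (φ ⟨ρ * c, ρ * σ⟩) (by rw [phia]; exact open_seg_param hρ (by linarith))
      refine (h1.comp (frm_tendsto Ω _)).congr fun z => ?_
      simp only [Function.comp, n1, hMu, ← hφ]
      ring
  have hx := φ.apply_symm_apply q
  have hB := V.thmB (x := φ.symm q) (show φ (φ.symm q) ∈ Ω by rwa [hx]) (by rw [← phid, hx]; exact hqr)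
  have hK := hMK (φ.symm q) (by rwa [hx])
  rw [hx] at hK
  rw [hK, ← n4, ← n5, ← n6, ← n7]
  exact hB

theorem interior_case {Ω : Set Pt} {u : Pt → ℝ} (hm : MinimalGraph Ω u) (hc : Convex ℝ Ω) {R : ℝ} (hR : 0 < R)
    {q : Pt} (hq : q ∈ Ω)
    (hfr : ∀ x ∈ frontier Ω, dist x q < R → Tendsto (fun z => |u z|) (𝓝[Ω] x) atTop) :
    |gaussK u q| ≤ 16 / R ^ 2 := by
  have hex := frm_MS (p := 0) (v := !₂[(1:ℝ), 0]) (τ := !₂[(0:ℝ), 1]) (ε := 1)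
    (hε := by norm_num) (hτ := by simp) (h0 := by simp) (h1 := by simp) hm hc (s := 1) (by norm_num)
  set φ := frm 0 (!₂[(1:ℝ), 0]) (!₂[(0:ℝ), 1]) 1 (by norm_num) (by simp) (by simp) (by simp) with hφ
  obtain ⟨M, hMu, hMK⟩ := hex
  have hx := φ.apply_symm_apply q
  have hq' : φ.symm q ∈ φ ⁻¹' Ω := show φ (φ.symm q) ∈ Ω by rwa [hx]
  have hd := M.disk hq' (R := R) (by
    intro x hxf hxd
    have h1 := (frm_frontier Ω x).1 hxf
    have h2 : dist (φ x) q < R := by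
      have : dist (φ x) (φ (φ.symm q)) = ‖x - φ.symm q‖ := frm_dist _ _
      rw [hx, ← dist_eq_norm] at this
      rwa [this]
    refine ((hfr _ h1 h2).comp (frm_tendsto Ω _)).congr fun z => ?_
    simp only [Function.comp, hMu, one_mul, ← hφ])
  have hA := M.thmA hq' hR hd
  have hK := hMK (φ.symm q) hq'
  rw [hx] at hK
  rw [hK]
  exact hA

theorem zmod_parity {n : ℕ} (hn : 2 ≤ n) (i : ZMod (2 * n)) : Even (i - 1).val ↔ ¬ Even i.val := by
  have : NeZero (2 * n) := ⟨by omega⟩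
  have key : ∀ j : ZMod (2 * n), Even j.val ↔ ZMod.castHom (Dvd.intro n rfl) (ZMod 2) j = 0 := by
    intro j
    rw [ZMod.castHom_apply, ZMod.cast_eq_val, ZMod.natCast_eq_zero_iff_even]
  rw [key, key, map_sub, map_one]
  generalize (ZMod.castHom (Dvd.intro n rfl) (ZMod 2)) i = x
  revert x
  decide

theorem zmod_ne {n : ℕ} (hn : 2 ≤ n) (i : ZMod (2 * n)) : i + 1 ≠ i - 1 := by
  intro h
  have h2 : ((2 : ℕ) : ZMod (2 * n)) = 0 := by
    push_cast
    linear_combination h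
  rw [ZMod.natCast_eq_zero_iff] at h2
  have := Nat.le_of_dvd (by norm_num) h2
  omega

/-- Uniform curvature estimate: given `r₀ > 0` there is `C > 0` bounding the Gauss
curvature of every Jenkins–Serrin graph over a non-special unit polygon each of whose
vertices `p` is such that the disk `D(p, r₀)` meets the frontier only along the two edges
ending at `p`. -/
theorem uniform_curvature_bound (r₀ : ℝ) (hr₀ : 0 < r₀) :
    ∃ C : ℝ, 0 < C ∧
      ∀ (n : ℕ) (P : UnitPolygon n), ¬ P.IsSpecial →
        (∀ i : ZMod (2 * n), Metric.ball (P.vtx i) r₀ ∩ frontier P.Ω ⊆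
          segment ℝ (P.vtx (i - 1)) (P.vtx i) ∪ segment ℝ (P.vtx i) (P.vtx (i + 1))) →
        ∀ u : Pt → ℝ, JSGraph P u → ∀ p ∈ P.Ω, |gaussK u p| ≤ C := by
  set r := min r₀ 1 with hr
  have hr0 : 0 < r := lt_min hr₀ one_pos
  refine ⟨25 * (384 / r) ^ 2 + 16 / (r / 16) ^ 2, by positivity, ?_⟩
  intro n P _ hb u hu q hq
  by_cases hv : ∃ i, dist q (P.vtx i) < r / 16
  · obtain ⟨i, hi⟩ := hv
    have hpos : 0 ≤ 16 / (r / 16) ^ 2 := by positivity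
    refine le_add_of_le_of_nonneg ?_ hpos
    have hseg : ∀ j, segment ℝ (P.vtx j) (P.vtx (j + 1)) ⊆ frontier P.Ω := by
      intro j
      rw [P.frontier_eq]
      exact subset_iUnion (fun i => segment ℝ (P.vtx i) (P.vtx (i + 1))) j
    have hprev := hseg (i - 1)
    rw [sub_add_cancel, segment_symm] at hprev
    have hpar := zmod_parity P.n_ge i
    have hd := P.unit_edges (i - 1)
    rw [sub_add_cancel, dist_comm] at hd
    have hball : ball (P.vtx i) r ∩ frontier P.Ω ⊆
        segment ℝ (P.vtx i) (P.vtx (i + 1)) ∪ segment ℝ (P.vtx i) (P.vtx (i - 1)) := by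
      rw [union_comm, segment_symm ℝ (P.vtx i) (P.vtx (i - 1))]
      exact (inter_subset_inter_left _ (ball_subset_ball (min_le_left _ _))).trans (hb i)
    have hne : P.vtx (i + 1) ≠ P.vtx (i - 1) := fun h => zmod_ne P.n_ge i (P.inj h)
    have hE := hu.2 i
    have hE' := hu.2 (i - 1)
    rw [sub_add_cancel, openSegment_symm] at hE'
    by_cases he : Even i.val
    · refine vertex_case hu.1 P.convex (P.unit_edges i) hd hne (hseg i) hprev hr0 (min_le_right _ _) hball
        (s := -1) (by norm_num) ?_ ?_ hq hi
      · intro t ht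
        simpa using (hE t ht).1 he
      · intro t ht
        have := (hE' t ht).2 (by rw [hpar]; simpa using he)
        simpa using this
    · refine vertex_case hu.1 P.convex (P.unit_edges i) hd hne (hseg i) hprev hr0 (min_le_right _ _) hball
        (s := 1) (by norm_num) ?_ ?_ hq hi
      · intro t ht
        have := (hE t ht).2 he
        simpa using this
      · intro t ht
        have := (hE' t ht).1 (by rw [hpar]; exact he)
        simpa using this
  · push Not at hv
    have hpos : 0 ≤ 25 * (384 / r) ^ 2 := by positivity
    refine le_add_of_nonneg_of_le hpos ?_
    refine interior_case hu.1 P.convex (by positivity) hq ?_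
    intro x hx hxd
    rw [P.frontier_eq] at hx
    obtain ⟨i, hi⟩ := mem_iUnion.1 hx
    have hne : ∀ j, P.vtx j ≠ x := by
      rintro j rfl
      have := hv j
      rw [dist_comm] at this
      linarith
    have ho := mem_openSegment_of_ne_left_right (hne i) (hne (i + 1)) hi
    by_cases he : Even i.val
    · exact tendsto_abs_atTop_atTop.comp ((hu.2 i x ho).1 he)
    · exact tendsto_abs_atBot_atTop.comp ((hu.2 i x ho).2 he)
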